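/- arXiv:math/0604300 — 3 statements merged into one kernel-verified Lean document; each statement's English description precedes it below -/
import Mathlib

section
/- Let F be a field with |F| ≥ 3 and n ≥ 2. Then Sp_{2n}(F) is the universal completion of the amalgam A_{≤2} = {P_J : J ⊆ I, |J| ≤ 2} of parabolic subgroups of rank at most 2. Precisely: (i) Sp_{2n}(F) is generated by the union of the subgroups P_J with |J| ≤ 2; and (ii) for every group K and every family of homomorphisms f_J : P_J → K (J ⊆ I, |J| ≤ 2) such that f_J restricts to f_{J'} on P_{J'} whenever J' ⊆ J (note P_{J'} ≤ P_J in that case), there exists a unique group homomorphism Φ : Sp_{2n}(F) → K restricting to f_J on P_J for every J with |J| ≤ 2. -/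
open Matrix

def Smat (F : Type) [Field F] (m : ℕ) : Matrix (Fin m) (Fin m) F :=
  Matrix.of fun i j =>
    if (i : ℕ) % 2 = 0 ∧ (j : ℕ) = (i : ℕ) + 1 then 1
    else if (j : ℕ) % 2 = 0 ∧ (i : ℕ) = (j : ℕ) + 1 then -1 else 0

/-- `V = F^{2n}`. -/
abbrev Vn (F : Type) [Field F] (n : ℕ) := Fin (2*n) → F

/-- The standard symplectic form `s` on `F^{2n}`:
`s(h_{2i−1}, h_{2i}) = 1 = −s(h_{2i}, h_{2i−1})`, all other pairs of basis vectors orthogonal. -/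
def sB (F : Type) [Field F] (n : ℕ) (v w : Vn F n) : F :=
  ∑ i, ∑ j, v i * Smat F (2*n) i j * w j

/-- `Sp_{2n}(F)`: the group of linear automorphisms of `V = F^{2n}` preserving `s`. -/
def SpV (F : Type) [Field F] (n : ℕ) : Subgroup ((Vn F n) ≃ₗ[F] (Vn F n)) where
  carrier := {g | ∀ v w, sB F n (g v) (g w) = sB F n v w}
  one_mem' := by intro v w; rfl
  mul_mem' := by
    intro a b ha hb v w
    have h : ∀ x, (a * b) x = a (b x) := fun x => rfl
    rw [h, h, ha, hb]
  inv_mem' := by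
    intro a ha v w
    have h1 := ha (a⁻¹ v) (a⁻¹ w)
    have h2 : a (a⁻¹ v) = v := by
      have := congrArg (fun (e : (Vn F n) ≃ₗ[F] (Vn F n)) => e v) (mul_inv_cancel a)
      exact this
    have h3 : a (a⁻¹ w) = w := by
      have := congrArg (fun (e : (Vn F n) ≃ₗ[F] (Vn F n)) => e w) (mul_inv_cancel a)
      exact this
    rw [h2, h3] at h1
    exact h1.symm

/-- `C_l = span(h₁, …, h_l)` (0-based: span of the `Pi.single k 1`, `k < l`). -/
def Cl (F : Type) [Field F] (n l : ℕ) : Submodule F (Vn F n) :=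
  Submodule.span F {v | ∃ k : Fin (2*n), (k : ℕ) < l ∧ v = Pi.single k 1}

/-- The subgroup of linear automorphisms stabilizing `C_l` for every `l ∈ T`. -/
def chFix (F : Type) [Field F] (n : ℕ) (T : Set ℕ) : Subgroup ((Vn F n) ≃ₗ[F] (Vn F n)) where
  carrier := {g | ∀ l ∈ T, Submodule.map (g : Vn F n →ₗ[F] Vn F n) (Cl F n l) = Cl F n l}
  one_mem' := by
    intro l _
    have : ((1 : (Vn F n) ≃ₗ[F] (Vn F n)) : Vn F n →ₗ[F] Vn F n) = LinearMap.id := rfl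
    rw [this, Submodule.map_id]
  mul_mem' := by
    intro a b ha hb l hl
    have h : ((a * b : (Vn F n) ≃ₗ[F] (Vn F n)) : Vn F n →ₗ[F] Vn F n) =
        (a : Vn F n →ₗ[F] Vn F n).comp (b : Vn F n →ₗ[F] Vn F n) := rfl
    rw [h, Submodule.map_comp, hb l hl, ha l hl]
  inv_mem' := by
    intro a ha l hl
    have h3 : Submodule.map ((a⁻¹ : (Vn F n) ≃ₗ[F] (Vn F n)) : Vn F n →ₗ[F] Vn F n)
        (Submodule.map (a : Vn F n →ₗ[F] Vn F n) (Cl F n l)) = Cl F n l := by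
      rw [← Submodule.map_comp]
      have h4 : ((a⁻¹ : (Vn F n) ≃ₗ[F] (Vn F n)) : Vn F n →ₗ[F] Vn F n).comp
          (a : Vn F n →ₗ[F] Vn F n) = LinearMap.id :=
        LinearMap.ext fun v =>
          congrArg (fun (e : (Vn F n) ≃ₗ[F] (Vn F n)) => e v) (inv_mul_cancel a)
      rw [h4, Submodule.map_id]
    rw [ha l hl] at h3
    exact h3

/-- The parabolic subgroup `P_J = {g ∈ Sp_{2n}(F) : g C_l = C_l for all l ∈ I − J}`,
where `I = {1, …, 2n−1}`. -/
def Par (F : Type) [Field F] (n : ℕ) (J : Finset ℕ) : Subgroup ((Vn F n) ≃ₗ[F] (Vn F n)) :=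
  SpV F n ⊓ chFix F n {l | l ∈ Finset.Icc 1 (2*n-1) ∧ l ∉ J}

theorem Par_le_SpV (F : Type) [Field F] (n : ℕ) (J : Finset ℕ) : Par F n J ≤ SpV F n :=
  inf_le_left

theorem Par_mono (F : Type) [Field F] (n : ℕ) {J J' : Finset ℕ} (h : J ⊆ J') :
    Par F n J ≤ Par F n J' := by
  refine inf_le_inf_left _ ?_
  intro g hg l hl
  exact hg l ⟨hl.1, fun hmem => hl.2 (h hmem)⟩

namespace SpAmalgam

variable {F : Type} [Field F] {n : ℕ}

/-! ### The symplectic form -/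

theorem sB_add_left (u v w : Vn F n) : sB F n (u + v) w = sB F n u w + sB F n v w := by
  simp only [sB, Pi.add_apply, add_mul, Finset.sum_add_distrib]

theorem sB_add_right (u v w : Vn F n) : sB F n u (v + w) = sB F n u v + sB F n u w := by
  simp only [sB, Pi.add_apply, mul_add, Finset.sum_add_distrib]

theorem sB_smul_left (c : F) (v w : Vn F n) : sB F n (c • v) w = c * sB F n v w := by
  simp only [sB, Pi.smul_apply, smul_eq_mul, Finset.mul_sum, mul_assoc]

theorem sB_smul_right (c : F) (v w : Vn F n) : sB F n v (c • w) = c * sB F n v w := by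
  simp only [sB, Pi.smul_apply, smul_eq_mul, Finset.mul_sum]
  exact Finset.sum_congr rfl fun i _ => Finset.sum_congr rfl fun j _ => by ring

theorem sB_zero_left (w : Vn F n) : sB F n 0 w = 0 := by simp [sB]

theorem sB_zero_right (w : Vn F n) : sB F n w 0 = 0 := by simp [sB]

theorem sB_neg_left (v w : Vn F n) : sB F n (-v) w = -sB F n v w := by
  rw [← neg_one_smul F v, sB_smul_left, neg_one_mul]

theorem sB_neg_right (v w : Vn F n) : sB F n v (-w) = -sB F n v w := by
  rw [← neg_one_smul F w, sB_smul_right, neg_one_mul]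

theorem sB_sub_left (u v w : Vn F n) : sB F n (u - v) w = sB F n u w - sB F n v w := by
  rw [sub_eq_add_neg, sB_add_left, sB_neg_left, sub_eq_add_neg]

theorem sB_sub_right (u v w : Vn F n) : sB F n u (v - w) = sB F n u v - sB F n u w := by
  rw [sub_eq_add_neg, sB_add_right, sB_neg_right, sub_eq_add_neg]

theorem Smat_swap (m : ℕ) (i j : Fin m) : Smat F m i j = -Smat F m j i := by
  simp only [Smat, Matrix.of_apply]
  split_ifs <;> first | omega | simp

theorem Smat_self (m : ℕ) (i : Fin m) : Smat F m i i = 0 := by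
  simp only [Smat, Matrix.of_apply]
  split_ifs <;> first | omega | simp

theorem sB_swap (v w : Vn F n) : sB F n v w = -sB F n w v := by
  unfold sB
  rw [Finset.sum_comm, ← Finset.sum_neg_distrib]
  refine Finset.sum_congr rfl fun i _ => ?_
  rw [← Finset.sum_neg_distrib]
  refine Finset.sum_congr rfl fun j _ => ?_
  rw [Smat_swap]
  ring

theorem sB_self (v : Vn F n) : sB F n v v = 0 := by
  unfold sB
  rw [← Finset.sum_product']
  refine Finset.sum_involution (fun p _ => (p.2, p.1)) ?_ ?_ ?_ ?_
  · rintro ⟨i, j⟩ -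
    simp only
    rw [Smat_swap]
    ring
  · rintro ⟨i, j⟩ - h heq
    simp only [Prod.mk.injEq] at heq
    rw [heq.1] at h
    exact h (by simp [Smat_self])
  · simp
  · simp

/-- The form as a linear map in its second argument. -/
def sLin (w : Vn F n) : Vn F n →ₗ[F] F where
  toFun := sB F n w
  map_add' := sB_add_right w
  map_smul' c v := sB_smul_right c w v

/-! ### The standard basis -/

/-- The standard basis vectors, indexed by `ℕ` and extended by zero. -/
def hv (F : Type) [Field F] (n k : ℕ) : Vn F n := fun i => if (i : ℕ) = k then 1 else 0

theorem hv_eq_single (i : Fin (2 * n)) : hv F n i = Pi.single i 1 := by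
  ext j
  simp [hv, Pi.single_apply, Fin.ext_iff]

theorem sB_hv (k : Fin (2 * n)) (v : Vn F n) : sB F n (hv F n k) v = ∑ j, Smat F (2 * n) k j * v j := by
  unfold sB
  rw [Finset.sum_eq_single k]
  · simp [hv]
  · intro b _ hb
    simp [hv, Fin.val_ne_of_ne hb]
  · simp

theorem sB_hv_even {k : ℕ} (hk : k % 2 = 0) (hk' : k + 1 < 2 * n) (v : Vn F n) :
    sB F n (hv F n k) v = v ⟨k + 1, hk'⟩ := by
  have := sB_hv (F := F) (⟨k, by omega⟩ : Fin (2 * n)) v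
  simp only at this
  rw [this, Finset.sum_eq_single ⟨k + 1, hk'⟩]
  · simp [Smat, hk]
  · intro b _ hb
    have : (b : ℕ) ≠ k + 1 := fun h => hb (Fin.ext h)
    simp only [Smat, Matrix.of_apply]
    split_ifs <;> first | omega | simp
  · simp

theorem sB_hv_odd {k : ℕ} (hk : k % 2 = 0) (hk' : k + 1 < 2 * n) (v : Vn F n) :
    sB F n (hv F n (k + 1)) v = -v ⟨k, by omega⟩ := by
  have := sB_hv (F := F) (⟨k + 1, by omega⟩ : Fin (2 * n)) v
  simp only at this
  rw [this, Finset.sum_eq_single ⟨k, by omega⟩]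
  · have h1 : (k + 1) % 2 ≠ 0 := by omega
    simp [Smat, hk, h1]
  · intro b _ hb
    have : (b : ℕ) ≠ k := fun h => hb (Fin.ext h)
    simp only [Smat, Matrix.of_apply]
    split_ifs <;> first | omega | simp
  · simp

theorem hv_of_le {k : ℕ} (hk : 2 * n ≤ k) : hv F n k = 0 := by
  ext i
  simp only [hv, Pi.zero_apply, ite_eq_right_iff, one_ne_zero, imp_false]
  omega

theorem sB_hv_pair {k : ℕ} (hk : k % 2 = 0) (hk' : k + 1 < 2 * n) :
    sB F n (hv F n k) (hv F n (k + 1)) = 1 := by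
  rw [sB_hv_even hk hk']
  simp [hv]

theorem sB_hv_hv_eq_zero {k m : ℕ} (h : k / 2 ≠ m / 2 ∨ k = m) :
    sB F n (hv F n k) (hv F n m) = 0 := by
  rcases le_or_gt (2 * n) k with hk | hk
  · rw [hv_of_le hk, sB_zero_left]
  rcases Nat.mod_two_eq_zero_or_one k with h2 | h2
  · rw [sB_hv_even h2 (by omega)]
    simp only [hv, ite_eq_right_iff, one_ne_zero, imp_false]
    omega
  · obtain ⟨k, rfl⟩ : ∃ k', k = k' + 1 := ⟨k - 1, by omega⟩
    rw [sB_hv_odd (by omega) hk]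
    simp only [hv, neg_eq_zero, ite_eq_right_iff, one_ne_zero, imp_false]
    omega

/-! ### The standard flag -/

theorem hv_mem_Cl {k l : ℕ} (h : k < l) : hv F n k ∈ Cl F n l := by
  rcases le_or_gt (2 * n) k with hk | hk
  · rw [hv_of_le hk]
    exact zero_mem _
  · exact Submodule.subset_span ⟨⟨k, hk⟩, h, hv_eq_single (⟨k, hk⟩ : Fin (2 * n))⟩

theorem mem_Cl {l : ℕ} {v : Vn F n} : v ∈ Cl F n l ↔ ∀ i : Fin (2 * n), l ≤ i → v i = 0 := by
  constructor
  · intro h i hi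
    induction h using Submodule.span_induction with
    | mem x hx =>
      obtain ⟨k, hk, rfl⟩ := hx
      rw [Pi.single_apply, if_neg]
      rintro rfl
      omega
    | zero => rfl
    | add x y _ _ hx hy => simp [hx, hy]
    | smul c x _ hx => simp [hx]
  · intro h
    rw [pi_eq_sum_univ' v]
    refine Submodule.sum_mem _ fun i _ => ?_
    rcases lt_or_ge (i : ℕ) l with hi | hi
    · refine Submodule.smul_mem _ _ ?_
      have := hv_mem_Cl (F := F) (n := n) hi
      rwa [hv_eq_single] at this
    · rw [h i hi, zero_smul]
      exact zero_mem _

theorem Cl_mono {k l : ℕ} (h : k ≤ l) : Cl F n k ≤ Cl F n l :=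
  Submodule.span_mono fun _ ⟨i, hi, hv⟩ => ⟨i, hi.trans_le h, hv⟩

theorem Cl_zero : Cl F n 0 = ⊥ := by
  rw [eq_bot_iff]
  intro v hv
  ext i
  exact mem_Cl.1 hv i (Nat.zero_le _)

theorem Cl_top {l : ℕ} (h : 2 * n ≤ l) : Cl F n l = ⊤ := by
  rw [eq_top_iff]
  intro v _
  exact mem_Cl.2 fun i hi => absurd i.2 (by omega)

/-- A vector of `C_{l+1}` is congruent to a multiple of `h_{l+1}` modulo `C_l`. -/
theorem exists_sub_smul_mem_Cl {l : ℕ} {v : Vn F n} (h : v ∈ Cl F n (l + 1)) :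
    ∃ c : F, v - c • hv F n l ∈ Cl F n l ∧ (v ∉ Cl F n l → c ≠ 0) := by
  rw [mem_Cl] at h
  rcases le_or_gt (2 * n) l with hl | hl
  · refine ⟨1, by rw [Cl_top hl]; trivial, fun _ => one_ne_zero⟩
  refine ⟨v ⟨l, hl⟩, ?_, fun hv h0 => hv ?_⟩
  · rw [mem_Cl]
    intro i hi
    rcases eq_or_lt_of_le hi with h1 | h1
    · obtain rfl : i = ⟨l, hl⟩ := Fin.ext h1.symm
      simp [hv]
    · simp [hv, h i h1, h1.ne']
  · rw [mem_Cl]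
    intro i hi
    rcases eq_or_lt_of_le hi with h1 | h1
    · obtain rfl : i = ⟨l, hl⟩ := Fin.ext h1.symm
      exact h0
    · exact h i h1

/-! ### The subspaces `C_c^⊥ ∩ C_b` -/

/-- The subspace `C_c^⊥ ∩ C_b`. -/
def perpCl (F : Type) [Field F] (n c b : ℕ) : Submodule F (Vn F n) where
  carrier := {v | (∀ k < c, sB F n (hv F n k) v = 0) ∧ v ∈ Cl F n b}
  zero_mem' := ⟨fun _ _ => sB_zero_right _, zero_mem _⟩
  add_mem' h1 h2 := ⟨fun k hk => by rw [sB_add_right, h1.1 k hk, h2.1 k hk, add_zero],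
    add_mem h1.2 h2.2⟩
  smul_mem' c v h := ⟨fun k hk => by rw [sB_smul_right, h.1 k hk, mul_zero],
    Submodule.smul_mem _ _ h.2⟩

theorem perpCl_mono {c c' b b' : ℕ} (hc : c' ≤ c) (hb : b ≤ b') :
    perpCl F n c b ≤ perpCl F n c' b' :=
  fun _ h => ⟨fun k hk => h.1 k (hk.trans_le hc), Cl_mono hb h.2⟩

theorem perpCl_succ {c b : ℕ} {v : Vn F n} (h : v ∈ perpCl F n c b)
    (h0 : sB F n (hv F n c) v = 0) : v ∈ perpCl F n (c + 1) b := by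
  refine ⟨fun k hk => ?_, h.2⟩
  rcases Nat.lt_succ_iff_lt_or_eq.1 hk with hk | rfl
  · exact h.1 k hk
  · exact h0

theorem sB_eq_zero_of_mem {c b : ℕ} {u v : Vn F n} (hu : u ∈ Cl F n c)
    (h : v ∈ perpCl F n c b) : sB F n u v = 0 := by
  induction hu using Submodule.span_induction with
  | mem x hx =>
    obtain ⟨k, hk, rfl⟩ := hx
    rw [← hv_eq_single]
    exact h.1 k hk
  | zero => exact sB_zero_left v
  | add x y _ _ hx hy => rw [sB_add_left, hx, hy, add_zero]
  | smul c x _ hx => rw [sB_smul_left, hx, mul_zero]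

theorem hv_mem_perpCl {k c b : ℕ} (hb : k < b) (h : c ≤ 2 * (k / 2) ∨ c ≤ k + 1 ∧ k % 2 = 0) :
    hv F n k ∈ perpCl F n c b := by
  refine ⟨fun j hj => sB_hv_hv_eq_zero ?_, hv_mem_Cl hb⟩
  omega

/-- `C_c^⊥ ∩ C_{c+1}` is spanned by `h_{c+1}` when `c` is even. -/
theorem eq_smul_of_mem_perpCl {c b : ℕ} (hc : c % 2 = 0) {v : Vn F n}
    (h : v ∈ perpCl F n c b) (h' : v ∈ Cl F n (c + 1)) : ∃ r : F, v = r • hv F n c := by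
  obtain ⟨r, hr, -⟩ := exists_sub_smul_mem_Cl h'
  refine ⟨r, sub_eq_zero.1 ?_⟩
  ext i
  rcases le_or_gt c i with hi | hi
  · exact mem_Cl.1 hr i hi
  obtain ⟨k, hk⟩ := i
  simp only at hi
  have hne : k ≠ c := hi.ne
  simp only [Pi.sub_apply, Pi.smul_apply, hv, hne, if_false, smul_zero, sub_zero, Pi.zero_apply]
  rcases Nat.mod_two_eq_zero_or_one k with h2 | h2
  · have := h.1 (k + 1) (by omega)
    rwa [sB_hv_odd h2 (by omega), neg_eq_zero] at this
  · obtain ⟨k, rfl⟩ : ∃ k', k = k' + 1 := ⟨k - 1, by omega⟩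
    have := h.1 k (by omega)
    rwa [sB_hv_even (by omega) hk] at this

/-- Splitting off the hyperbolic plane `⟨h_{c+1}, h_{c+2}⟩`, `c` even. -/
theorem exists_perpCl_decomp {c b : ℕ} (hc : c % 2 = 0) (hb : c + 1 < b) (hn : c + 1 < 2 * n)
    {v : Vn F n} (h : v ∈ perpCl F n c b) :
    ∃ x y : F, v - x • hv F n c - y • hv F n (c + 1) ∈ perpCl F n (c + 2) b := by
  have e1 : hv F n c ∈ perpCl F n c b := hv_mem_perpCl (by omega) (by omega)
  have e2 : hv F n (c + 1) ∈ perpCl F n c b := hv_mem_perpCl (by omega) (by omega)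
  refine ⟨-sB F n (hv F n (c + 1)) v, sB F n (hv F n c) v, perpCl_succ (perpCl_succ ?_ ?_) ?_⟩
  · exact sub_mem (sub_mem h (Submodule.smul_mem _ _ e1)) (Submodule.smul_mem _ _ e2)
  · simp only [sB_sub_right, sB_smul_right, sB_self, sB_hv_pair hc hn]
    ring
  · simp only [sB_sub_right, sB_smul_right, sB_self, sB_swap (hv F n (c + 1)) (hv F n c),
      sB_hv_pair hc hn]
    ring

/-! ### Avoiding hyperplanes -/

theorem exists_ne_ne {α : Type} (hF : 2 < Cardinal.mk α) (a b : α) : ∃ c : α, c ≠ a ∧ c ≠ b := by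
  by_contra! h
  have h1 : (Set.univ : Set α) ⊆ {a, b} := fun c _ => by
    by_cases hc : c = a
    · exact Or.inl hc
    · exact Or.inr (h c hc)
  have h2 : Cardinal.mk (Set.univ : Set α) ≤ 2 :=
    (Cardinal.mk_le_mk_of_subset h1).trans
      ((Cardinal.mk_insert_le).trans (by rw [Cardinal.mk_singleton]; norm_num))
  rw [Cardinal.mk_univ] at h2
  exact absurd hF (not_lt.2 h2)

theorem exists_mem_ne_zero₂ {V : Type*} [AddCommGroup V] [Module F V] (W : Submodule F V)
    {f g : V →ₗ[F] F} (hf : ∃ x ∈ W, f x ≠ 0) (hg : ∃ x ∈ W, g x ≠ 0) :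
    ∃ x ∈ W, f x ≠ 0 ∧ g x ≠ 0 := by
  obtain ⟨x, hx, hfx⟩ := hf
  obtain ⟨y, hy, hgy⟩ := hg
  by_cases h1 : g x = 0
  · by_cases h2 : f y = 0
    · exact ⟨x + y, add_mem hx hy, by simpa [h2] using hfx, by simpa [h1] using hgy⟩
    · exact ⟨y, hy, h2, hgy⟩
  · exact ⟨x, hx, hfx, h1⟩

theorem exists_mem_ne_zero₃ (hF : 2 < Cardinal.mk F) {V : Type*} [AddCommGroup V] [Module F V]
    (W : Submodule F V) {f g h : V →ₗ[F] F} (hf : ∃ x ∈ W, f x ≠ 0) (hg : ∃ x ∈ W, g x ≠ 0)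
    (hh : ∃ x ∈ W, h x ≠ 0) : ∃ x ∈ W, f x ≠ 0 ∧ g x ≠ 0 ∧ h x ≠ 0 := by
  obtain ⟨x, hx, hfx, hgx⟩ := exists_mem_ne_zero₂ W hf hg
  by_cases h1 : h x = 0
  · obtain ⟨y, hy, hhy⟩ := hh
    obtain ⟨c, hc1, hc2⟩ := exists_ne_ne hF (-f y / f x) (-g y / g x)
    refine ⟨y + c • x, add_mem hy (W.smul_mem c hx), fun h => hc1 ?_, fun h => hc2 ?_, ?_⟩
    · rw [eq_div_iff hfx]
      simp only [map_add, map_smul, smul_eq_mul] at h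
      linear_combination h
    · rw [eq_div_iff hgx]
      simp only [map_add, map_smul, smul_eq_mul] at h
      linear_combination h
    · simpa [h1] using hhy
  · exact ⟨x, hx, hfx, hgx, h1⟩

/-! ### Stabilizers of the members of the flag -/

/-- The stabilizer of `C_l`. -/
abbrev stab (F : Type) [Field F] (n l : ℕ) : Subgroup (Vn F n ≃ₗ[F] Vn F n) := chFix F n {l}

theorem mem_stab {l : ℕ} {g : Vn F n ≃ₗ[F] Vn F n} :
    g ∈ stab F n l ↔ ∀ v ∈ Cl F n l, g v ∈ Cl F n l := by
  constructor
  · intro h v hv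
    have := h l rfl
    rw [← this]
    exact ⟨v, hv, rfl⟩
  · rintro h _ rfl
    refine Submodule.eq_of_le_of_finrank_eq ?_ ?_
    · rintro _ ⟨v, hv, rfl⟩
      exact h v hv
    · exact LinearEquiv.finrank_map_eq g _

theorem mem_Par {J : Finset ℕ} {g : Vn F n ≃ₗ[F] Vn F n} :
    g ∈ Par F n J ↔ g ∈ SpV F n ∧ ∀ l ∉ J, g ∈ stab F n l := by
  refine and_congr_right fun _ => ⟨fun h l hl => ?_, fun h l hl => h l hl.2 l rfl⟩
  rcases Nat.eq_zero_or_pos l with rfl | h0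
  · rw [mem_stab, Cl_zero]
    rintro v rfl
    exact (Submodule.mem_bot F).2 (map_zero g)
  rcases le_or_gt (2 * n) l with h1 | h1
  · rw [mem_stab, Cl_top h1]
    exact fun _ _ => trivial
  rintro _ rfl
  exact h _ ⟨Finset.mem_Icc.2 ⟨h0, by omega⟩, hl⟩

theorem Par_erase {J : Finset ℕ} {l : ℕ} {g : Vn F n ≃ₗ[F] Vn F n} (h : g ∈ Par F n J)
    (h' : g ∈ stab F n l) : g ∈ Par F n (J.erase l) := by
  rw [mem_Par] at *
  refine ⟨h.1, fun k hk => ?_⟩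
  rw [Finset.mem_erase, not_and_or, not_not] at hk
  rcases hk with rfl | hk
  · exact h'
  · exact h.2 k hk

theorem inv_apply_self (g : Vn F n ≃ₗ[F] Vn F n) (v : Vn F n) : g⁻¹ (g v) = v :=
  g.symm_apply_apply v

theorem apply_inv_self (g : Vn F n ≃ₗ[F] Vn F n) (v : Vn F n) : g (g⁻¹ v) = v :=
  g.apply_symm_apply v

theorem sB_map {g : Vn F n ≃ₗ[F] Vn F n} (h : g ∈ SpV F n) (v w : Vn F n) :
    sB F n (g v) (g w) = sB F n v w := h v w

theorem sB_map_right {g : Vn F n ≃ₗ[F] Vn F n} (h : g ∈ SpV F n) (v w : Vn F n) :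
    sB F n v (g w) = sB F n (g⁻¹ v) w := by
  rw [← sB_map h (g⁻¹ v), apply_inv_self]

theorem map_mem_perpCl {g : Vn F n ≃ₗ[F] Vn F n} {c b : ℕ} (h : g ∈ SpV F n)
    (hc : g ∈ stab F n c) (hb : g ∈ stab F n b) {v : Vn F n} (h1 : v ∈ perpCl F n c b) :
    g v ∈ perpCl F n c b := by
  refine ⟨fun k hk => ?_, mem_stab.1 hb v h1.2⟩
  rw [sB_map_right h]
  exact sB_eq_zero_of_mem (mem_stab.1 (inv_mem hc) _ (hv_mem_Cl hk)) h1

theorem stab_succ {g : Vn F n ≃ₗ[F] Vn F n} {l : ℕ} (h : g ∈ stab F n l)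
    (h' : g (hv F n l) ∈ Cl F n (l + 1)) : g ∈ stab F n (l + 1) := by
  rw [mem_stab] at *
  intro v h2
  obtain ⟨c, hc, -⟩ := exists_sub_smul_mem_Cl h2
  have h1 : g v = g (v - c • hv F n l) + c • g (hv F n l) := by
    rw [map_sub, map_smul, sub_add_cancel]
  rw [h1]
  exact add_mem (Cl_mono (Nat.le_succ l) (h _ hc)) (Submodule.smul_mem _ _ h')

/-! ### Transvections -/

theorem transvection_cancel (w : Vn F n) {c d : F} (h : d + c = 0) (v : Vn F n) :
    (v + (c * sB F n w v) • w) + (d * sB F n w (v + (c * sB F n w v) • w)) • w = v := by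
  rw [sB_add_right, sB_smul_right, sB_self, mul_zero, add_zero, add_assoc, ← add_smul,
    ← add_mul, add_comm c d, h, zero_mul, zero_smul, add_zero]

/-- The symplectic transvection `v ↦ v + c s(w, v) w`. -/
def transvection (w : Vn F n) (c : F) : Vn F n ≃ₗ[F] Vn F n where
  toFun v := v + (c * sB F n w v) • w
  map_add' u v := by
    rw [sB_add_right, mul_add, add_smul]
    abel
  map_smul' r v := by
    rw [sB_smul_right, RingHom.id_apply, smul_add, smul_smul, mul_left_comm]
  invFun v := v + (-c * sB F n w v) • w
  left_inv := transvection_cancel w (neg_add_cancel c)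
  right_inv := transvection_cancel w (add_neg_cancel c)

theorem transvection_apply (w : Vn F n) (c : F) (v : Vn F n) :
    transvection w c v = v + (c * sB F n w v) • w := rfl

theorem transvection_mem_SpV (w : Vn F n) (c : F) : transvection w c ∈ SpV F n := by
  intro u v
  simp only [transvection_apply, sB_add_left, sB_add_right, sB_smul_left, sB_smul_right, sB_self,
    sB_swap u w]
  ring

/-- The group generated by the transvections along vectors of `C_c^⊥ ∩ C_b`. -/
def tvGroup (F : Type) [Field F] (n c b : ℕ) : Subgroup (Vn F n ≃ₗ[F] Vn F n) :=
  Subgroup.closure {g | ∃ w ∈ perpCl F n c b, ∃ r, g = transvection w r}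

theorem transvection_mem {c b : ℕ} {w : Vn F n} (h : w ∈ perpCl F n c b) (r : F) :
    transvection w r ∈ tvGroup F n c b := Subgroup.subset_closure ⟨w, h, r, rfl⟩

theorem tvGroup_mono {c c' b b' : ℕ} (hc : c' ≤ c) (hb : b ≤ b') :
    tvGroup F n c b ≤ tvGroup F n c' b' :=
  Subgroup.closure_mono fun _ ⟨w, hw, h⟩ => ⟨w, perpCl_mono hc hb hw, h⟩

theorem tvGroup_le_SpV (c b : ℕ) : tvGroup F n c b ≤ SpV F n := by
  refine (Subgroup.closure_le _).2 ?_
  rintro _ ⟨w, -, r, rfl⟩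
  exact transvection_mem_SpV w r

theorem tvGroup_fix {c b : ℕ} {g : Vn F n ≃ₗ[F] Vn F n} (hg : g ∈ tvGroup F n c b)
    {u : Vn F n} (hu : u ∈ Cl F n c) : g u = u := by
  induction hg using Subgroup.closure_induction with
  | mem x hx =>
    obtain ⟨w, hw, r, rfl⟩ := hx
    rw [transvection_apply, sB_swap, sB_eq_zero_of_mem hu hw]
    simp
  | one => rfl
  | mul x y _ _ hx hy => rw [LinearEquiv.mul_apply, hy, hx]
  | inv x _ hx => nth_rw 1 [← hx]; exact inv_apply_self x u

theorem tvGroup_sub_mem {c b : ℕ} {g : Vn F n ≃ₗ[F] Vn F n} (hg : g ∈ tvGroup F n c b)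
    (u : Vn F n) : g u - u ∈ perpCl F n c b := by
  induction hg using Subgroup.closure_induction generalizing u with
  | mem x hx =>
    obtain ⟨w, hw, r, rfl⟩ := hx
    rw [transvection_apply, add_sub_cancel_left]
    exact Submodule.smul_mem _ _ hw
  | one => exact (sub_self u).symm ▸ zero_mem _
  | mul x y _ _ hx hy =>
    have := add_mem (hx (y u)) (hy u)
    rwa [sub_add_sub_cancel] at this
  | inv x _ hx =>
    have := neg_mem (hx (x⁻¹ u))
    rwa [apply_inv_self, neg_sub] at this

theorem tvGroup_map_mem {c b : ℕ} {g : Vn F n ≃ₗ[F] Vn F n} (hg : g ∈ tvGroup F n c b)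
    {M : Submodule F (Vn F n)} (hM : perpCl F n c b ≤ M) {u : Vn F n} (hu : u ∈ M) : g u ∈ M := by
  have := add_mem (hM (tvGroup_sub_mem hg u)) hu
  rwa [sub_add_cancel] at this

theorem tvGroup_le_stab {c b l : ℕ} (h : l ≤ c ∨ b ≤ l) : tvGroup F n c b ≤ stab F n l := by
  intro g hg
  rw [mem_stab]
  intro v hv
  rcases h with h | h
  · rwa [tvGroup_fix hg (Cl_mono h hv)]
  · exact tvGroup_map_mem hg (fun w hw => Cl_mono h hw.2) hv

theorem tvGroup_le_Par {c b : ℕ} {J : Finset ℕ} (h : ∀ l, c < l → l < b → l ∈ J) :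
    tvGroup F n c b ≤ Par F n J := by
  intro g hg
  refine mem_Par.2 ⟨tvGroup_le_SpV c b hg, fun l hl => tvGroup_le_stab ?_ hg⟩
  by_contra! h1
  exact hl (h l h1.1 h1.2)

/-! ### Transitivity properties of groups of transvections -/

theorem exists_transvection_eq {c b : ℕ} {u v : Vn F n} (h : v - u ∈ perpCl F n c b)
    (h0 : sB F n u v ≠ 0) : ∃ g ∈ tvGroup F n c b, g u = v := by
  refine ⟨transvection (v - u) (sB F n v u)⁻¹, transvection_mem h _, ?_⟩
  have h1 : sB F n v u ≠ 0 := by rwa [sB_swap, neg_ne_zero]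
  rw [transvection_apply, sB_sub_left, sB_self, sub_zero, inv_mul_cancel₀ h1, one_smul,
    add_sub_cancel]

theorem exists_tvGroup_eq {c b : ℕ} {u v : Vn F n} (hu : u ∈ perpCl F n c b)
    (hv : v ∈ perpCl F n c b) (hu0 : ∃ t ∈ perpCl F n c b, sB F n u t ≠ 0)
    (hv0 : ∃ t ∈ perpCl F n c b, sB F n v t ≠ 0) : ∃ g ∈ tvGroup F n c b, g u = v := by
  obtain ⟨z, hz, h1, h2⟩ := exists_mem_ne_zero₂ (perpCl F n c b) (f := sLin u) (g := sLin v) hu0 hv0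
  obtain ⟨g, hg, rfl⟩ := exists_transvection_eq (sub_mem hz hu) h1
  obtain ⟨g', hg', h⟩ := exists_transvection_eq (sub_mem hv hz)
    (by rw [sB_swap, neg_ne_zero]; exact h2)
  exact ⟨g' * g, mul_mem hg' hg, h⟩

theorem exists_tvGroup_eq_of_hyperbolic {c b : ℕ} (hc : c % 2 = 0) (hb : c < b) {u v : Vn F n}
    (h : v - u ∈ perpCl F n c b) (hu1 : sB F n (hv F n c) u = 1)
    (hv1 : sB F n (hv F n c) v = 1) : ∃ g ∈ tvGroup F n (c + 1) b, g u = v := by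
  have he : hv F n c ∈ perpCl F n (c + 1) b := hv_mem_perpCl hb (by omega)
  have hvu : v - u ∈ perpCl F n (c + 1) b :=
    perpCl_succ h (by rw [sB_sub_right, hu1, hv1, sub_self])
  by_cases h0 : sB F n u v = 0
  · obtain ⟨g, hg, h1⟩ := exists_transvection_eq (u := u) (v := u + hv F n c)
      (c := c + 1) (b := b) (by rwa [add_sub_cancel_left])
      (by rw [sB_add_right, sB_self, zero_add, sB_swap, hu1]; simp)
    obtain ⟨g', hg', h2⟩ := exists_transvection_eq (u := u + hv F n c) (v := v)
      (c := c + 1) (b := b) (by rw [← sub_sub]; exact sub_mem hvu he)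
      (by rw [sB_add_left, h0, zero_add, hv1]; simp)
    exact ⟨g' * g, mul_mem hg' hg, by rw [LinearEquiv.mul_apply, h1, h2]⟩
  · exact exists_transvection_eq hvu h0

/-! ### Partial homomorphisms -/

section Partial

variable {G K : Type*} [Group G] [Group K]

/-- The function `φ` is multiplicative on the subgroup `P`. -/
def HomOn (φ : G → K) (P : Subgroup G) : Prop := ∀ x ∈ P, ∀ y ∈ P, φ (x * y) = φ x * φ y

theorem HomOn.mono {φ : G → K} {P Q : Subgroup G} (h : HomOn φ P) (hQ : Q ≤ P) : HomOn φ Q :=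
  fun x hx y hy => h x (hQ hx) y (hQ hy)

theorem HomOn.one {φ : G → K} {P : Subgroup G} (h : HomOn φ P) : φ 1 = 1 := by
  have := h 1 P.one_mem 1 P.one_mem
  rwa [mul_one, eq_comm, mul_eq_left] at this

theorem HomOn.inv {φ : G → K} {P : Subgroup G} (h : HomOn φ P) {x : G} (hx : x ∈ P) :
    φ x⁻¹ = (φ x)⁻¹ := by
  have := h x hx x⁻¹ (inv_mem hx)
  rw [mul_inv_cancel, h.one] at this
  exact (inv_eq_of_mul_eq_one_right this.symm).symm

/-- Two partial homomorphisms on `H` that agree on generators agree on `H`. -/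
theorem HomOn.eqOn_closure {φ ψ : G → K} {H : Subgroup G} (h : HomOn φ H) (h' : HomOn ψ H)
    {S : Set G} (hS : S ⊆ H) (hSe : ∀ x ∈ S, φ x = ψ x) {x : G}
    (hx : x ∈ Subgroup.closure S) : φ x = ψ x := by
  have hle : Subgroup.closure S ≤ H := (Subgroup.closure_le _).2 hS
  induction hx using Subgroup.closure_induction with
  | mem x hx => exact hSe x hx
  | one => rw [h.one, h'.one]
  | mul x y hx hy ihx ihy =>
    rw [h x (hle hx) y (hle hy), h' x (hle hx) y (hle hy), ihx, ihy]
  | inv x hx ihx => rw [h.inv (hle hx), h'.inv (hle hx), ihx]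

/-- Extension of a partial homomorphism from two factors to their product. -/
theorem HomOn.exists_extend_mul {φ : G → K} {H A B : Subgroup G} (hA : A ≤ H) (hB : B ≤ H)
    (hAB : ∀ x ∈ H, ∃ a ∈ A, ∃ b ∈ B, x = a * b) (hφA : HomOn φ A) (hφB : HomOn φ B)
    {S : Set G} (hSA : S ⊆ A) (hS : A ≤ Subgroup.closure S)
    (hcomm : ∀ a ∈ S, ∀ b ∈ B, ∃ a' ∈ A, ∃ b' ∈ B, b * a = a' * b' ∧
      φ b * φ a = φ a' * φ b') :
    ∃ Φ : G → K, HomOn Φ H ∧ (∀ a ∈ A, Φ a = φ a) ∧ ∀ b ∈ B, Φ b = φ b := by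
  classical
  choose! α hα β hβ hαβ using hAB
  set Φ : G → K := fun x => φ (α x) * φ (β x) with hΦ
  have key : ∀ a ∈ A, ∀ b ∈ B, Φ (a * b) = φ a * φ b := by
    intro a ha b hb
    have hx : a * b ∈ H := mul_mem (hA ha) (hB hb)
    have ha' := hα _ hx
    have hb' := hβ _ hx
    have h1 := hαβ _ hx
    simp only [hΦ]
    generalize α (a * b) = a' at *
    generalize β (a * b) = b' at *
    have h2 : a'⁻¹ * a = b' * b⁻¹ := by
      rw [inv_mul_eq_iff_eq_mul, ← mul_assoc, ← h1, mul_inv_cancel_right]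
    have h3 := hφA a' ha' (a'⁻¹ * a) (mul_mem (inv_mem ha') ha)
    have h4 := hφB (b' * b⁻¹) (mul_mem hb' (inv_mem hb)) b hb
    rw [mul_inv_cancel_left] at h3
    rw [inv_mul_cancel_right] at h4
    rw [h3, h4, h2, mul_assoc]
  have left : ∀ a ∈ A, ∀ x ∈ H, Φ (a * x) = φ a * Φ x := by
    intro a ha x hx
    have h1 := key (a * α x) (mul_mem ha (hα x hx)) (β x) (hβ x hx)
    rw [mul_assoc, ← hαβ x hx, hφA a ha _ (hα x hx), mul_assoc] at h1
    exact h1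
  have right : ∀ b ∈ B, ∀ x ∈ H, Φ (x * b) = Φ x * φ b := by
    intro b hb x hx
    have h1 := key (α x) (hα x hx) (β x * b) (mul_mem (hβ x hx) hb)
    rw [← mul_assoc, ← hαβ x hx, hφB _ (hβ x hx) b hb, ← mul_assoc] at h1
    exact h1
  have onA : ∀ a ∈ A, Φ a = φ a := by
    intro a ha
    have := key a ha 1 B.one_mem
    rwa [hφA.one, mul_one, mul_one] at this
  have onB : ∀ b ∈ B, Φ b = φ b := by
    intro b hb
    have := key 1 A.one_mem b hb
    rwa [hφA.one, one_mul, one_mul] at this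
  have swap : ∀ a ∈ A, ∀ b ∈ B, Φ (b * a) = φ b * φ a := by
    intro a ha
    have hle : Subgroup.closure S ≤ A := (Subgroup.closure_le _).2 hSA
    have ha' := hS ha
    clear ha
    induction ha' using Subgroup.closure_induction with
    | mem x hx =>
      intro b hb
      obtain ⟨a', ha', b', hb', h1, h2⟩ := hcomm x hx b hb
      rw [h1, key a' ha' b' hb', h2]
    | one =>
      intro b hb
      rw [hφA.one, mul_one, mul_one, onB b hb]
    | mul x y hx hy ihx ihy =>
      intro b hb
      have h0 : b * x ∈ H := mul_mem (hB hb) (hA (hle hx))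
      have h1 := hαβ _ h0
      rw [← mul_assoc, h1, mul_assoc, left _ (hα _ h0) _ (mul_mem (hB (hβ _ h0)) (hA (hle hy))),
        ihy _ (hβ _ h0), hφA x (hle hx) y (hle hy), ← mul_assoc, ← mul_assoc, ← ihx b hb]
    | inv x hx ihx =>
      intro b hb
      have h0 : b * x⁻¹ ∈ H := mul_mem (hB hb) (hA (inv_mem (hle hx)))
      have h1 := hαβ _ h0
      have h2 : b = α (b * x⁻¹) * (β (b * x⁻¹) * x) := by
        rw [← mul_assoc, ← h1, inv_mul_cancel_right]
      have h3 := left _ (hα _ h0) _ (mul_mem (hB (hβ _ h0)) (hA (hle hx)))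
      rw [← h2, ihx _ (hβ _ h0), onB b hb] at h3
      rw [h3, hφA.inv (hle hx), ← mul_assoc, mul_inv_cancel_right]
  refine ⟨Φ, fun x hx y hy => ?_, onA, onB⟩
  have h0 : β x * α y ∈ H := mul_mem (hB (hβ x hx)) (hA (hα y hy))
  have h1 : x * y = α x * (β x * α y * β y) := by
    conv_lhs => rw [hαβ x hx, hαβ y hy]
    group
  rw [h1, left _ (hα x hx) _ (mul_mem h0 (hB (hβ y hy))), right _ (hβ y hy) _ h0,
    swap _ (hα y hy) _ (hβ x hx)]
  simp only [hΦ, mul_assoc]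

end Partial

/-! ### Amalgams of point stabilizers in a simply connected graph -/

section Graph

variable {G K : Type*} [Group G] [Group K]

/-- A group `H` acting on a connected graph with vertex stabilizer `P₁`, with adjacency pulled back
to a relation `A` on `H`, such that all cycles decompose into triangles, and every triangle
decomposes into triangles conjugate into `P₃`. The subgroup `P₂` controls the edges. -/
structure SimplyConnectedSystem (H P₁ P₂ P₃ : Subgroup G) (A Good : G → G → Prop) : Prop where
  le₁ : P₁ ≤ H
  le₂ : P₂ ≤ H
  le₃ : P₃ ≤ H
  symm : ∀ x ∈ H, ∀ y ∈ H, A x y → A y x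
  mul_left : ∀ g ∈ H, ∀ x ∈ H, ∀ y ∈ H, A x y → A (g * x) (g * y)
  mul_right : ∀ x ∈ H, ∀ y ∈ H, ∀ p ∈ P₁, A x y → A x (y * p)
  not_adj : ∀ x ∈ P₁, ¬ A 1 x
  adj : ∀ x ∈ P₂, x ∉ P₁ → A 1 x
  edge : ∀ x ∈ H, A 1 x → ∃ p ∈ P₁, ∃ q ∈ P₂, ∃ p' ∈ P₁, x = p * q * p'
  edge₃ : ∀ x ∈ P₃, A 1 x → ∃ p ∈ P₁ ⊓ P₃, ∃ q ∈ P₂ ⊓ P₃, ∃ p' ∈ P₁ ⊓ P₃, x = p * q * p'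
  unique : ∀ c ∈ P₁, ∀ q ∈ P₂, q ∉ P₁ → ∀ q' ∈ P₂, q'⁻¹ * c * q ∈ P₁ → c ∈ P₂
  good : ∀ x ∈ H, ∀ y ∈ H, A 1 x → A 1 y → A x y → Good x y →
    ∃ p ∈ P₁, ∃ u ∈ P₃, ∃ u' ∈ P₁, ∃ w ∈ P₃, ∃ w' ∈ P₁, x = p * u * u' ∧ y = p * w * w'
  bad : ∀ x ∈ H, ∀ y ∈ H, A 1 x → A 1 y → A x y → Good x y ∨
    ∃ w ∈ H, A 1 w ∧ A x w ∧ A y w ∧ Good x w ∧ Good y w ∧ Good (x⁻¹ * y) (x⁻¹ * w)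
  three : ∀ x ∈ H, ∀ y ∈ H, ∀ z ∈ H, ∃ w ∈ H, A x w ∧ A y w ∧ A z w
  quad : ∀ x ∈ H, ∀ y ∈ H, ∀ z ∈ H, ∀ t ∈ H, A x y → A y z → A z t → A t x →
    A x z ∨ A y t ∨ ∃ w ∈ H, A x w ∧ A y w ∧ A z w ∧ A t w

namespace SimplyConnectedSystem

variable {H P₁ P₂ P₃ : Subgroup G} {A Good : G → G → Prop}

open Classical in
/-- The extension of `φ` to `P₁ P₂ P₁`. -/
noncomputable def edgeMap (P₁ P₂ : Subgroup G) (φ : G → K) (x : G) : K :=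
  if h : ∃ t : G × G × G, t.1 ∈ P₁ ∧ t.2.1 ∈ P₂ ∧ t.2.2 ∈ P₁ ∧ x = t.1 * t.2.1 * t.2.2 then
    φ h.choose.1 * φ h.choose.2.1 * φ h.choose.2.2 else 1

theorem adj_mul (S : SimplyConnectedSystem H P₁ P₂ P₃ A Good) {p x p' : G} (hp : p ∈ P₁)
    (hx : x ∈ H) (hp' : p' ∈ P₁) (h : A 1 x) : A 1 (p * x * p') := by
  have h1 := S.mul_left p (S.le₁ hp) 1 H.one_mem x hx h
  rw [mul_one] at h1
  have hpx := mul_mem (S.le₁ hp) hx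
  have h2 := S.symm _ (S.le₁ hp) _ hpx h1
  have h3 := S.mul_right _ hpx _ (S.le₁ hp) _ (inv_mem hp) h2
  rw [mul_inv_cancel] at h3
  exact S.mul_right _ H.one_mem _ hpx _ hp' (S.symm _ hpx _ H.one_mem h3)

theorem adj_of_mul (S : SimplyConnectedSystem H P₁ P₂ P₃ A Good) {p x p' : G} (hp : p ∈ P₁)
    (hx : x ∈ H) (hp' : p' ∈ P₁) (h : A 1 (p * x * p')) : A 1 x := by
  have h1 := S.adj_mul (inv_mem hp) (mul_mem (mul_mem (S.le₁ hp) hx) (S.le₁ hp')) (inv_mem hp') h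
  rwa [mul_assoc, mul_inv_cancel_right, inv_mul_cancel_left] at h1

theorem edgeMap_eq (S : SimplyConnectedSystem H P₁ P₂ P₃ A Good) {φ : G → K} (h₁ : HomOn φ P₁)
    (h₂ : HomOn φ P₂) {p q p' : G} (hp : p ∈ P₁) (hq : q ∈ P₂) (hp' : p' ∈ P₁)
    (h : A 1 (p * q * p')) : edgeMap P₁ P₂ φ (p * q * p') = φ p * φ q * φ p' := by
  have hex : ∃ t : G × G × G, t.1 ∈ P₁ ∧ t.2.1 ∈ P₂ ∧ t.2.2 ∈ P₁ ∧
      p * q * p' = t.1 * t.2.1 * t.2.2 := ⟨(p, q, p'), hp, hq, hp', rfl⟩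
  rw [edgeMap, dif_pos hex]
  obtain ⟨hr, hs, hr', he⟩ := hex.choose_spec
  generalize hex.choose.1 = r at *
  generalize hex.choose.2.1 = s at *
  generalize hex.choose.2.2 = r' at *
  have hq0 : q ∉ P₁ := fun h0 => S.not_adj q h0 (S.adj_of_mul hp (S.le₂ hq) hp' h)
  have hd : s⁻¹ * (r⁻¹ * p) * q = r' * p'⁻¹ := by
    rw [eq_mul_inv_iff_mul_eq, mul_assoc, mul_assoc, mul_assoc, ← mul_assoc p, he]
    group
  have hd1 : r' * p'⁻¹ ∈ P₁ := mul_mem hr' (inv_mem hp')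
  have hc1 : r⁻¹ * p ∈ P₁ := mul_mem (inv_mem hr) hp
  have hc2 : r⁻¹ * p ∈ P₂ := S.unique _ hc1 q hq hq0 s hs (hd ▸ hd1)
  have hd2 : r' * p'⁻¹ ∈ P₂ := hd ▸ mul_mem (mul_mem (inv_mem hs) hc2) hq
  have e1 := h₁ r hr _ hc1
  have e2 := h₁ _ hd1 p' hp'
  rw [mul_inv_cancel_left] at e1
  rw [inv_mul_cancel_right] at e2
  have e3 : φ (r⁻¹ * p) * φ q = φ s * φ (r' * p'⁻¹) := by
    rw [← h₂ _ hc2 q hq, ← h₂ s hs _ hd2, ← hd]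
    congr 1
    group
  rw [e1, e2, mul_assoc (φ r) (φ (r⁻¹ * p)), e3]
  simp only [mul_assoc]

theorem exists_extend (S : SimplyConnectedSystem H P₁ P₂ P₃ A Good) {φ : G → K}
    (h₁ : HomOn φ P₁) (h₂ : HomOn φ P₂) (h₃ : HomOn φ P₃) :
    ∃ Φ : G → K, HomOn Φ H ∧ (∀ x ∈ P₁, Φ x = φ x) ∧ ∀ x ∈ P₂, Φ x = φ x := by
  set τ := edgeMap P₁ P₂ φ with hτ
  have one_mem : (1 : G) ∈ H := H.one_mem
  have τ_mul : ∀ p ∈ P₁, ∀ x ∈ H, ∀ p' ∈ P₁, A 1 x → τ (p * x * p') = φ p * τ x * φ p' := by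
    intro p hp x hx p' hp' h
    obtain ⟨r, hr, q, hq, r', hr', rfl⟩ := S.edge x hx h
    have e1 : p * (r * q * r') * p' = p * r * q * (r' * p') := by group
    have h1 := S.adj_mul hp hx hp' h
    rw [e1] at h1 ⊢
    rw [hτ, S.edgeMap_eq h₁ h₂ (mul_mem hp hr) hq (mul_mem hr' hp') h1,
      S.edgeMap_eq h₁ h₂ hr hq hr' h, h₁ p hp r hr, h₁ r' hr' p' hp']
    group
  have adj_inv : ∀ x ∈ H, A 1 x → A 1 x⁻¹ := by
    intro x hx h
    have := S.mul_left _ (inv_mem hx) _ hx _ one_mem (S.symm _ one_mem _ hx h)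
    rwa [inv_mul_cancel, mul_one] at this
  have τ_inv : ∀ x ∈ H, A 1 x → τ x⁻¹ = (τ x)⁻¹ := by
    intro x hx h
    have h' := adj_inv x hx h
    obtain ⟨r, hr, q, hq, r', hr', rfl⟩ := S.edge x hx h
    have e1 : (r * q * r')⁻¹ = r'⁻¹ * q⁻¹ * r⁻¹ := by group
    rw [e1] at h' ⊢
    rw [hτ, S.edgeMap_eq h₁ h₂ (inv_mem hr') (inv_mem hq) (inv_mem hr) h',
      S.edgeMap_eq h₁ h₂ hr hq hr' h, h₁.inv hr, h₁.inv hr', h₂.inv hq]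
    group
  have τ_three : ∀ x ∈ P₃, A 1 x → τ x = φ x := by
    intro x hx h
    obtain ⟨r, hr, q, hq, r', hr', rfl⟩ := S.edge₃ x hx h
    rw [hτ, S.edgeMap_eq h₁ h₂ hr.1 hq.1 hr'.1 h, h₃ _ (mul_mem hr.2 hq.2) _ hr'.2,
      h₃ _ hr.2 _ hq.2]
  have adj_diff : ∀ x ∈ H, ∀ y ∈ H, A x y → A 1 (x⁻¹ * y) := by
    intro x hx y hy h
    have := S.mul_left _ (inv_mem hx) _ hx _ hy h
    rwa [inv_mul_cancel] at this
  have flat_of_good : ∀ x ∈ H, ∀ y ∈ H, A 1 x → A 1 y → A x y → Good x y →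
      τ y = τ x * τ (x⁻¹ * y) := by
    intro x hx y hy h1x h1y hxy hg
    have hd := adj_diff x hx y hy hxy
    obtain ⟨p, hp, u, hu, u', hu', w, hw, w', hw', rfl, rfl⟩ := S.good x hx y hy h1x h1y hxy hg
    have e1 : (p * u * u')⁻¹ * (p * w * w') = u'⁻¹ * (u⁻¹ * w) * w' := by group
    have huw : u⁻¹ * w ∈ P₃ := mul_mem (inv_mem hu) hw
    rw [e1] at hd ⊢
    have au := S.adj_of_mul hp (S.le₃ hu) hu' h1x
    have aw := S.adj_of_mul hp (S.le₃ hw) hw' h1y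
    have auw := S.adj_of_mul (inv_mem hu') (S.le₃ huw) hw' hd
    rw [τ_mul _ hp _ (S.le₃ hu) _ hu' au, τ_mul _ hp _ (S.le₃ hw) _ hw' aw,
      τ_mul _ (inv_mem hu') _ (S.le₃ huw) _ hw' auw, τ_three _ hu au, τ_three _ hw aw,
      τ_three _ huw auw, h₃ _ (inv_mem hu) _ hw, h₃.inv hu, h₁.inv hu']
    group
  have flat : ∀ x ∈ H, ∀ y ∈ H, A 1 x → A 1 y → A x y → τ y = τ x * τ (x⁻¹ * y) := by
    intro x hx y hy h1x h1y hxy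
    rcases S.bad x hx y hy h1x h1y hxy with hg | ⟨w, hw, h1w, hxw, hyw, g1, g2, g3⟩
    · exact flat_of_good x hx y hy h1x h1y hxy hg
    · have f1 := flat_of_good x hx w hw h1x h1w hxw g1
      have f2 := flat_of_good y hy w hw h1y h1w hyw g2
      have f3 := flat_of_good _ (mul_mem (inv_mem hx) hy) _ (mul_mem (inv_mem hx) hw)
        (adj_diff x hx y hy hxy) (adj_diff x hx w hw hxw)
        (S.mul_left _ (inv_mem hx) _ hy _ hw hyw) g3
      have e1 : (x⁻¹ * y)⁻¹ * (x⁻¹ * w) = y⁻¹ * w := by group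
      rw [e1] at f3
      rw [f3, f2, ← mul_assoc] at f1
      exact mul_right_cancel f1
  have flat' : ∀ x ∈ H, ∀ y ∈ H, ∀ z ∈ H, A x y → A y z → A x z →
      τ (x⁻¹ * y) * τ (y⁻¹ * z) = τ (x⁻¹ * z) := by
    intro x hx y hy z hz hxy hyz hxz
    have := flat _ (mul_mem (inv_mem hx) hy) _ (mul_mem (inv_mem hx) hz)
        (adj_diff x hx y hy hxy) (adj_diff x hx z hz hxz)
        (S.mul_left _ (inv_mem hx) _ hy _ hz hyz)
    have e1 : (x⁻¹ * y)⁻¹ * (x⁻¹ * z) = y⁻¹ * z := by group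
    rw [this, e1]
  have quad : ∀ x ∈ H, ∀ y ∈ H, ∀ z ∈ H, ∀ t ∈ H, A x y → A y z → A z t → A t x →
      τ (x⁻¹ * y) * τ (y⁻¹ * z) = τ (x⁻¹ * t) * τ (t⁻¹ * z) := by
    intro x hx y hy z hz t ht hxy hyz hzt htx
    have htz := S.symm _ hz _ ht hzt
    have hxt := S.symm _ ht _ hx htx
    rcases S.quad x hx y hy z hz t ht hxy hyz hzt htx with h | h | ⟨w, hw, hxw, hyw, hzw, htw⟩
    · rw [flat' x hx y hy z hz hxy hyz h, flat' x hx t ht z hz hxt htz h]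
    · rw [← flat' x hx y hy t ht hxy h hxt, mul_assoc,
        flat' y hy t ht z hz h htz hyz]
    · have hwz := S.symm _ hz _ hw hzw
      rw [← flat' x hx w hw y hy hxw (S.symm _ hy _ hw hyw) hxy,
        ← flat' x hx w hw t ht hxw (S.symm _ ht _ hw htw) hxt, mul_assoc, mul_assoc,
        flat' w hw y hy z hz (S.symm _ hy _ hw hyw) hyz hwz,
        flat' w hw t ht z hz (S.symm _ ht _ hw htw) htz hwz]
  have hmid : ∀ x ∈ H, ∃ w ∈ H, A 1 w ∧ A x w := by
    intro x hx
    obtain ⟨w, hw, h1, h2, -⟩ := S.three 1 one_mem x hx x hx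
    exact ⟨w, hw, h1, h2⟩
  choose! m hm h1m hxm using hmid
  set Φ : G → K := fun x => τ (m x) * τ ((m x)⁻¹ * x) with hΦ
  have Φ_eq : ∀ x ∈ H, ∀ w ∈ H, A 1 w → A x w → Φ x = τ w * τ (w⁻¹ * x) := by
    intro x hx w hw h1 h2
    have := quad 1 one_mem (m x) (hm x hx) x hx w hw (h1m x hx) (S.symm _ hx _ (hm x hx) (hxm x hx))
      h2 (S.symm _ one_mem _ hw h1)
    rwa [inv_one, one_mul, one_mul] at this
  have Φ_one : Φ 1 = 1 := by
    have h1 := h1m 1 one_mem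
    simp only [hΦ, mul_one]
    rw [τ_inv _ (hm 1 one_mem) h1, mul_inv_cancel]
  have Φ_mul : ∀ x ∈ H, ∀ q ∈ H, A 1 q → Φ (x * q) = Φ x * τ q := by
    intro x hx q hq hq1
    have hxq := mul_mem hx hq
    obtain ⟨w, hw, h1, h2, h3⟩ := S.three 1 one_mem x hx (x * q) hxq
    have h4 := S.mul_left x hx 1 one_mem q hq hq1
    rw [mul_one] at h4
    have := flat' w hw x hx (x * q) hxq (S.symm _ hx _ hw h2) h4 (S.symm _ hxq _ hw h3)
    rw [inv_mul_cancel_left] at this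
    rw [Φ_eq _ hxq w hw h1 h3, Φ_eq _ hx w hw h1 h2, ← this, mul_assoc]
  have Φ_edge : ∀ q ∈ H, A 1 q → Φ q = τ q := by
    intro q hq h
    have := Φ_mul 1 one_mem q hq h
    rwa [one_mul, Φ_one, one_mul] at this
  have onP₁ : ∀ x ∈ P₁, Φ x = φ x := by
    intro x hx
    have hxH := S.le₁ hx
    have hinv := inv_mem (hm x hxH)
    have := τ_mul 1 P₁.one_mem _ hinv x hx (adj_inv _ (hm x hxH) (h1m x hxH))
    rw [one_mul, h₁.one, one_mul, τ_inv _ (hm x hxH) (h1m x hxH)] at this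
    simp only [hΦ]
    rw [this, mul_inv_cancel_left]
  refine ⟨Φ, fun x hx y hy => ?_, onP₁, fun x hx => ?_⟩
  · have hmy := hm y hy
    have hd := mul_mem (inv_mem hmy) hy
    have e1 : x * y = x * m y * ((m y)⁻¹ * y) := by group
    rw [e1, Φ_mul _ (mul_mem hx hmy) _ hd
      (adj_diff _ hmy _ hy (S.symm _ hy _ hmy (hxm y hy))), Φ_mul x hx _ hmy (h1m y hy), mul_assoc]
  · by_cases hx1 : x ∈ P₁
    · exact onP₁ x hx1
    · have hadj := S.adj x hx hx1
      have := S.edgeMap_eq h₁ h₂ P₁.one_mem hx P₁.one_mem (by rwa [one_mul, mul_one])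
      rw [one_mul, mul_one, h₁.one, one_mul, mul_one] at this
      rw [Φ_edge x (S.le₂ hx) hadj, hτ, this]

end SimplyConnectedSystem

end Graph

/-! ### The geometry attached to an interval of the flag -/

theorem mem_Par_Ioo {a b : ℕ} {g : Vn F n ≃ₗ[F] Vn F n} :
    g ∈ Par F n (Finset.Ioo a b) ↔ g ∈ SpV F n ∧ ∀ l, l ≤ a ∨ b ≤ l → g ∈ stab F n l := by
  rw [mem_Par]
  refine and_congr_right fun _ => forall_congr' fun l => ?_
  rw [Finset.mem_Ioo, not_and_or, not_lt, not_lt]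

theorem hv_notMem_Cl {k : ℕ} (h : k < 2 * n) : hv F n k ∉ Cl F n k := by
  intro h1
  have := mem_Cl.1 h1 ⟨k, h⟩ le_rfl
  simp [hv] at this

theorem map_mem_Cl_iff {l : ℕ} {g : Vn F n ≃ₗ[F] Vn F n} (h : g ∈ stab F n l) {v : Vn F n} :
    g v ∈ Cl F n l ↔ v ∈ Cl F n l := by
  refine ⟨fun h1 => ?_, mem_stab.1 h v⟩
  rw [← inv_apply_self g v]
  exact mem_stab.1 (inv_mem h) _ h1

theorem exists_map_hv_eq {l : ℕ} (hl : l < 2 * n) {g : Vn F n ≃ₗ[F] Vn F n} (h : g ∈ stab F n l)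
    (h' : g ∈ stab F n (l + 1)) : ∃ r : F, r ≠ 0 ∧ ∃ m ∈ Cl F n l, g (hv F n l) = r • hv F n l + m := by
  obtain ⟨r, hr, hr0⟩ := exists_sub_smul_mem_Cl (mem_stab.1 h' _ (hv_mem_Cl (Nat.lt_succ_self l)))
  refine ⟨r, hr0 fun h1 => hv_notMem_Cl hl ((map_mem_Cl_iff h).1 h1), _, hr, ?_⟩
  rw [add_sub_cancel]

theorem inv_mul_mem_stab {l : ℕ} {x g : Vn F n ≃ₗ[F] Vn F n} (hx : x ∈ stab F n l)
    (hg : g ∈ stab F n l) {r : F} {m : Vn F n} (hm : m ∈ Cl F n l)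
    (h : x (hv F n l) = r • g (hv F n l) + m) : g⁻¹ * x ∈ stab F n (l + 1) := by
  refine stab_succ (mul_mem (inv_mem hg) hx) ?_
  rw [LinearEquiv.mul_apply, h, map_add, map_smul, inv_apply_self]
  exact add_mem (Submodule.smul_mem _ _ (hv_mem_Cl (Nat.lt_succ_self l)))
    (Cl_mono (Nat.le_succ l) (mem_stab.1 (inv_mem hg) _ hm))

/-- An adjacency relation on the images of `C_{a+1}` under `P_J`, `J` the interval `(a, b)`, in
which points are adjacent when they are in general position. -/
structure AdjGeometry (F : Type) [Field F] (n a b : ℕ)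
    (A : (Vn F n ≃ₗ[F] Vn F n) → (Vn F n ≃ₗ[F] Vn F n) → Prop) : Prop where
  symm : ∀ x y, A x y → A y x
  mul_left : ∀ g ∈ Par F n (Finset.Ioo a b), ∀ x y, A x y → A (g * x) (g * y)
  mul_right : ∀ x ∈ Par F n (Finset.Ioo a b), ∀ y ∈ Par F n (Finset.Ioo a b),
    ∀ p ∈ Par F n (Finset.Ioo a b), p ∈ stab F n (a + 1) → A x y → A x (y * p)
  irrefl : ¬ A 1 1
  adj : ∀ x ∈ Par F n (Finset.Ioo a b), x ∈ stab F n (a + 2) → x ∉ stab F n (a + 1) → A 1 x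
  factor : ∀ b', b' = b ∨ b' = a + 3 → ∀ x ∈ Par F n (Finset.Ioo a b), A 1 x →
    x (hv F n a) ∈ Cl F n b' → ∃ g ∈ tvGroup F n (a + 1) b', ∃ g' ∈ tvGroup F n a (a + 2),
      (g * g')⁻¹ * x ∈ stab F n (a + 1)
  three : ∀ x ∈ Par F n (Finset.Ioo a b), ∀ y ∈ Par F n (Finset.Ioo a b),
    ∀ z ∈ Par F n (Finset.Ioo a b), ∃ w ∈ Par F n (Finset.Ioo a b), A x w ∧ A y w ∧ A z w
  quad : ∀ x ∈ Par F n (Finset.Ioo a b), ∀ y ∈ Par F n (Finset.Ioo a b),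
    ∀ z ∈ Par F n (Finset.Ioo a b), ∀ t ∈ Par F n (Finset.Ioo a b),
    A x y → A y z → A z t → A t x → A x z ∨ A y t ∨
      ∃ w ∈ Par F n (Finset.Ioo a b), A x w ∧ A y w ∧ A z w ∧ A t w

/-- A class of triangles lying, up to conjugacy, in `C_{a+3}`, into which all triangles
decompose. -/
structure TriangleGeometry (F : Type) [Field F] (n a b : ℕ)
    (A Good : (Vn F n ≃ₗ[F] Vn F n) → (Vn F n ≃ₗ[F] Vn F n) → Prop) : Prop
    extends AdjGeometry F n a b A where
  good : ∀ x ∈ Par F n (Finset.Ioo a b), ∀ y ∈ Par F n (Finset.Ioo a b), A 1 x → A 1 y → A x y →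
    Good x y → ∃ p ∈ tvGroup F n (a + 1) b, (p⁻¹ * x) (hv F n a) ∈ Cl F n (a + 3) ∧
      (p⁻¹ * y) (hv F n a) ∈ Cl F n (a + 3)
  bad : ∀ x ∈ Par F n (Finset.Ioo a b), ∀ y ∈ Par F n (Finset.Ioo a b), A 1 x → A 1 y → A x y →
    Good x y ∨ ∃ w ∈ Par F n (Finset.Ioo a b), A 1 w ∧ A x w ∧ A y w ∧ Good x w ∧ Good y w ∧
      Good (x⁻¹ * y) (x⁻¹ * w)

theorem TriangleGeometry.simplyConnectedSystem {a b : ℕ} (hab : a + 4 ≤ b)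
    {A Good : (Vn F n ≃ₗ[F] Vn F n) → (Vn F n ≃ₗ[F] Vn F n) → Prop}
    (T : TriangleGeometry F n a b A Good) :
    SimplyConnectedSystem (Par F n (Finset.Ioo a b)) (Par F n ((Finset.Ioo a b).erase (a + 1)))
      (Par F n ((Finset.Ioo a b).erase (a + 2))) (Par F n ((Finset.Ioo a b).erase (a + 3)))
      A Good := by
  have le (i : ℕ) : Par F n ((Finset.Ioo a b).erase i) ≤ Par F n (Finset.Ioo a b) :=
    Par_mono F n (Finset.erase_subset _ _)
  have st (i : ℕ) : ∀ x ∈ Par F n ((Finset.Ioo a b).erase i), x ∈ stab F n i :=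
    fun x hx => (mem_Par.1 hx).2 i (Finset.notMem_erase _ _)
  have one : (1 : Vn F n ≃ₗ[F] Vn F n) ∈ Par F n (Finset.Ioo a b) := one_mem _
  have tv {c d i : ℕ} (hc : a ≤ c) (hd : d ≤ b) (h : i ≤ c ∨ d ≤ i) :
      tvGroup F n c d ≤ Par F n ((Finset.Ioo a b).erase i) :=
    tvGroup_le_Par fun l h1 h2 => by
      rw [Finset.mem_erase, Finset.mem_Ioo]
      omega
  have right1 : ∀ x ∈ Par F n (Finset.Ioo a b), ∀ y ∈ Par F n (Finset.Ioo a b),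
      ∀ p ∈ Par F n ((Finset.Ioo a b).erase (a + 1)), A x y → A x (y * p) :=
    fun x hx y hy p hp => T.mul_right x hx y hy p (le _ hp) (st _ p hp)
  refine
    { le₁ := le _, le₂ := le _, le₃ := le _
      symm := fun x _ y _ => T.symm x y
      mul_left := fun g hg x _ y _ => T.mul_left g hg x y
      mul_right := right1
      not_adj := fun x hx h => T.irrefl ?_
      adj := fun x hx hx1 => T.adj x (le _ hx) (st _ x hx) fun h => hx1 (Par_erase (le _ hx) h)
      edge := ?_, edge₃ := ?_, unique := ?_, good := ?_, bad := T.bad, three := T.three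
      quad := T.quad }
  · have := right1 1 one x (le _ hx) x⁻¹ (inv_mem hx) h
    rwa [mul_inv_cancel] at this
  · intro x hx h
    obtain ⟨g, hg, g', hg', h1⟩ := T.factor b (Or.inl rfl) x hx h
      (mem_stab.1 ((mem_Par_Ioo.1 hx).2 b (Or.inr le_rfl)) _ (hv_mem_Cl (by omega)))
    have hgP := tv (i := a + 1) (by omega) (by omega) (by omega) hg
    have hgP' := tv (i := a + 2) (by omega) (by omega) (by omega) hg'
    exact ⟨g, hgP, g', hgP', _,
      Par_erase (mul_mem (inv_mem (mul_mem (le _ hgP) (le _ hgP'))) hx) h1, by group⟩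
  · intro x hx h
    obtain ⟨g, hg, g', hg', h1⟩ := T.factor (a + 3) (Or.inr rfl) x (le _ hx) h
      (mem_stab.1 (st _ x hx) _ (hv_mem_Cl (by omega)))
    have hgP := tv (i := a + 1) (by omega) (by omega) (by omega) hg
    have hgP' := tv (i := a + 2) (by omega) (by omega) (by omega) hg'
    have hgQ := tv (i := a + 3) (by omega) (by omega) (by omega) hg
    have hgQ' := tv (i := a + 3) (by omega) (by omega) (by omega) hg'
    have h2 := mul_mem (inv_mem (mul_mem hgQ hgQ')) hx
    exact ⟨g, ⟨hgP, hgQ⟩, g', ⟨hgP', hgQ'⟩, _, ⟨Par_erase (le _ h2) h1, h2⟩, by group⟩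
  · intro c hc q hq hq1 q' hq' h
    refine Par_erase (le _ hc) (stab_succ (st _ c hc) ?_)
    have hqa : q (hv F n a) ∉ Cl F n (a + 1) := fun h1 => hq1 (Par_erase (le _ hq)
      (stab_succ ((mem_Par_Ioo.1 (le _ hq)).2 a (Or.inl le_rfl)) h1))
    obtain ⟨r, hr, hr0⟩ := exists_sub_smul_mem_Cl
      (mem_stab.1 (st _ q hq) _ (hv_mem_Cl (show a < a + 2 by omega)))
    have h1 : c (q (hv F n a)) ∈ Cl F n (a + 2) := by
      have h2 := mem_stab.1 (st _ _ h) _ (hv_mem_Cl (Nat.lt_succ_self a))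
      have h3 := mem_stab.1 (st _ _ hq') _ (Cl_mono (Nat.le_succ (a + 1)) h2)
      rwa [LinearEquiv.mul_apply, LinearEquiv.mul_apply, apply_inv_self] at h3
    have h2 := sub_mem h1 (Cl_mono (Nat.le_succ (a + 1)) (mem_stab.1 (st _ c hc) _ hr))
    rw [← map_sub, sub_sub_cancel, map_smul] at h2
    exact (Submodule.smul_mem_iff _ (hr0 hqa)).1 h2
  · intro x hx y hy h1 h2 h3 h4
    obtain ⟨p, hp, hpx, hpy⟩ := T.good x hx y hy h1 h2 h3 h4
    have hpP := tv (i := a + 1) (by omega) (by omega) (by omega) hp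
    have key : ∀ x ∈ Par F n (Finset.Ioo a b), A 1 x → (p⁻¹ * x) (hv F n a) ∈ Cl F n (a + 3) →
        ∃ u ∈ Par F n ((Finset.Ioo a b).erase (a + 3)),
        ∃ u' ∈ Par F n ((Finset.Ioo a b).erase (a + 1)), x = p * u * u' := by
      intro x hx h1 hpx
      have hpi := inv_mem (le _ hpP)
      have h5 := T.mul_left _ hpi _ _ (T.symm _ _ h1)
      have h6 := right1 _ (mul_mem hpi hx) _ (mul_mem hpi one) _ hpP h5
      rw [mul_one, inv_mul_cancel] at h6
      obtain ⟨g, hg, g', hg', h7⟩ := T.factor (a + 3) (Or.inr rfl) _ (mul_mem hpi hx)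
        (T.symm _ _ h6) hpx
      have hgQ := tv (i := a + 3) (by omega) (by omega) (by omega) hg
      have hgQ' := tv (i := a + 3) (by omega) (by omega) (by omega) hg'
      have hgg := mul_mem hgQ hgQ'
      exact ⟨_, hgg, _, Par_erase (mul_mem (inv_mem (le _ hgg)) (mul_mem hpi hx)) h7, by group⟩
    obtain ⟨u, hu, u', hu', hx⟩ := key x hx h1 hpx
    obtain ⟨w, hw, w', hw', hy⟩ := key y hy h2 hpy
    exact ⟨p, hpP, u, hu, u', hu', w, hw, w', hw', hx, hy⟩

/-! ### The geometry of non-orthogonal points -/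

/-- The points `g C_{a+1}` and `g' C_{a+1}` are not orthogonal modulo `C_a`, for `a` even. -/
def EvenAdj (F : Type) [Field F] (n a : ℕ) (g g' : Vn F n ≃ₗ[F] Vn F n) : Prop :=
  sB F n (g (hv F n a)) (g' (hv F n a)) ≠ 0

/-- The triangle on `C_{a+1}`, `g C_{a+1}`, `g' C_{a+1}` is nondegenerate in a strong sense. -/
def EvenGood (F : Type) [Field F] (n a b : ℕ) (g g' : Vn F n ≃ₗ[F] Vn F n) : Prop :=
  ∃ t ∈ perpCl F n a b, sB F n t (hv F n a) = 0 ∧ sB F n t (g (hv F n a)) = 0 ∧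
    sB F n t (g' (hv F n a)) ≠ 0

theorem sB_ne_zero_swap {u v : Vn F n} (h : sB F n u v ≠ 0) : sB F n v u ≠ 0 := by
  rwa [sB_swap, neg_ne_zero]

section Even

variable {a b : ℕ}

theorem map_hv_mem_perpCl (ha : a % 2 = 0) (hab : a < b) {g : Vn F n ≃ₗ[F] Vn F n}
    (hg : g ∈ Par F n (Finset.Ioo a b)) : g (hv F n a) ∈ perpCl F n a b :=
  map_mem_perpCl (mem_Par_Ioo.1 hg).1 ((mem_Par_Ioo.1 hg).2 a (Or.inl le_rfl))
    ((mem_Par_Ioo.1 hg).2 b (Or.inr le_rfl)) (hv_mem_perpCl hab (by omega))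

theorem map_mem_perpCl_of_mem {g : Vn F n ≃ₗ[F] Vn F n} {c : ℕ}
    (hg : g ∈ Par F n (Finset.Ioo a b)) (hc : c ≤ a) {v : Vn F n} (h : v ∈ perpCl F n c b) :
    g v ∈ perpCl F n c b :=
  map_mem_perpCl (mem_Par_Ioo.1 hg).1 ((mem_Par_Ioo.1 hg).2 c (Or.inl hc))
    ((mem_Par_Ioo.1 hg).2 b (Or.inr le_rfl)) h

theorem tvGroup_le_Par_Ioo {c d : ℕ} (hc : a ≤ c) (hd : d ≤ b) :
    tvGroup F n c d ≤ Par F n (Finset.Ioo a b) :=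
  tvGroup_le_Par fun l h1 h2 => Finset.mem_Ioo.2 ⟨by omega, by omega⟩

/-- Every nonradical vector of `C_a^⊥ ∩ C_b` is an image of `h_{a+1}`. -/
theorem exists_map_hv_eq_of_even (ha : a % 2 = 0) (hab : a + 2 ≤ b) (hb : b ≤ 2 * n) {w t : Vn F n}
    (hw : w ∈ perpCl F n a b) (ht : t ∈ perpCl F n a b) (h : sB F n t w ≠ 0) :
    ∃ g ∈ Par F n (Finset.Ioo a b), g (hv F n a) = w := by
  obtain ⟨g, hg, h1⟩ := exists_tvGroup_eq (hv_mem_perpCl (show a < b by omega) (by omega)) hw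
    ⟨hv F n (a + 1), hv_mem_perpCl (by omega) (by omega), by
      rw [sB_hv_pair ha (by omega)]
      exact one_ne_zero⟩
    ⟨t, ht, sB_ne_zero_swap h⟩
  exact ⟨g, tvGroup_le_Par_Ioo le_rfl le_rfl hg, h1⟩

theorem exists_map_hv_succ_eq (ha : a % 2 = 0) {b' : ℕ} (hab : a + 2 ≤ b') (hb : b' ≤ 2 * n)
    {v : Vn F n} (h : v ∈ perpCl F n a b') (h0 : sB F n (hv F n a) v ≠ 0) :
    ∃ g ∈ tvGroup F n (a + 1) b', sB F n (hv F n a) v • g (hv F n (a + 1)) = v := by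
  have hf : hv F n (a + 1) ∈ perpCl F n a b' := hv_mem_perpCl (by omega) (by omega)
  obtain ⟨g, hg, h1⟩ := exists_tvGroup_eq_of_hyperbolic (b := b') ha (by omega)
    (u := hv F n (a + 1)) (v := (sB F n (hv F n a) v)⁻¹ • v)
    (sub_mem (Submodule.smul_mem _ _ h) hf) (sB_hv_pair ha (by omega))
    (by rw [sB_smul_right, inv_mul_cancel₀ h0])
  exact ⟨g, hg, by rw [h1, smul_smul, mul_inv_cancel₀ h0, one_smul]⟩

theorem evenAdj_adjGeometry (hF : 2 < Cardinal.mk F) (ha : a % 2 = 0) (hab : a + 3 ≤ b)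
    (hb : b ≤ 2 * n) : AdjGeometry F n a b (EvenAdj F n a) where
  symm x y h := sB_ne_zero_swap h
  mul_left g hg x y h := by
    rw [EvenAdj, LinearEquiv.mul_apply, LinearEquiv.mul_apply, sB_map (mem_Par_Ioo.1 hg).1]
    exact h
  mul_right x hx y hy p hp hp1 h := by
    obtain ⟨r, hr, m, hm, h1⟩ := exists_map_hv_eq (show a < 2 * n by omega)
      ((mem_Par_Ioo.1 hp).2 a (Or.inl le_rfl)) hp1
    have hym := mem_stab.1 ((mem_Par_Ioo.1 hy).2 a (Or.inl le_rfl)) _ hm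
    rw [EvenAdj, LinearEquiv.mul_apply, h1, map_add, map_smul, sB_add_right, sB_smul_right,
      sB_swap _ (y m), sB_eq_zero_of_mem hym (map_hv_mem_perpCl ha (by omega) hx), neg_zero,
      add_zero]
    exact mul_ne_zero hr h
  irrefl h := h (sB_self _)
  adj x hx hx2 hx1 := by
    have hxa : x (hv F n a) ∉ Cl F n (a + 1) := fun h1 => hx1
      (stab_succ ((mem_Par_Ioo.1 hx).2 a (Or.inl le_rfl)) h1)
    obtain ⟨r, hr, hr0⟩ := exists_sub_smul_mem_Cl
      (mem_stab.1 hx2 _ (hv_mem_Cl (show a < a + 2 by omega)))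
    obtain ⟨k, hk⟩ := eq_smul_of_mem_perpCl ha (sub_mem (map_hv_mem_perpCl ha (by omega) hx)
      (Submodule.smul_mem _ r (hv_mem_perpCl (show a + 1 < b by omega) (by omega)))) hr
    rw [EvenAdj, sub_eq_iff_eq_add.1 hk, sB_add_right, sB_smul_right, sB_smul_right]
    change k * sB F n (hv F n a) (hv F n a) + _ * sB F n (hv F n a) _ ≠ 0
    rw [sB_self, sB_hv_pair ha (by omega), mul_zero, zero_add, mul_one]
    exact hr0 hxa
  factor b' hb' x hx h hxb' := by
    have hxW : x (hv F n a) ∈ perpCl F n a b' :=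
      ⟨(map_hv_mem_perpCl ha (by omega) hx).1, hxb'⟩
    obtain ⟨g, hg, h1⟩ := exists_map_hv_succ_eq ha (show a + 2 ≤ b' by omega) (by omega) hxW h
    obtain ⟨g', hg', h2⟩ := exists_transvection_eq (u := hv F n a) (v := hv F n (a + 1))
      (c := a) (b := a + 2)
      (sub_mem (hv_mem_perpCl (by omega) (by omega)) (hv_mem_perpCl (by omega) (by omega)))
      (by rw [sB_hv_pair ha (by omega)]; exact one_ne_zero)
    refine ⟨g, hg, g', hg', inv_mul_mem_stab (m := 0) (r := sB F n (hv F n a) (x (hv F n a)))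
      ((mem_Par_Ioo.1 hx).2 a (Or.inl le_rfl))
      (mul_mem (tvGroup_le_stab (Or.inl (Nat.le_succ a)) hg) (tvGroup_le_stab (Or.inl le_rfl) hg'))
      (zero_mem _) ?_⟩
    rw [LinearEquiv.mul_apply, h2, add_zero]
    exact h1.symm
  three x hx y hy z hz := by
    have wit : ∀ x ∈ Par F n (Finset.Ioo a b), ∃ t ∈ perpCl F n a b,
        sLin (x (hv F n a)) t ≠ 0 := by
      intro x hx
      refine ⟨x (hv F n (a + 1)), map_mem_perpCl_of_mem hx le_rfl
        (hv_mem_perpCl (by omega) (by omega)), ?_⟩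
      change sB F n _ _ ≠ 0
      rw [sB_map (mem_Par_Ioo.1 hx).1, sB_hv_pair ha (by omega)]
      exact one_ne_zero
    obtain ⟨w, hw, h1, h2, h3⟩ := exists_mem_ne_zero₃ hF _ (wit x hx) (wit y hy) (wit z hz)
    obtain ⟨g, hg, rfl⟩ := exists_map_hv_eq_of_even ha (by omega) hb hw
      (map_hv_mem_perpCl ha (by omega) hx) h1
    exact ⟨g, hg, h1, h2, h3⟩
  quad x hx y hy z hz t ht hxy hyz hzt htx := by
    by_cases hxz : EvenAdj F n a x z
    · exact Or.inl hxz
    by_cases hyt : EvenAdj F n a y t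
    · exact Or.inr (Or.inl hyt)
    refine Or.inr (Or.inr ?_)
    have hX := map_hv_mem_perpCl ha (by omega) hx
    have hY := map_hv_mem_perpCl ha (by omega) hy
    have hZ := map_hv_mem_perpCl ha (by omega) hz
    have hT := map_hv_mem_perpCl ha (by omega) ht
    simp only [EvenAdj, not_not] at *
    generalize x (hv F n a) = X at *
    generalize y (hv F n a) = Y at *
    generalize z (hv F n a) = Z at *
    generalize t (hv F n a) = T at *
    have hxt := sB_ne_zero_swap htx
    have hyx := sB_ne_zero_swap hxy
    obtain ⟨δ, hδ1, hδ2⟩ := exists_ne_ne hF (-sB F n X Y / sB F n X T) (-sB F n Z Y / sB F n Z T)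
    obtain ⟨β, hβ1, hβ2⟩ := exists_ne_ne hF (-sB F n Y X / sB F n Y Z) (-sB F n T X / sB F n T Z)
    have htz := sB_ne_zero_swap hzt
    rw [Ne, eq_div_iff hxt] at hδ1
    rw [Ne, eq_div_iff hzt] at hδ2
    rw [Ne, eq_div_iff hyz] at hβ1
    rw [Ne, eq_div_iff htz] at hβ2
    have hzx : sB F n Z X = 0 := by rw [sB_swap, hxz, neg_zero]
    have hty : sB F n T Y = 0 := by rw [sB_swap, hyt, neg_zero]
    have hw : X + β • Z + Y + δ • T ∈ perpCl F n a b :=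
      add_mem (add_mem (add_mem hX (Submodule.smul_mem _ _ hZ)) hY) (Submodule.smul_mem _ _ hT)
    have e1 : sB F n X (X + β • Z + Y + δ • T) ≠ 0 := by
      simp only [sB_add_right, sB_smul_right, sB_self, hxz]
      exact fun h => hδ1 (by linear_combination h)
    have e2 : sB F n Y (X + β • Z + Y + δ • T) ≠ 0 := by
      simp only [sB_add_right, sB_smul_right, sB_self, hyt]
      exact fun h => hβ1 (by linear_combination h)
    have e3 : sB F n Z (X + β • Z + Y + δ • T) ≠ 0 := by
      simp only [sB_add_right, sB_smul_right, sB_self, hzx]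
      exact fun h => hδ2 (by linear_combination h)
    have e4 : sB F n T (X + β • Z + Y + δ • T) ≠ 0 := by
      simp only [sB_add_right, sB_smul_right, sB_self, hty]
      exact fun h => hβ2 (by linear_combination h)
    obtain ⟨g, hg, h⟩ := exists_map_hv_eq_of_even ha (by omega) hb hw hX e1
    rw [← h] at e1 e2 e3 e4
    exact ⟨g, hg, e1, e2, e3, e4⟩

theorem evenAdj_triangleGeometry (hF : 2 < Cardinal.mk F) (ha : a % 2 = 0) (hab : a + 4 ≤ b)
    (hb : b ≤ 2 * n) : TriangleGeometry F n a b (EvenAdj F n a) (EvenGood F n a b) where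
  toAdjGeometry := evenAdj_adjGeometry hF ha (by omega) hb
  good x hx y hy h1x _ _ := by
    rintro ⟨t, ht, hte, htx, hty⟩
    have hxW := map_hv_mem_perpCl ha (show a < b by omega) hx
    have hyW := map_hv_mem_perpCl ha (show a < b by omega) hy
    obtain ⟨p, hp, hpx⟩ := exists_map_hv_succ_eq ha (by omega) hb hxW h1x
    have hpS := tvGroup_le_SpV _ _ hp
    have hpe : p (hv F n a) = hv F n a := tvGroup_fix hp (hv_mem_Cl (by omega))
    have hpH : p ∈ Par F n (Finset.Ioo a b) := tvGroup_le_Par_Ioo (by omega) le_rfl hp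
    have ht1 : p⁻¹ t ∈ perpCl F n (a + 2) b := by
      refine perpCl_succ (perpCl_succ (map_mem_perpCl_of_mem (inv_mem hpH) le_rfl ht) ?_) ?_
      · rw [sB_swap, ← sB_map_right hpS, hpe, hte, neg_zero]
      · rw [← hpx, sB_smul_right] at htx
        rw [sB_swap, ← sB_map_right hpS, (mul_eq_zero.1 htx).resolve_left h1x, neg_zero]
    obtain ⟨α, β, hz⟩ := exists_perpCl_decomp ha (by omega) (by omega)
      (map_mem_perpCl_of_mem (inv_mem hpH) le_rfl hyW)
    set z := p⁻¹ (y (hv F n a)) - α • hv F n a - β • hv F n (a + 1) with hzdef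
    have hzt : sB F n z (p⁻¹ t) ≠ 0 := by
      have e1 := sB_eq_zero_of_mem (hv_mem_Cl (show a < a + 2 by omega)) ht1
      have e2 := sB_eq_zero_of_mem (hv_mem_Cl (show a + 1 < a + 2 by omega)) ht1
      rw [hzdef, sB_sub_left, sB_sub_left, sB_smul_left, sB_smul_left, e1, e2,
        sB_map (inv_mem hpS)]
      simpa using sB_ne_zero_swap hty
    obtain ⟨q, hq, hqz⟩ := exists_tvGroup_eq
      (hv_mem_perpCl (show a + 2 < b by omega) (by omega)) hz
      ⟨hv F n (a + 3), hv_mem_perpCl (by omega) (by omega), by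
        rw [sB_hv_pair (by omega) (by omega)]
        exact one_ne_zero⟩ ⟨_, ht1, hzt⟩
    have hqi := inv_mem hq
    refine ⟨p * q, mul_mem hp (tvGroup_mono (Nat.le_succ _) le_rfl hq), ?_, ?_⟩
    · rw [_root_.mul_inv_rev, LinearEquiv.mul_apply, LinearEquiv.mul_apply, ← hpx, map_smul,
        inv_apply_self, map_smul, tvGroup_fix hqi (hv_mem_Cl (by omega))]
      exact Submodule.smul_mem _ _ (hv_mem_Cl (by omega))
    · have e1 : p⁻¹ (y (hv F n a)) = z + β • hv F n (a + 1) + α • hv F n a := by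
        rw [hzdef]
        abel
      rw [_root_.mul_inv_rev, LinearEquiv.mul_apply, LinearEquiv.mul_apply, e1, map_add, map_add,
        map_smul, map_smul, ← hqz, inv_apply_self, tvGroup_fix hqi (hv_mem_Cl (by omega)),
        tvGroup_fix hqi (hv_mem_Cl (by omega))]
      exact add_mem (add_mem (hv_mem_Cl (by omega))
        (Submodule.smul_mem _ _ (hv_mem_Cl (by omega))))
        (Submodule.smul_mem _ _ (hv_mem_Cl (by omega)))
  bad x hx y hy h1x h1y hxy := by
    rw [or_iff_not_imp_left]
    intro hng
    have heW : hv F n a ∈ perpCl F n a b := hv_mem_perpCl (by omega) (by omega)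
    have hxW := map_hv_mem_perpCl ha (show a < b by omega) hx
    have hyW := map_hv_mem_perpCl ha (show a < b by omega) hy
    obtain ⟨p, hp, hpx⟩ := exists_map_hv_succ_eq ha (by omega) hb hxW h1x
    have hpS := tvGroup_le_SpV _ _ hp
    have hpe : p (hv F n a) = hv F n a := tvGroup_fix hp (hv_mem_Cl (by omega))
    have hpH : p ∈ Par F n (Finset.Ioo a b) := tvGroup_le_Par_Ioo (by omega) le_rfl hp
    have perp : ∀ k, (k = a + 2 ∨ k = a + 3) → p (hv F n k) ∈ perpCl F n a b ∧
        sB F n (p (hv F n k)) (hv F n a) = 0 ∧ sB F n (p (hv F n k)) (x (hv F n a)) = 0 ∧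
        sB F n (p (hv F n k)) (y (hv F n a)) = 0 := by
      intro k hk
      have h1 : p (hv F n k) ∈ perpCl F n a b :=
        map_mem_perpCl_of_mem hpH le_rfl (hv_mem_perpCl (by omega) (by omega))
      have h2 : sB F n (p (hv F n k)) (hv F n a) = 0 := by
        rw [← hpe, sB_map hpS]
        exact sB_hv_hv_eq_zero (by omega)
      have h3 : sB F n (p (hv F n k)) (x (hv F n a)) = 0 := by
        rw [← hpx, sB_smul_right, sB_map hpS, sB_hv_hv_eq_zero (by omega), mul_zero]
      exact ⟨h1, h2, h3, by_contra fun h4 => hng ⟨_, h1, h2, h3, h4⟩⟩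
    obtain ⟨ht, hte, htx, hty⟩ := perp (a + 2) (Or.inl rfl)
    obtain ⟨hu, hue, hux, huy⟩ := perp (a + 3) (Or.inr rfl)
    have htu : sB F n (p (hv F n (a + 2))) (p (hv F n (a + 3))) = 1 := by
      rw [sB_map hpS, sB_hv_pair (by omega) (by omega)]
    set t := p (hv F n (a + 2))
    set u := p (hv F n (a + 3))
    obtain ⟨w₀, hw₀, h1, h2, h3⟩ := exists_mem_ne_zero₃ hF (perpCl F n a b)
      (f := sLin (hv F n a)) (g := sLin (x (hv F n a))) (h := sLin (y (hv F n a)))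
      ⟨_, hxW, h1x⟩ ⟨_, heW, sB_ne_zero_swap h1x⟩ ⟨_, heW, sB_ne_zero_swap h1y⟩
    have hw : ∃ w ∈ perpCl F n a b, sB F n (hv F n a) w ≠ 0 ∧ sB F n (x (hv F n a)) w ≠ 0 ∧
        sB F n (y (hv F n a)) w ≠ 0 ∧ sB F n t w ≠ 0 := by
      by_cases h4 : sB F n t w₀ = 0
      · refine ⟨w₀ + u, add_mem hw₀ hu, ?_, ?_, ?_, ?_⟩
        · rw [sB_add_right, sB_swap _ u, hue, neg_zero, add_zero]
          exact h1
        · rw [sB_add_right, sB_swap _ u, hux, neg_zero, add_zero]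
          exact h2
        · rw [sB_add_right, sB_swap _ u, huy, neg_zero, add_zero]
          exact h3
        · rw [sB_add_right, h4, htu, zero_add]
          exact one_ne_zero
      · exact ⟨w₀, hw₀, h1, h2, h3, h4⟩
    obtain ⟨w, hw, h1w, hxw, hyw, htw⟩ := hw
    obtain ⟨g, hg, rfl⟩ := exists_map_hv_eq_of_even ha (by omega) hb hw heW h1w
    have hxS := inv_mem (mem_Par_Ioo.1 hx).1
    refine ⟨g, hg, h1w, hxw, hyw, ⟨t, ht, hte, htx, htw⟩, ⟨t, ht, hte, hty, htw⟩,
      ⟨x⁻¹ t, map_mem_perpCl_of_mem (inv_mem hx) le_rfl ht, ?_, ?_, ?_⟩⟩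
    · rw [← sB_map_right (mem_Par_Ioo.1 hx).1, htx]
    · rw [LinearEquiv.mul_apply, sB_map hxS, hty]
    · rw [LinearEquiv.mul_apply, sB_map hxS]
      exact htw

end Even

/-! ### The geometry of points on an affine symplectic space -/

/-- The normalized representative of the point `g C_{c+2}`. -/
noncomputable def oddPoint (F : Type) [Field F] (n c : ℕ) (g : Vn F n ≃ₗ[F] Vn F n) : Vn F n :=
  (sB F n (hv F n c) (g (hv F n (c + 1))))⁻¹ • g (hv F n (c + 1))

/-- The points `g C_{c+2}` and `g' C_{c+2}` differ by a nonradical vector of `C_{c+1}^⊥ ∩ C_b`. -/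
def OddAdj (F : Type) [Field F] (n c b : ℕ) (g g' : Vn F n ≃ₗ[F] Vn F n) : Prop :=
  ∃ t ∈ perpCl F n (c + 1) b, sB F n t (oddPoint F n c g - oddPoint F n c g') ≠ 0

/-- The triangle on `C_{c+2}`, `g C_{c+2}`, `g' C_{c+2}` spans a nondegenerate plane. -/
def OddGood (F : Type) [Field F] (n c : ℕ) (g g' : Vn F n ≃ₗ[F] Vn F n) : Prop :=
  sB F n (oddPoint F n c g - hv F n (c + 1)) (oddPoint F n c g' - hv F n (c + 1)) ≠ 0

section Odd

variable {b c : ℕ}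

theorem exists_map_hv_eq_smul_of_stab (hc : c % 2 = 0) (hcb : c + 1 < b) (hb : b ≤ 2 * n)
    {g : Vn F n ≃ₗ[F] Vn F n} (hg : g ∈ SpV F n) (h0 : g ∈ stab F n c)
    (h1 : g ∈ stab F n (c + 1)) (h2 : g ∈ stab F n b) :
    ∃ r : F, r ≠ 0 ∧ g (hv F n c) = r • hv F n c ∧
      r * sB F n (hv F n c) (g (hv F n (c + 1))) = 1 := by
  obtain ⟨r, hr⟩ := eq_smul_of_mem_perpCl hc
    (map_mem_perpCl hg h0 h2 (hv_mem_perpCl (show c < b by omega) (by omega)))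
    (mem_stab.1 h1 _ (hv_mem_Cl (Nat.lt_succ_self c)))
  have h3 := sB_map hg (hv F n c) (hv F n (c + 1))
  rw [hr, sB_hv_pair hc (by omega), sB_smul_left] at h3
  exact ⟨r, left_ne_zero_of_mul_eq_one h3, hr, h3⟩

theorem exists_map_hv_eq_smul (hc : c % 2 = 0) (hcb : c + 1 < b) (hb : b ≤ 2 * n)
    {g : Vn F n ≃ₗ[F] Vn F n} (hg : g ∈ Par F n (Finset.Ioo (c + 1) b)) :
    ∃ r : F, r ≠ 0 ∧ g (hv F n c) = r • hv F n c ∧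
      r * sB F n (hv F n c) (g (hv F n (c + 1))) = 1 :=
  have hgP := mem_Par_Ioo.1 hg
  exists_map_hv_eq_smul_of_stab hc hcb hb hgP.1 (hgP.2 _ (Or.inl (Nat.le_succ c)))
    (hgP.2 _ (Or.inl le_rfl)) (hgP.2 _ (Or.inr le_rfl))

theorem oddPoint_mem (hc : c % 2 = 0) (hcb : c + 1 < b) {g : Vn F n ≃ₗ[F] Vn F n}
    (hg : g ∈ Par F n (Finset.Ioo (c + 1) b)) : oddPoint F n c g ∈ perpCl F n c b :=
  Submodule.smul_mem _ _
    (map_mem_perpCl_of_mem hg (Nat.le_succ c) (hv_mem_perpCl hcb (by omega)))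

theorem sB_hv_oddPoint (hc : c % 2 = 0) (hcb : c + 1 < b) (hb : b ≤ 2 * n)
    {g : Vn F n ≃ₗ[F] Vn F n} (hg : g ∈ Par F n (Finset.Ioo (c + 1) b)) :
    sB F n (hv F n c) (oddPoint F n c g) = 1 := by
  obtain ⟨r, -, -, h⟩ := exists_map_hv_eq_smul hc hcb hb hg
  rw [oddPoint, sB_smul_right, inv_mul_cancel₀ (right_ne_zero_of_mul_eq_one h)]

theorem oddPoint_one (hc : c % 2 = 0) (hcn : c + 1 < 2 * n) :
    oddPoint F n c 1 = hv F n (c + 1) := by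
  change (sB F n (hv F n c) (hv F n (c + 1)))⁻¹ • hv F n (c + 1) = _
  rw [sB_hv_pair hc hcn, inv_one, one_smul]

theorem oddPoint_mul {g x : Vn F n ≃ₗ[F] Vn F n} (hg : g ∈ SpV F n) {r : F} (hr : r ≠ 0)
    (h : g (hv F n c) = r • hv F n c) : oddPoint F n c (g * x) = r • g (oddPoint F n c x) := by
  have h1 := sB_map hg (hv F n c) (x (hv F n (c + 1)))
  rw [h, sB_smul_left] at h1
  rw [oddPoint, oddPoint, ← h1, LinearEquiv.mul_apply, map_smul, smul_smul]
  congr 1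
  rw [mul_inv, mul_inv_cancel_left₀ hr]

theorem oddPoint_sub_mem (hc : c % 2 = 0) (hcb : c + 1 < b) (hb : b ≤ 2 * n)
    {g g' : Vn F n ≃ₗ[F] Vn F n} (hg : g ∈ Par F n (Finset.Ioo (c + 1) b))
    (hg' : g' ∈ Par F n (Finset.Ioo (c + 1) b)) :
    oddPoint F n c g - oddPoint F n c g' ∈ perpCl F n (c + 1) b :=
  perpCl_succ (sub_mem (oddPoint_mem hc hcb hg) (oddPoint_mem hc hcb hg'))
    (by rw [sB_sub_right, sB_hv_oddPoint hc hcb hb hg, sB_hv_oddPoint hc hcb hb hg', sub_self])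

theorem oddPoint_sub_hv_mem (hc : c % 2 = 0) (hcb : c + 1 < b) (hb : b ≤ 2 * n)
    {g : Vn F n ≃ₗ[F] Vn F n} (hg : g ∈ Par F n (Finset.Ioo (c + 1) b)) :
    oddPoint F n c g - hv F n (c + 1) ∈ perpCl F n (c + 1) b := by
  rw [← oddPoint_one hc (by omega)]
  exact oddPoint_sub_mem hc hcb hb hg (one_mem _)

theorem exists_oddPoint_eq (hc : c % 2 = 0) (hcb : c + 1 < b) (hb : b ≤ 2 * n) {v : Vn F n}
    (h : v - hv F n (c + 1) ∈ perpCl F n (c + 1) b) :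
    ∃ g ∈ Par F n (Finset.Ioo (c + 1) b), oddPoint F n c g = v := by
  have h1 : sB F n (hv F n c) v = 1 := by
    have := h.1 c (Nat.lt_succ_self c)
    rwa [sB_sub_right, sB_hv_pair hc (by omega), sub_eq_zero] at this
  obtain ⟨g, hg, h2⟩ := exists_tvGroup_eq_of_hyperbolic hc (show c < b by omega)
    (perpCl_mono (Nat.le_succ c) le_rfl h) (sB_hv_pair hc (by omega)) h1
  exact ⟨g, tvGroup_le_Par_Ioo le_rfl le_rfl hg, by rw [oddPoint, h2, h1, inv_one, one_smul]⟩

/-- The projection of a vector of `C_{c+1}^⊥` to `C_{c+2}^⊥` along `h_{c+1}`. -/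
def oddProj (F : Type) [Field F] (n c : ℕ) (v : Vn F n) : Vn F n :=
  v + sB F n (hv F n (c + 1)) v • hv F n c

theorem oddProj_mem (hc : c % 2 = 0) (hcb : c + 1 < b) (hb : b ≤ 2 * n) {v : Vn F n}
    (h : v ∈ perpCl F n (c + 1) b) : oddProj F n c v ∈ perpCl F n (c + 2) b := by
  refine perpCl_succ (add_mem h (Submodule.smul_mem _ _
    (hv_mem_perpCl (by omega) (by omega)))) ?_
  rw [oddProj, sB_add_right, sB_smul_right, sB_swap _ (hv F n c), sB_hv_pair hc (by omega)]
  ring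

theorem sB_oddProj {v w : Vn F n} (hv' : v ∈ perpCl F n (c + 1) b)
    (hw : w ∈ perpCl F n (c + 1) b) :
    sB F n (oddProj F n c v) (oddProj F n c w) = sB F n v w := by
  have h1 := hv'.1 c (Nat.lt_succ_self c)
  have h2 := hw.1 c (Nat.lt_succ_self c)
  rw [oddProj, oddProj, sB_add_left, sB_smul_left, sB_add_right, sB_smul_right, sB_add_right,
    sB_smul_right, h2, sB_self, sB_swap v (hv F n c), h1]
  ring

theorem exists_oddAdj₄ (hF : 2 < Cardinal.mk F) (hc : c % 2 = 0) (hcb : c + 4 ≤ b)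
    (hb : b ≤ 2 * n) (x y z t : Vn F n ≃ₗ[F] Vn F n) :
    ∃ w ∈ Par F n (Finset.Ioo (c + 1) b), OddAdj F n c b x w ∧ OddAdj F n c b y w ∧
      OddAdj F n c b z w ∧ OddAdj F n c b t w := by
  have hf : hv F n (c + 2) ∈ perpCl F n (c + 1) b := hv_mem_perpCl (by omega) (by omega)
  have hf' : hv F n (c + 3) ∈ perpCl F n (c + 1) b := hv_mem_perpCl (by omega) (by omega)
  have hff' : sB F n (hv F n (c + 2)) (hv F n (c + 3)) = 1 := sB_hv_pair (by omega) (by omega)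
  obtain ⟨β, hβ1, hβ2⟩ := exists_ne_ne hF (sB F n (hv F n (c + 2)) (oddPoint F n c x))
    (sB F n (hv F n (c + 2)) (oddPoint F n c y))
  obtain ⟨α, hα1, hα2⟩ := exists_ne_ne hF (-sB F n (hv F n (c + 3)) (oddPoint F n c z))
    (-sB F n (hv F n (c + 3)) (oddPoint F n c t))
  obtain ⟨w, hw, h⟩ := exists_oddPoint_eq hc (show c + 1 < b by omega) hb
    (v := hv F n (c + 1) + (α • hv F n (c + 2) + β • hv F n (c + 3)))
    (by rw [add_sub_cancel_left]
        exact add_mem (Submodule.smul_mem _ _ hf) (Submodule.smul_mem _ _ hf'))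
  have e1 : sB F n (hv F n (c + 2)) (oddPoint F n c w) = β := by
    rw [h, sB_add_right, sB_add_right, sB_smul_right, sB_smul_right, sB_self, hff',
      sB_hv_hv_eq_zero (by omega)]
    ring
  have e2 : sB F n (hv F n (c + 3)) (oddPoint F n c w) = -α := by
    rw [h, sB_add_right, sB_add_right, sB_smul_right, sB_smul_right, sB_self,
      sB_swap _ (hv F n (c + 2)), hff', sB_hv_hv_eq_zero (by omega)]
    ring
  refine ⟨w, hw, ⟨_, hf, ?_⟩, ⟨_, hf, ?_⟩, ⟨_, hf', ?_⟩, ⟨_, hf', ?_⟩⟩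
  · rw [sB_sub_right, e1]
    exact sub_ne_zero.2 hβ1.symm
  · rw [sB_sub_right, e1]
    exact sub_ne_zero.2 hβ2.symm
  · rw [sB_sub_right, e2]
    exact fun h => hα1 (by linear_combination h)
  · rw [sB_sub_right, e2]
    exact fun h => hα2 (by linear_combination h)

theorem oddAdj_factor (hc : c % 2 = 0) (hcb : c + 4 ≤ b) (hb : b ≤ 2 * n) {b' : ℕ}
    (hb' : b' = b ∨ b' = c + 4) {x : Vn F n ≃ₗ[F] Vn F n}
    (hx : x ∈ Par F n (Finset.Ioo (c + 1) b)) (h : OddAdj F n c b 1 x)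
    (hxb' : x (hv F n (c + 1)) ∈ Cl F n b') :
    ∃ g ∈ tvGroup F n (c + 2) b', ∃ g' ∈ tvGroup F n (c + 1) (c + 3),
      (g * g')⁻¹ * x ∈ stab F n (c + 2) := by
  have hcb1 : c + 1 < b := by omega
  obtain ⟨r, hr, hrp, hre⟩ := exists_map_hv_eq_smul hc hcb1 hb hx
  obtain ⟨t, ht, htx⟩ := h
  rw [oddPoint_one hc (by omega)] at htx
  have huW := oddPoint_sub_hv_mem hc hcb1 hb hx
  set u := oddPoint F n c x - hv F n (c + 1) with hu
  have huW' : u ∈ perpCl F n (c + 1) b' :=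
    ⟨huW.1, sub_mem (Submodule.smul_mem _ _ hxb') (hv_mem_Cl (by omega))⟩
  have huP := oddProj_mem hc (show c + 1 < b' by omega) (by omega) huW'
  have htP := oddProj_mem hc hcb1 hb ht
  have htu : sB F n (oddProj F n c u) (oddProj F n c t) ≠ 0 := by
    rw [sB_oddProj huW ht]
    refine sB_ne_zero_swap fun h0 => htx ?_
    rw [hu, sB_sub_right] at h0
    rw [sB_sub_right]
    linear_combination -h0
  have wit : ∃ s ∈ perpCl F n (c + 2) b', sB F n (oddProj F n c u) s ≠ 0 := by
    rcases hb' with rfl | rfl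
    · exact ⟨_, htP, htu⟩
    · obtain ⟨α, β, hs⟩ := exists_perpCl_decomp (by omega) (show c + 2 + 1 < b by omega)
        (by omega) htP
      refine ⟨α • hv F n (c + 2) + β • hv F n (c + 2 + 1),
        add_mem (Submodule.smul_mem _ _ (hv_mem_perpCl (by omega) (by omega)))
          (Submodule.smul_mem _ _ (hv_mem_perpCl (by omega) (by omega))), fun h0 => htu ?_⟩
      have := sB_eq_zero_of_mem huP.2 hs
      rw [sub_sub, sB_sub_right, h0, sub_zero] at this
      exact this
  obtain ⟨g, hg, hgu⟩ := exists_tvGroup_eq (hv_mem_perpCl (show c + 2 < b' by omega) (by omega))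
    huP ⟨hv F n (c + 3), hv_mem_perpCl (by omega) (by omega), by
      rw [sB_hv_pair (by omega) (by omega)]
      exact one_ne_zero⟩ wit
  have hpf : hv F n c + hv F n (c + 2) ∈ perpCl F n (c + 1) (c + 3) :=
    add_mem (hv_mem_perpCl (by omega) (by omega)) (hv_mem_perpCl (by omega) (by omega))
  have hg' := transvection_mem hpf 1
  have hg'e : transvection (hv F n c + hv F n (c + 2)) 1 (hv F n (c + 1)) =
      hv F n (c + 1) + (hv F n c + hv F n (c + 2)) := by
    rw [transvection_apply, sB_add_left, sB_hv_pair hc (by omega),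
      sB_hv_hv_eq_zero (k := c + 2) (by omega), add_zero, one_mul, one_smul]
  refine ⟨g, hg, _, hg', inv_mul_mem_stab (l := c + 1)
    (r := sB F n (hv F n c) (x (hv F n (c + 1))))
    (m := -(sB F n (hv F n c) (x (hv F n (c + 1))) * (1 + sB F n (hv F n (c + 1)) u)) • hv F n c)
    ((mem_Par_Ioo.1 hx).2 _ (Or.inl le_rfl))
    (mul_mem (tvGroup_le_stab (Or.inl (Nat.le_succ _)) hg) (tvGroup_le_stab (Or.inl le_rfl) hg'))
    (Submodule.smul_mem _ _ (hv_mem_Cl (Nat.lt_succ_self c))) ?_⟩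
  rw [LinearEquiv.mul_apply, hg'e, map_add, map_add, hgu, tvGroup_fix hg (hv_mem_Cl (by omega)),
    tvGroup_fix hg (hv_mem_Cl (by omega))]
  have hxe : x (hv F n (c + 1)) =
      sB F n (hv F n c) (x (hv F n (c + 1))) • (u + hv F n (c + 1)) := by
    rw [hu, sub_add_cancel, oddPoint, smul_smul,
      mul_inv_cancel₀ (right_ne_zero_of_mul_eq_one hre), one_smul]
  conv_lhs => rw [hxe]
  rw [oddProj]
  module

theorem oddAdj_adjGeometry (hF : 2 < Cardinal.mk F) (hc : c % 2 = 0) (hcb : c + 4 ≤ b)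
    (hb : b ≤ 2 * n) : AdjGeometry F n (c + 1) b (OddAdj F n c b) where
  symm := by
    rintro x y ⟨t, ht, h⟩
    refine ⟨t, ht, ?_⟩
    rwa [← neg_sub, sB_neg_right, neg_ne_zero]
  mul_left := by
    rintro g hg x y ⟨t, ht, h⟩
    obtain ⟨r, hr, hrp, -⟩ := exists_map_hv_eq_smul hc (show c + 1 < b by omega) hb hg
    have hgS := (mem_Par_Ioo.1 hg).1
    refine ⟨g t, map_mem_perpCl_of_mem hg le_rfl ht, ?_⟩
    rw [oddPoint_mul hgS hr hrp, oddPoint_mul hgS hr hrp, ← smul_sub, ← map_sub, sB_smul_right,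
      sB_map hgS]
    exact mul_ne_zero hr h
  mul_right := by
    rintro x hx y hy p hp hp1 ⟨t, ht, h⟩
    obtain ⟨r, hr, m, hm, h1⟩ := exists_map_hv_eq (show c + 1 < 2 * n by omega)
      ((mem_Par_Ioo.1 hp).2 _ (Or.inl le_rfl)) hp1
    have hym := mem_stab.1 ((mem_Par_Ioo.1 hy).2 _ (Or.inl le_rfl)) _ hm
    have h2 : sB F n (hv F n c) (y m) = 0 := by
      rw [sB_swap, sB_eq_zero_of_mem hym
        (hv_mem_perpCl (b := b) (show c < b by omega) (by omega)), neg_zero]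
    refine ⟨t, ht, ?_⟩
    have h3 : oddPoint F n c (y * p) = oddPoint F n c y +
        (r * sB F n (hv F n c) (y (hv F n (c + 1))))⁻¹ • y m := by
      rw [oddPoint, oddPoint, LinearEquiv.mul_apply, h1, map_add, map_smul, sB_add_right,
        sB_smul_right, h2, add_zero, smul_add, smul_smul, mul_inv, mul_right_comm,
        inv_mul_cancel₀ hr, one_mul]
    rw [h3, ← sub_sub, sB_sub_right, sB_smul_right, sB_swap t (y m), sB_eq_zero_of_mem hym ht,
      neg_zero, mul_zero, sub_zero]
    exact h
  irrefl := by
    rintro ⟨t, -, h⟩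
    exact h (by rw [sub_self, sB_zero_right])
  adj x hx hx2 hx1 := by
    have hxa : x (hv F n (c + 1)) ∉ Cl F n (c + 2) := fun h1 => hx1
      (stab_succ ((mem_Par_Ioo.1 hx).2 _ (Or.inl le_rfl)) h1)
    obtain ⟨s, hs, -, hse⟩ := exists_map_hv_eq_smul hc (show c + 1 < b by omega) hb hx
    obtain ⟨r, hr, hr0⟩ := exists_sub_smul_mem_Cl
      (mem_stab.1 hx2 _ (hv_mem_Cl (show c + 1 < c + 3 by omega)))
    have hf' : hv F n (c + 3) ∈ perpCl F n (c + 2) b := hv_mem_perpCl (by omega) (by omega)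
    have h1 := sB_eq_zero_of_mem hr hf'
    rw [sB_sub_left, sB_smul_left, sB_hv_pair (by omega) (by omega), mul_one, sub_eq_zero] at h1
    refine ⟨_, perpCl_mono (Nat.le_succ _) le_rfl hf', ?_⟩
    rw [oddPoint_one hc (by omega), sB_sub_right, sB_hv_hv_eq_zero (by omega), zero_sub,
      neg_ne_zero, oddPoint, sB_smul_right]
    refine mul_ne_zero (inv_ne_zero (right_ne_zero_of_mul_eq_one hse)) ?_
    rw [sB_swap, h1, neg_ne_zero]
    exact hr0 hxa
  factor b' hb' x hx h hxb' := oddAdj_factor hc hcb hb hb' hx h hxb'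
  three x _ y _ z _ := by
    obtain ⟨w, hw, h1, h2, h3, -⟩ := exists_oddAdj₄ hF hc hcb hb x y z z
    exact ⟨w, hw, h1, h2, h3⟩
  quad x _ y _ z _ t _ _ _ _ _ := Or.inr (Or.inr (exists_oddAdj₄ hF hc hcb hb x y z t))

theorem oddAdj_triangleGeometry (hF : 2 < Cardinal.mk F) (hc : c % 2 = 0) (hcb : c + 4 ≤ b)
    (hb : b ≤ 2 * n) : TriangleGeometry F n (c + 1) b (OddAdj F n c b) (OddGood F n c) where
  toAdjGeometry := oddAdj_adjGeometry hF hc hcb hb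
  good x hx y hy _ _ _ hg := by
    have hcb1 : c + 1 < b := by omega
    have hxW := oddPoint_sub_hv_mem hc hcb1 hb hx
    have hyW := oddPoint_sub_hv_mem hc hcb1 hb hy
    have hxP := oddProj_mem hc hcb1 hb hxW
    have hyP := oddProj_mem hc hcb1 hb hyW
    rw [OddGood, ← sB_oddProj hxW hyW] at hg
    have back : ∀ x ∈ Par F n (Finset.Ioo (c + 1) b), ∀ g ∈ tvGroup F n (c + 2) b,
        g (oddProj F n c (oddPoint F n c x - hv F n (c + 1))) ∈ Cl F n (c + 4) →
        (g * x) (hv F n (c + 1)) ∈ Cl F n (c + 4) := by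
      intro x hx g hg h
      obtain ⟨r, hr, -, hre⟩ := exists_map_hv_eq_smul hc hcb1 hb hx
      have h1 : x (hv F n (c + 1)) = sB F n (hv F n c) (x (hv F n (c + 1))) • oddPoint F n c x := by
        rw [oddPoint, smul_smul, mul_inv_cancel₀ (right_ne_zero_of_mul_eq_one hre), one_smul]
      rw [LinearEquiv.mul_apply, h1, map_smul]
      refine Submodule.smul_mem _ _ ?_
      rw [oddProj, map_add, map_smul, tvGroup_fix hg (hv_mem_Cl (by omega)), map_sub,
        tvGroup_fix hg (hv_mem_Cl (by omega))] at h
      have h2 := sub_mem h (Submodule.smul_mem _ (sB F n (hv F n (c + 1))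
        (oddPoint F n c x - hv F n (c + 1))) (hv_mem_Cl (F := F) (n := n)
          (show c < c + 4 by omega)))
      rw [add_sub_cancel_right] at h2
      have h3 := add_mem h2 (hv_mem_Cl (F := F) (n := n) (show c + 1 < c + 4 by omega))
      rwa [sub_add_cancel] at h3
    have hx' := back x hx
    have hy' := back y hy
    set u := oddProj F n c (oddPoint F n c x - hv F n (c + 1))
    set w := oddProj F n c (oddPoint F n c y - hv F n (c + 1))
    obtain ⟨p, hp, hpu⟩ := exists_tvGroup_eq
      (hv_mem_perpCl (show c + 2 < b by omega) (by omega)) hxP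
      ⟨hv F n (c + 3), hv_mem_perpCl (by omega) (by omega), by
        rw [sB_hv_pair (by omega) (by omega)]
        exact one_ne_zero⟩ ⟨w, hyP, hg⟩
    have hpS := tvGroup_le_SpV _ _ hp
    have hpw : p⁻¹ w ∈ perpCl F n (c + 2) b :=
      tvGroup_map_mem (inv_mem hp) le_rfl hyP
    have hfw : sB F n (hv F n (c + 2)) (p⁻¹ w) = sB F n u w := by
      rw [← sB_map hpS, hpu, apply_inv_self]
    obtain ⟨q, hq, hqw⟩ := exists_map_hv_succ_eq (a := c + 2) (by omega) (by omega) hb hpw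
      (by rw [hfw]; exact hg)
    have hpq := mul_mem hp (tvGroup_mono (Nat.le_succ _) le_rfl hq)
    refine ⟨p * q, hpq, hx' _ (inv_mem hpq) ?_, hy' _ (inv_mem hpq) ?_⟩
    · rw [_root_.mul_inv_rev, LinearEquiv.mul_apply, ← hpu, inv_apply_self,
        tvGroup_fix (inv_mem hq) (hv_mem_Cl (by omega))]
      exact hv_mem_Cl (by omega)
    · rw [_root_.mul_inv_rev, LinearEquiv.mul_apply, ← hqw, map_smul, inv_apply_self]
      exact Submodule.smul_mem _ _ (hv_mem_Cl (by omega))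
  bad x hx y hy h1x h1y hxy := by
    rw [or_iff_not_imp_left]
    intro hng
    have hcb1 : c + 1 < b := by omega
    have hxW := oddPoint_sub_hv_mem hc hcb1 hb hx
    have hyW := oddPoint_sub_hv_mem hc hcb1 hb hy
    have hO := oddPoint_one (F := F) hc (show c + 1 < 2 * n by omega)
    rw [OddGood, not_not] at hng
    have neg : ∀ v v' : Vn F n, (∃ t ∈ perpCl F n (c + 1) b, sB F n t (v - v') ≠ 0) →
        ∃ t ∈ perpCl F n (c + 1) b, sLin (v' - v) t ≠ 0 := by
      rintro v v' ⟨t, ht, h⟩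
      refine ⟨t, ht, ?_⟩
      change sB F n (v' - v) t ≠ 0
      rwa [sB_swap, ← sB_neg_right, neg_sub]
    have h1 := neg _ _ h1x
    have h2 := neg _ _ h1y
    have h3 := neg _ _ hxy
    rw [hO] at h1 h2
    obtain ⟨w, hw, hxw, hyw, hxyw⟩ := exists_mem_ne_zero₃ hF _ h1 h2 h3
    obtain ⟨g, hg, hgw⟩ := exists_oddPoint_eq hc hcb1 hb (v := hv F n (c + 1) + w)
      (by rwa [add_sub_cancel_left])
    change sB F n _ w ≠ 0 at hxw hyw hxyw
    have e1 : oddPoint F n c g - hv F n (c + 1) = w := by rw [hgw, add_sub_cancel_left]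
    have hxi := inv_mem hx
    obtain ⟨r, hr, hrp, -⟩ := exists_map_hv_eq_smul hc hcb1 hb hxi
    have hxS := (mem_Par_Ioo.1 hxi).1
    refine ⟨g, hg, ⟨_, hxW, ?_⟩, ⟨_, hxW, ?_⟩, ⟨_, hyW, ?_⟩, ?_, ?_, ?_⟩
    · rw [hO, ← neg_sub (oddPoint F n c g), e1, sB_neg_right, neg_ne_zero]
      exact hxw
    · have : oddPoint F n c x - oddPoint F n c g = (oddPoint F n c x - hv F n (c + 1)) - w := by
        rw [← e1, sub_sub_sub_cancel_right]
      rw [this, sB_sub_right, sB_self, zero_sub, neg_ne_zero]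
      exact hxw
    · have : oddPoint F n c y - oddPoint F n c g = (oddPoint F n c y - hv F n (c + 1)) - w := by
        rw [← e1, sub_sub_sub_cancel_right]
      rw [this, sB_sub_right, sB_self, zero_sub, neg_ne_zero]
      exact hyw
    · rw [OddGood, e1]
      exact hxw
    · rw [OddGood, e1]
      exact hyw
    · have e2 : hv F n (c + 1) = oddPoint F n c (x⁻¹ * x) := by rw [inv_mul_cancel, hO]
      rw [OddGood, e2, oddPoint_mul hxS hr hrp, oddPoint_mul hxS hr hrp, oddPoint_mul hxS hr hrp,
        ← smul_sub, ← smul_sub, ← map_sub, ← map_sub, sB_smul_left, sB_smul_right, sB_map hxS]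
      refine mul_ne_zero hr (mul_ne_zero hr ?_)
      have e3 : oddPoint F n c g - oddPoint F n c x = w - (oddPoint F n c x - hv F n (c + 1)) := by
        rw [← e1, sub_sub_sub_cancel_right]
      have e4 : sB F n (oddPoint F n c y - oddPoint F n c x)
          (oddPoint F n c x - hv F n (c + 1)) = 0 := by
        rw [← sub_sub_sub_cancel_right (oddPoint F n c y) _ (hv F n (c + 1)), sB_sub_left,
          sB_self, sub_zero, sB_swap, hng, neg_zero]
      rw [e3, sB_sub_right, e4, sub_zero]
      exact hxyw

end Odd

/-! ### Factorization and generation of parabolic subgroups -/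

theorem exists_adjGeometry (hF : 2 < Cardinal.mk F) {a b : ℕ} (hab : a + 3 ≤ b) (hb : b ≤ 2 * n) :
    ∃ A, AdjGeometry F n a b A := by
  rcases Nat.mod_two_eq_zero_or_one a with ha | ha
  · exact ⟨_, evenAdj_adjGeometry hF ha hab hb⟩
  · obtain ⟨c, rfl⟩ : ∃ c, a = c + 1 := ⟨a - 1, by omega⟩
    exact ⟨_, oddAdj_adjGeometry hF (by omega) (by omega) hb⟩

theorem exists_triangleGeometry (hF : 2 < Cardinal.mk F) {a b : ℕ} (hab : a + 4 ≤ b)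
    (hb : b ≤ 2 * n) : ∃ A Good, TriangleGeometry F n a b A Good := by
  rcases Nat.mod_two_eq_zero_or_one a with ha | ha
  · exact ⟨_, _, evenAdj_triangleGeometry hF ha hab hb⟩
  · obtain ⟨c, rfl⟩ : ∃ c, a = c + 1 := ⟨a - 1, by omega⟩
    exact ⟨_, _, oddAdj_triangleGeometry hF (by omega) (by omega) hb⟩

/-- Transitivity of the transvection group of `C_a^⊥ ∩ C_b` on the images of `C_{a+1}`. -/
theorem exists_tvGroup_inv_mul_mem_stab {a b : ℕ} (hab : a < b) (hb : b ≤ 2 * n)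
    {g : Vn F n ≃ₗ[F] Vn F n} (hg : g ∈ SpV F n) (ha : ∀ l ≤ a, g ∈ stab F n l)
    (hgb : g ∈ stab F n b) : ∃ γ ∈ tvGroup F n a b, γ⁻¹ * g ∈ stab F n (a + 1) := by
  obtain rfl | hab := Nat.eq_or_lt_of_le (Nat.succ_le_of_lt hab)
  · exact ⟨1, one_mem _, by rwa [inv_one, one_mul]⟩
  have hab' : a + 1 < b := hab
  rcases Nat.mod_two_eq_zero_or_one a with h | h
  · have he : hv F n a ∈ perpCl F n a b := hv_mem_perpCl (by omega) (by omega)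
    have hf : hv F n (a + 1) ∈ perpCl F n a b := hv_mem_perpCl hab' (by omega)
    have hef : sB F n (hv F n a) (hv F n (a + 1)) ≠ 0 := by
      rw [sB_hv_pair h (by omega)]
      exact one_ne_zero
    obtain ⟨γ, hγ, h1⟩ := exists_tvGroup_eq he (map_mem_perpCl hg (ha a le_rfl) hgb he)
      ⟨_, hf, hef⟩ ⟨_, map_mem_perpCl hg (ha a le_rfl) hgb hf, by rwa [sB_map hg]⟩
    refine ⟨γ, hγ, inv_mul_mem_stab (ha a le_rfl) (tvGroup_le_stab (Or.inl le_rfl) hγ)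
      (r := 1) (zero_mem _) ?_⟩
    rw [h1, one_smul, add_zero]
  · obtain ⟨c, rfl⟩ : ∃ c, a = c + 1 := ⟨a - 1, by omega⟩
    have hc : c % 2 = 0 := by omega
    obtain ⟨r, hr, -, hr1⟩ := exists_map_hv_eq_smul_of_stab hc (by omega) hb hg
      (ha c (Nat.le_succ c)) (ha _ le_rfl) hgb
    have hf : hv F n (c + 1) ∈ perpCl F n c b := hv_mem_perpCl (by omega) (by omega)
    have hgf := map_mem_perpCl hg (ha c (Nat.le_succ c)) hgb hf
    obtain ⟨γ, hγ, h1⟩ := exists_tvGroup_eq_of_hyperbolic hc (show c < b by omega)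
      (sub_mem (Submodule.smul_mem _ r hgf) hf) (sB_hv_pair hc (by omega))
      (by rw [sB_smul_right, hr1])
    refine ⟨γ, hγ, inv_mul_mem_stab (ha _ le_rfl) (tvGroup_le_stab (Or.inl le_rfl) hγ)
      (r := r⁻¹) (zero_mem _) ?_⟩
    rw [h1, inv_smul_smul₀ hr, add_zero]

theorem exists_Par_mul_Par {J : Finset ℕ} {l : ℕ} (hl : l ∉ J) (hln : l ≤ 2 * n)
    {g : Vn F n ≃ₗ[F] Vn F n} (hg : g ∈ Par F n J) :
    ∃ a ∈ Par F n (J.filter (· < l)), ∃ b ∈ Par F n (J.filter (l < ·)), g = a * b := by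
  have key : ∀ i ≤ l, ∃ a ∈ Par F n (J.filter (· < l)), ∀ k ≤ i, a⁻¹ * g ∈ stab F n k := by
    intro i
    induction i with
    | zero =>
      refine fun _ => ⟨1, one_mem _, fun k hk => ?_⟩
      rw [inv_one, one_mul, Nat.le_zero.1 hk, mem_stab, Cl_zero]
      rintro v hv
      rw [(Submodule.mem_bot F).1 hv, map_zero]
      exact zero_mem _
    | succ i ih =>
      intro hi
      obtain ⟨a, ha, h1⟩ := ih (by omega)
      have haJ := mul_mem (inv_mem (Par_mono F n (Finset.filter_subset _ _) ha)) hg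
      have hex : ∃ b, i < b ∧ b ∉ J := ⟨l, hi, hl⟩
      classical
      obtain ⟨hb, hbJ⟩ := Nat.find_spec hex
      have hbl : Nat.find hex ≤ l := Nat.find_min' hex ⟨hi, hl⟩
      have hmin (k : ℕ) (h2 : k < Nat.find hex) (h3 : i < k) : k ∈ J := by
        by_contra h4
        exact Nat.find_min hex h2 ⟨h3, h4⟩
      generalize Nat.find hex = b at *
      obtain ⟨γ, hγ, h2⟩ := exists_tvGroup_inv_mul_mem_stab hb (by omega)
        (mem_Par.1 haJ).1 h1 ((mem_Par.1 haJ).2 b hbJ)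
      refine ⟨a * γ, mul_mem ha (tvGroup_le_Par (fun k h3 h4 => ?_) hγ), fun k hk => ?_⟩
      · exact Finset.mem_filter.2 ⟨hmin k h4 h3, by omega⟩
      · rw [_root_.mul_inv_rev, mul_assoc]
        obtain rfl | hk := Nat.eq_or_lt_of_le hk
        · exact h2
        · exact mul_mem (inv_mem (tvGroup_le_stab (Or.inl (by omega)) hγ)) (h1 k (by omega))
  obtain ⟨a, ha, h1⟩ := key l le_rfl
  have haJ := mem_Par.1 (mul_mem (inv_mem (Par_mono F n (Finset.filter_subset _ _) ha)) hg)
  refine ⟨a, ha, a⁻¹ * g, mem_Par.2 ⟨haJ.1, fun k hk => ?_⟩, (mul_inv_cancel_left a g).symm⟩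
  rcases le_or_gt k l with h2 | h2
  · exact h1 k h2
  · exact haJ.2 k fun h3 => hk (Finset.mem_filter.2 ⟨h3, h2⟩)

/-- A finite set of naturals is an interval or has a gap. -/
theorem exists_eq_Ioo_or_gap {J : Finset ℕ} {N : ℕ} (hJ : J ⊆ Finset.Icc 1 N) (h0 : J.Nonempty) :
    (∃ a b, J = Finset.Ioo a b ∧ b ≤ N + 1) ∨ ∃ l ∉ J, (∃ i ∈ J, i < l) ∧ ∃ j ∈ J, l < j := by
  by_cases h : ∃ l ∉ J, (∃ i ∈ J, i < l) ∧ ∃ j ∈ J, l < j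
  · exact Or.inr h
  have h1 := Finset.mem_Icc.1 (hJ (J.min'_mem h0))
  have h2 := Finset.mem_Icc.1 (hJ (J.max'_mem h0))
  refine Or.inl ⟨J.min' h0 - 1, J.max' h0 + 1, ?_, by omega⟩
  ext k
  rw [Finset.mem_Ioo]
  refine ⟨fun hk => ?_, fun hk => ?_⟩
  · have := J.min'_le k hk
    have := J.le_max' k hk
    omega
  · by_contra hkJ
    have h3 : k ≠ J.min' h0 := fun h => hkJ (h ▸ J.min'_mem h0)
    have h4 : k ≠ J.max' h0 := fun h => hkJ (h ▸ J.max'_mem h0)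
    exact h ⟨k, hkJ, ⟨_, J.min'_mem h0, by omega⟩, _, J.max'_mem h0, by omega⟩

theorem AdjGeometry.Par_le {a b : ℕ} {A} (T : AdjGeometry F n a b A) (hab : a + 3 ≤ b)
    {M : Subgroup (Vn F n ≃ₗ[F] Vn F n)} (h₁ : Par F n ((Finset.Ioo a b).erase (a + 1)) ≤ M)
    (h₂ : Par F n ((Finset.Ioo a b).erase (a + 2)) ≤ M) : Par F n (Finset.Ioo a b) ≤ M := by
  have tv {c d i : ℕ} (hc : a ≤ c) (hd : d ≤ b) (h : i ≤ c ∨ d ≤ i) :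
      tvGroup F n c d ≤ Par F n ((Finset.Ioo a b).erase i) :=
    tvGroup_le_Par fun l h1 h2 => by
      rw [Finset.mem_erase, Finset.mem_Ioo]
      omega
  have le (i : ℕ) : Par F n ((Finset.Ioo a b).erase i) ≤ Par F n (Finset.Ioo a b) :=
    Par_mono F n (Finset.erase_subset _ _)
  have key : ∀ x ∈ Par F n (Finset.Ioo a b), A 1 x → x ∈ M := by
    intro x hx h
    obtain ⟨g, hg, g', hg', h1⟩ := T.factor b (Or.inl rfl) x hx h
      (mem_stab.1 ((mem_Par_Ioo.1 hx).2 b (Or.inr le_rfl)) _ (hv_mem_Cl (by omega)))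
    have hgP := tv (i := a + 1) (by omega) (by omega) (by omega) hg
    have hgP' := tv (i := a + 2) (by omega) (by omega) (by omega) hg'
    have h2 := h₁ (Par_erase (mul_mem (inv_mem (mul_mem (le _ hgP) (le _ hgP'))) hx) h1)
    have h3 := mul_mem (mul_mem (h₁ hgP) (h₂ hgP')) h2
    rwa [mul_inv_cancel_left] at h3
  intro x hx
  obtain ⟨w, hw, hxw, h1w, -⟩ := T.three x hx 1 (one_mem _) 1 (one_mem _)
  have h1 := T.mul_left w⁻¹ (inv_mem hw) _ _ (T.symm _ _ hxw)
  rw [inv_mul_cancel] at h1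
  have h2 := mul_mem (key w hw h1w) (key _ (mul_mem (inv_mem hw) hx) h1)
  rwa [mul_inv_cancel_left] at h2

/-- A parabolic subgroup is generated by the minimal parabolic subgroups it contains. -/
theorem Par_le (hF : 2 < Cardinal.mk F) {M : Subgroup (Vn F n ≃ₗ[F] Vn F n)}
    (h0 : Par F n ∅ ≤ M) {J : Finset ℕ} (hJ : J ⊆ Finset.Icc 1 (2 * n - 1))
    (h1 : ∀ j ∈ J, Par F n {j} ≤ M) : Par F n J ≤ M := by
  induction J using Finset.strongInduction with
  | H J ih =>
  have ih' : ∀ J' ⊂ J, Par F n J' ≤ M := fun J' h =>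
    ih J' h (h.1.trans hJ) fun j hj => h1 j (h.1 hj)
  rcases J.eq_empty_or_nonempty with rfl | hne
  · exact h0
  rcases exists_eq_Ioo_or_gap hJ hne with ⟨a, b, rfl, hb⟩ | ⟨l, hl, ⟨i, hi, hil⟩, j, hj, hlj⟩
  · have hab' : a + 1 < b := by
      obtain ⟨k, hk⟩ := hne
      rw [Finset.mem_Ioo] at hk
      omega
    rcases Nat.lt_or_ge b (a + 3) with h2 | h2
    · have : Finset.Ioo a b = {a + 1} := by
        ext k
        rw [Finset.mem_Ioo, Finset.mem_singleton]
        omega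
      rw [this]
      exact h1 _ (Finset.mem_Ioo.2 ⟨by omega, by omega⟩)
    · obtain ⟨A, T⟩ := exists_adjGeometry (n := n) hF h2 (by omega)
      exact T.Par_le h2
        (ih' _ (Finset.erase_ssubset (Finset.mem_Ioo.2 ⟨by omega, by omega⟩)))
        (ih' _ (Finset.erase_ssubset (Finset.mem_Ioo.2 ⟨by omega, by omega⟩)))
  · intro g hg
    have hj1 := Finset.mem_Icc.1 (hJ hj)
    obtain ⟨x, hx, y, hy, rfl⟩ := exists_Par_mul_Par hl (by omega) hg
    exact mul_mem
      (ih' _ (Finset.filter_ssubset.2 ⟨j, hj, by omega⟩) hx)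
      (ih' _ (Finset.filter_ssubset.2 ⟨i, hi, by omega⟩) hy)

/-- Partial homomorphisms on `P_J` agree if they agree on all minimal parabolic subgroups. -/
theorem HomOn.eq_of_mem_Par (hF : 2 < Cardinal.mk F) {K : Type*} [Group K]
    {φ ψ : (Vn F n ≃ₗ[F] Vn F n) → K} {J : Finset ℕ} (hJ : J ⊆ Finset.Icc 1 (2 * n - 1))
    (hφ : HomOn φ (Par F n J)) (hψ : HomOn ψ (Par F n J)) (h0 : ∀ g ∈ Par F n ∅, φ g = ψ g)
    (h1 : ∀ j ∈ J, ∀ g ∈ Par F n {j}, φ g = ψ g) : ∀ g ∈ Par F n J, φ g = ψ g := by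
  intro g hg
  refine hφ.eqOn_closure hψ (S := {g | g ∈ Par F n J ∧ φ g = ψ g}) (fun _ h => h.1)
    (fun _ h => h.2) (Par_le hF (fun x hx => Subgroup.subset_closure ?_) hJ
      (fun j hj x hx => Subgroup.subset_closure ?_) hg)
  · exact ⟨Par_mono F n (Finset.empty_subset J) hx, h0 x hx⟩
  · exact ⟨Par_mono F n (Finset.singleton_subset_iff.2 hj) hx, h1 j hj x hx⟩

variable {K : Type*} [Group K]

/-! ### Extension of compatible families -/

section Extension

variable {φ : (Vn F n ≃ₗ[F] Vn F n) → K} {J : Finset ℕ}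

theorem exists_extend_of_mul (hF : 2 < Cardinal.mk F) (hJ : J ⊆ Finset.Icc 1 (2 * n - 1))
    (h : ∀ J' ⊂ J, HomOn φ (Par F n J')) (p q : ℕ → Prop) [DecidablePred p] [DecidablePred q]
    (hpq : ∀ j ∈ J, p j → ¬ q j) (hcov : ∀ j ∈ J, p j ∨ q j)
    (hmul : ∀ U ⊆ J, ∀ x ∈ Par F n U, ∃ a ∈ Par F n (U.filter p), ∃ b ∈ Par F n (U.filter q),
      x = a * b) (hp : 2 ≤ (J.filter p).card) (hq : ∃ j ∈ J, q j) :
    ∃ Φ : (Vn F n ≃ₗ[F] Vn F n) → K, HomOn Φ (Par F n J) ∧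
      ∀ J' ⊂ J, ∀ g ∈ Par F n J', Φ g = φ g := by
  obtain ⟨i₀, hi₀, i₁, hi₁, hne⟩ := Finset.one_lt_card.1 hp
  rw [Finset.mem_filter] at hi₀ hi₁
  obtain ⟨j₀, hj₀, hqj₀⟩ := hq
  have hpJ : J.filter p ⊂ J := Finset.filter_ssubset.2 ⟨j₀, hj₀, fun h => hpq _ hj₀ h hqj₀⟩
  have hqJ : J.filter q ⊂ J := Finset.filter_ssubset.2 ⟨i₀, hi₀.1, hpq _ hi₀.1 hi₀.2⟩
  have hgen : Par F n (J.filter p) ≤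
      Subgroup.closure {g | ∃ i ∈ J, p i ∧ g ∈ Par F n {i}} := by
    refine Par_le hF (fun g hg => Subgroup.subset_closure ?_)
      ((Finset.filter_subset _ _).trans hJ) fun j hj g hg => Subgroup.subset_closure ?_
    · exact ⟨i₀, hi₀.1, hi₀.2, Par_mono F n (Finset.empty_subset _) hg⟩
    · exact ⟨j, (Finset.mem_filter.1 hj).1, (Finset.mem_filter.1 hj).2, hg⟩
  obtain ⟨Φ, hΦ, hΦp, hΦq⟩ := HomOn.exists_extend_mul (φ := φ) (H := Par F n J)
    (Par_mono F n hpJ.1) (Par_mono F n hqJ.1) (hmul J subset_rfl) (h _ hpJ) (h _ hqJ)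
    (S := {g | ∃ i ∈ J, p i ∧ g ∈ Par F n {i}})
    (fun g ⟨i, hi, hpi, hg⟩ => Par_mono F n
      (Finset.singleton_subset_iff.2 (Finset.mem_filter.2 ⟨hi, hpi⟩)) hg)
    hgen (by
      rintro a ⟨i, hi, hpi, ha⟩ b hb
      have hUJ : insert i (J.filter q) ⊂ J := by
        refine (Finset.ssubset_iff_of_subset (Finset.insert_subset hi hqJ.1)).2 ?_
        obtain ⟨k, hk, hki⟩ : ∃ k, (k ∈ J ∧ p k) ∧ k ≠ i := by
          by_cases h1 : i₀ = i
          · exact ⟨i₁, hi₁, fun h2 => hne (h1.trans h2.symm)⟩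
          · exact ⟨i₀, hi₀, h1⟩
        refine ⟨k, hk.1, fun h1 => ?_⟩
        rcases Finset.mem_insert.1 h1 with h1 | h1
        · exact hki h1
        · exact hpq _ hk.1 hk.2 (Finset.mem_filter.1 h1).2
      have haU : a ∈ Par F n (insert i (J.filter q)) :=
        Par_mono F n (Finset.singleton_subset_iff.2 (Finset.mem_insert_self _ _)) ha
      have hbU : b ∈ Par F n (insert i (J.filter q)) :=
        Par_mono F n (Finset.subset_insert _ _) hb
      obtain ⟨a', ha', b', hb', h1⟩ := hmul _ hUJ.1 _ (mul_mem hbU haU)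
      have ha'U := Par_mono F n (Finset.filter_subset _ _) ha'
      have hb'U := Par_mono F n (Finset.filter_subset _ _) hb'
      refine ⟨a', Par_mono F n (Finset.filter_subset_filter _ hUJ.1) ha', b',
        Par_mono F n (Finset.filter_subset_filter _ hUJ.1) hb', h1, ?_⟩
      rw [← h _ hUJ b hbU a haU, h1, h _ hUJ a' ha'U b' hb'U])
  refine ⟨Φ, hΦ, fun J' hJ' => HomOn.eq_of_mem_Par hF (hJ'.1.trans hJ)
    (hΦ.mono (Par_mono F n hJ'.1)) (h J' hJ')
    (fun g hg => hΦp g (Par_mono F n (Finset.empty_subset _) hg)) fun j hj g hg => ?_⟩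
  rcases hcov j (hJ'.1 hj) with h1 | h1
  · exact hΦp g (Par_mono F n
      (Finset.singleton_subset_iff.2 (Finset.mem_filter.2 ⟨hJ'.1 hj, h1⟩)) hg)
  · exact hΦq g (Par_mono F n
      (Finset.singleton_subset_iff.2 (Finset.mem_filter.2 ⟨hJ'.1 hj, h1⟩)) hg)

/-- `P_J` is the completion of the amalgam of its proper parabolic subgroups if `J` has at least
three elements. -/
theorem exists_extend_Par (hF : 2 < Cardinal.mk F) (hJ : J ⊆ Finset.Icc 1 (2 * n - 1))
    (hcard : 3 ≤ J.card) (h : ∀ J' ⊂ J, HomOn φ (Par F n J')) :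
    ∃ Φ : (Vn F n ≃ₗ[F] Vn F n) → K, HomOn Φ (Par F n J) ∧
      ∀ J' ⊂ J, ∀ g ∈ Par F n J', Φ g = φ g := by
  rcases exists_eq_Ioo_or_gap hJ (Finset.card_pos.1 (by omega)) with
    ⟨a, b, rfl, hb⟩ | ⟨l, hl, ⟨i, hi, hil⟩, j, hj, hlj⟩
  · rw [Nat.card_Ioo] at hcard
    have hab : a + 4 ≤ b := by omega
    obtain ⟨A, Good, T⟩ := exists_triangleGeometry (n := n) hF hab (by omega)
    have hs (i : ℕ) (h1 : a < i) (h2 : i < b) : (Finset.Ioo a b).erase i ⊂ Finset.Ioo a b :=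
      Finset.erase_ssubset (Finset.mem_Ioo.2 ⟨h1, h2⟩)
    obtain ⟨Φ, hΦ, hΦ₁, hΦ₂⟩ := (T.simplyConnectedSystem hab).exists_extend
      (h _ (hs (a + 1) (by omega) (by omega))) (h _ (hs (a + 2) (by omega) (by omega)))
      (h _ (hs (a + 3) (by omega) (by omega)))
    refine ⟨Φ, hΦ, fun J' hJ' => HomOn.eq_of_mem_Par hF (hJ'.1.trans hJ)
      (hΦ.mono (Par_mono F n hJ'.1)) (h J' hJ')
      (fun g hg => hΦ₁ g (Par_mono F n (Finset.empty_subset _) hg)) fun j hj g hg => ?_⟩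
    have hjJ := hJ'.1 hj
    by_cases h1 : j = a + 1
    · exact hΦ₂ g (Par_mono F n
        (Finset.singleton_subset_iff.2 (Finset.mem_erase.2 ⟨by omega, hjJ⟩)) hg)
    · exact hΦ₁ g (Par_mono F n
        (Finset.singleton_subset_iff.2 (Finset.mem_erase.2 ⟨h1, hjJ⟩)) hg)
  · have hj1 := Finset.mem_Icc.1 (hJ hj)
    have hfac : ∀ U ⊆ J, ∀ x ∈ Par F n U, ∃ a ∈ Par F n (U.filter (· < l)),
        ∃ b ∈ Par F n (U.filter (l < ·)), x = a * b :=
      fun U hU x hx => exists_Par_mul_Par (fun h1 => hl (hU h1)) (by omega) hx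
    have hcov : ∀ j ∈ J, j < l ∨ l < j := fun k hk =>
      lt_or_gt_of_ne fun h1 => hl (h1 ▸ hk)
    by_cases h2 : 2 ≤ (J.filter (· < l)).card
    · exact exists_extend_of_mul hF hJ h (· < l) (l < ·) (fun k _ h1 => by omega) hcov hfac h2
        ⟨j, hj, hlj⟩
    · refine exists_extend_of_mul hF hJ h (l < ·) (· < l) (fun k _ h1 => by omega)
        (fun k hk => (hcov k hk).symm) (fun U hU x hx => ?_) ?_ ⟨i, hi, hil⟩
      · obtain ⟨a, ha, b, hb, h1⟩ := hfac U hU x⁻¹ (inv_mem hx)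
        exact ⟨b⁻¹, inv_mem hb, a⁻¹, inv_mem ha, by rw [← _root_.mul_inv_rev, ← h1, inv_inv]⟩
      · have h3 := Finset.card_filter_add_card_filter_not (s := J) (· < l)
        have h4 : J.filter (fun k => ¬ k < l) = J.filter (l < ·) :=
          Finset.filter_congr fun k hk => by have := hcov k hk; omega
        rw [h4] at h3
        omega

end Extension

open Classical in
/-- The smallest `J` such that `g ∈ P_J`. -/
noncomputable def parType (F : Type) [Field F] (n : ℕ) (g : Vn F n ≃ₗ[F] Vn F n) : Finset ℕ :=
  (Finset.Icc 1 (2 * n - 1)).filter fun l => g ∉ stab F n l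

theorem mem_parType {g : Vn F n ≃ₗ[F] Vn F n} {l : ℕ} :
    l ∈ parType F n g ↔ l ∈ Finset.Icc 1 (2 * n - 1) ∧ g ∉ stab F n l := by
  classical
  exact Finset.mem_filter

theorem parType_subset (g : Vn F n ≃ₗ[F] Vn F n) : parType F n g ⊆ Finset.Icc 1 (2 * n - 1) :=
  fun _ h => (mem_parType.1 h).1

theorem mem_Par_parType {g : Vn F n ≃ₗ[F] Vn F n} (hg : g ∈ SpV F n) :
    g ∈ Par F n (parType F n g) := by
  refine ⟨hg, fun l hl => ?_⟩
  by_contra h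
  exact hl.2 (mem_parType.2 ⟨hl.1, fun h' => h (h' l rfl)⟩)

theorem parType_subset_of_mem {g : Vn F n ≃ₗ[F] Vn F n} {J : Finset ℕ} (hg : g ∈ Par F n J) :
    parType F n g ⊆ J := fun l hl => by
  by_contra h
  exact (mem_parType.1 hl).2 ((mem_Par.1 hg).2 l h)

theorem exists_homOn_of_card_le (hF : 2 < Cardinal.mk F) {φ : (Vn F n ≃ₗ[F] Vn F n) → K}
    (h : ∀ J ⊆ Finset.Icc 1 (2 * n - 1), J.card ≤ 2 → HomOn φ (Par F n J)) {k : ℕ} (hk : 2 ≤ k) :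
    ∃ Φ : (Vn F n ≃ₗ[F] Vn F n) → K,
      (∀ J ⊆ Finset.Icc 1 (2 * n - 1), J.card ≤ k → HomOn Φ (Par F n J)) ∧
      ∀ J ⊆ Finset.Icc 1 (2 * n - 1), J.card ≤ 2 → ∀ g ∈ Par F n J, Φ g = φ g := by
  induction k, hk using Nat.le_induction with
  | base => exact ⟨φ, h, fun _ _ _ _ _ => rfl⟩
  | succ k hk ih =>
    obtain ⟨ψ, hψ, hψφ⟩ := ih
    have hex : ∀ J : Finset ℕ, J ⊆ Finset.Icc 1 (2 * n - 1) ∧ J.card = k + 1 →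
        ∃ Φ : (Vn F n ≃ₗ[F] Vn F n) → K, HomOn Φ (Par F n J) ∧
          ∀ J' ⊂ J, ∀ g ∈ Par F n J', Φ g = ψ g := fun J hJ =>
      exists_extend_Par hF hJ.1 (by omega) fun J' hJ' => hψ J' (hJ'.1.trans hJ.1) (by
        have := Finset.card_lt_card hJ'
        omega)
    choose! Ψ hΨ hΨψ using hex
    set Φ : (Vn F n ≃ₗ[F] Vn F n) → K := fun g =>
      if (parType F n g).card = k + 1 then Ψ (parType F n g) g else ψ g with hΦ
    have small : ∀ J : Finset ℕ, J.card ≤ k → ∀ g ∈ Par F n J, Φ g = ψ g := fun J hJ g hg => by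
      have := Finset.card_le_card (parType_subset_of_mem hg)
      exact if_neg (by omega)
    refine ⟨Φ, fun J hJ hJk => ?_, fun J hJ hJ2 g hg =>
      (small J (by omega) g hg).trans (hψφ J hJ hJ2 g hg)⟩
    have congr {χ : (Vn F n ≃ₗ[F] Vn F n) → K} (h1 : HomOn χ (Par F n J))
        (h2 : ∀ g ∈ Par F n J, Φ g = χ g) : HomOn Φ (Par F n J) := fun x hx y hy => by
      rw [h2 _ (mul_mem hx hy), h2 x hx, h2 y hy, h1 x hx y hy]
    rcases Nat.lt_or_ge k J.card with h1 | h1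
    · have hJ' := And.intro hJ (le_antisymm hJk h1)
      refine congr (hΨ J hJ') fun g hg => ?_
      have hsub := parType_subset_of_mem hg
      by_cases h2 : (parType F n g).card = k + 1
      · rw [hΦ]
        simp only
        rw [if_pos h2, Finset.eq_of_subset_of_card_le hsub (by omega)]
      · rw [hΦ]
        simp only
        rw [if_neg h2]
        refine (hΨψ J hJ' _ (hsub.ssubset_of_ne ?_) g
          (mem_Par_parType (Par_le_SpV F n J hg))).symm
        rintro rfl
        exact h2 hJ'.2
    · exact congr (hψ J hJ h1) (small J h1)

theorem Par_Icc : Par F n (Finset.Icc 1 (2 * n - 1)) = SpV F n :=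
  le_antisymm (Par_le_SpV F n _) fun _ hg => ⟨hg, fun _ hl => absurd hl.1 hl.2⟩

theorem SpV_le (hF : 2 < Cardinal.mk F) {M : Subgroup (Vn F n ≃ₗ[F] Vn F n)}
    (h : ∀ J ⊆ Finset.Icc 1 (2 * n - 1), J.card ≤ 2 → Par F n J ≤ M) : SpV F n ≤ M := by
  rw [← Par_Icc]
  exact Par_le hF (h ∅ (Finset.empty_subset _) (by simp)) subset_rfl fun j hj =>
    h {j} (Finset.singleton_subset_iff.2 hj) (by simp)

end SpAmalgam

/-- **For `|F| ≥ 3` and `n ≥ 2`, `Sp_{2n}(F)` is the universal completion of the amalgam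
`A_{≤2} = {P_J : J ⊆ I, |J| ≤ 2}` of parabolic subgroups of rank at most 2.** -/
theorem sp_universal_completion_rank2_parabolics (F : Type) [Field F] (n : ℕ) (hn : 2 ≤ n)
    (hF : 2 < Cardinal.mk F) :
    (Subgroup.closure (⋃ J ∈ {J : Finset ℕ | J ⊆ Finset.Icc 1 (2*n-1) ∧ J.card ≤ 2},
        ((Par F n J : Subgroup ((Vn F n) ≃ₗ[F] (Vn F n))) :
          Set ((Vn F n) ≃ₗ[F] (Vn F n)))) = SpV F n) ∧
    (∀ (K : Type) [Group K]
      (f : (J : Finset ℕ) → J ⊆ Finset.Icc 1 (2*n-1) → J.card ≤ 2 → ↥(Par F n J) →* K),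
      (∀ (J : Finset ℕ) (hJ : J ⊆ Finset.Icc 1 (2*n-1)) (hJ2 : J.card ≤ 2)
        (J' : Finset ℕ) (hJ' : J' ⊆ Finset.Icc 1 (2*n-1)) (hJ'2 : J'.card ≤ 2)
        (hsub : J' ⊆ J) (g : ↥(Par F n J')),
        f J hJ hJ2 (Subgroup.inclusion (Par_mono F n hsub) g) = f J' hJ' hJ'2 g) →
      ∃! Φ : ↥(SpV F n) →* K,
        ∀ (J : Finset ℕ) (hJ : J ⊆ Finset.Icc 1 (2*n-1)) (hJ2 : J.card ≤ 2)
          (g : ↥(Par F n J)),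
          Φ (Subgroup.inclusion (Par_le_SpV F n J) g) = f J hJ hJ2 g) := by
  refine ⟨le_antisymm ((Subgroup.closure_le _).2 (Set.iUnion₂_subset fun J _ =>
    Par_le_SpV F n J)) (SpAmalgam.SpV_le hF fun J hJ hJ2 => ?_), fun K _ f hf => ?_⟩
  · intro g hg
    exact Subgroup.subset_closure (Set.mem_iUnion₂.2 ⟨J, ⟨hJ, hJ2⟩, hg⟩)
  classical
  set φ : (Vn F n ≃ₗ[F] Vn F n) → K := fun g =>
    if h : g ∈ SpV F n ∧ (SpAmalgam.parType F n g).card ≤ 2 then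
      f _ (SpAmalgam.parType_subset g) h.2 ⟨g, SpAmalgam.mem_Par_parType h.1⟩ else 1 with hφ
  have hφf : ∀ (J : Finset ℕ) (hJ : J ⊆ Finset.Icc 1 (2*n-1)) (hJ2 : J.card ≤ 2)
      (g : Vn F n ≃ₗ[F] Vn F n) (hg : g ∈ Par F n J), φ g = f J hJ hJ2 ⟨g, hg⟩ := by
    intro J hJ hJ2 g hg
    have hsub := SpAmalgam.parType_subset_of_mem hg
    have h1 : g ∈ SpV F n ∧ (SpAmalgam.parType F n g).card ≤ 2 :=
      ⟨Par_le_SpV F n J hg, (Finset.card_le_card hsub).trans hJ2⟩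
    rw [hφ]
    simp only
    rw [dif_pos h1, ← hf J hJ hJ2 _ (SpAmalgam.parType_subset g) h1.2 hsub]
    rfl
  obtain ⟨Φ, hΦ, hΦφ⟩ := SpAmalgam.exists_homOn_of_card_le hF (φ := φ)
    (fun J hJ hJ2 x hx y hy => by
      rw [hφf J hJ hJ2 x hx, hφf J hJ hJ2 y hy, hφf J hJ hJ2 _ (mul_mem hx hy), ← map_mul]
      rfl) (show 2 ≤ 2 * n by omega)
  have hhom := hΦ _ subset_rfl (by rw [Nat.card_Icc]; omega)
  rw [SpAmalgam.Par_Icc] at hhom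
  refine ⟨MonoidHom.mk' (fun g : SpV F n => Φ g) fun x y => hhom x x.2 y y.2,
    fun J hJ hJ2 g => (hΦφ J hJ hJ2 g g.2).trans (hφf J hJ hJ2 g g.2), fun Ψ hΨ => ?_⟩
  have hle := SpAmalgam.SpV_le hF (M := (Ψ.eqLocus
    (MonoidHom.mk' (fun g : SpV F n => Φ g) fun x y => hhom x x.2 y y.2)).map (SpV F n).subtype)
    fun J hJ hJ2 g hg => ⟨⟨g, Par_le_SpV F n J hg⟩, (hΨ J hJ hJ2 ⟨g, hg⟩).trans
      ((hΦφ J hJ hJ2 g hg).trans (hφf J hJ hJ2 g hg)).symm, rfl⟩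
  ext g
  obtain ⟨g', hg', h1⟩ := hle g.2
  obtain rfl : g' = g := Subtype.ext h1
  exact hg'
end

section
/- Let F be a field, V an F-vector space with an alternating bilinear form s, U ≤ V a finite-dimensional subspace, and W ≤ U a subspace with W ∩ Rad(U) = 0. Then every hyperbolic basis of W (with respect to the restriction of s) extends to a hyperbolic basis of U: given a hyperbolic basis (e_1, …, e_{r'+d'}; f_1, …, f_{r'}) of W, there exists a hyperbolic basis (E_1, …, E_{r+d}; F_1, …, F_r) of U and an injection ι : {1, …, r'+d'} → {1, …, r+d} such that e_i = E_{ι(i)} for all i, f_j = F_{ι(j)} for all j ≤ r' (in particular ι(j) ≤ r for j ≤ r'), i.e. the given vectors occur among the basis vectors of U with hyperbolic partners preserved. -/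
variable {F V : Type} [Field F] [AddCommGroup V] [Module F V]

/-- The radical `Rad(U) = {x ∈ U : s(x,y) = 0 for all y ∈ U}` of a subspace `U`
with respect to the bilinear form `s`. -/
def rad (s : V →ₗ[F] V →ₗ[F] F) (U : Submodule F V) : Submodule F V where
  carrier := {x | x ∈ U ∧ ∀ y ∈ U, s x y = 0}
  zero_mem' := ⟨U.zero_mem, fun y _ => by simp⟩
  add_mem' := by
    rintro a b ⟨haU, ha⟩ ⟨hbU, hb⟩
    exact ⟨U.add_mem haU hbU, fun y hy => by
      rw [map_add, LinearMap.add_apply, ha y hy, hb y hy, add_zero]⟩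
  smul_mem' := by
    rintro c x ⟨hxU, hx⟩
    exact ⟨U.smul_mem c hxU, fun y hy => by
      rw [map_smul, LinearMap.smul_apply, hx y hy, smul_zero]⟩

/-- The orthogonal complement `U^⊥ = {v ∈ V : s(u,v) = 0 for all u ∈ U}`. -/
def perp (s : V →ₗ[F] V →ₗ[F] F) (U : Submodule F V) : Submodule F V where
  carrier := {v | ∀ u ∈ U, s u v = 0}
  zero_mem' := fun u _ => by simp
  add_mem' := fun ha hb u hu => by rw [map_add, ha u hu, hb u hu, add_zero]
  smul_mem' := fun c x hx u hu => by rw [map_smul, hx u hu, smul_zero]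

/-- `(e₁, …, e_{r+d}; f₁, …, f_r)` is a hyperbolic basis of the subspace `U` with respect to
the alternating form `s`: all vectors lie in `U`, `s(eᵢ,eⱼ) = 0 = s(fᵢ,fⱼ)`, `s(eᵢ,fⱼ) = δᵢⱼ`,
the combined family is a basis of `U`, and `(e_{r+1}, …, e_{r+d})` is a basis of `Rad(U)`. -/
def IsHypBasis (s : V →ₗ[F] V →ₗ[F] F) (U : Submodule F V) (r d : ℕ)
    (e : Fin (r + d) → V) (f : Fin r → V) : Prop :=
  (∀ i, e i ∈ U) ∧ (∀ j, f j ∈ U) ∧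
  (∀ i j, s (e i) (e j) = 0) ∧
  (∀ i j, s (f i) (f j) = 0) ∧
  (∀ (i : Fin (r + d)) (j : Fin r), s (e i) (f j) = if (i : ℕ) = (j : ℕ) then 1 else 0) ∧
  LinearIndependent F (Sum.elim e f) ∧
  Submodule.span F (Set.range (Sum.elim e f)) = U ∧
  Submodule.span F (Set.range fun k : Fin d => e (Fin.natAdd r k)) = rad s U

/-- The first `m` terms of `e` and the first `k` terms of `f` lie in `U` and satisfy the relations
of a hyperbolic basis; nothing is required about their span. -/
structure IsHypSystem (s : V →ₗ[F] V →ₗ[F] F) (U : Submodule F V) (m k : ℕ)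
    (e f : ℕ → V) : Prop where
  left_mem : ∀ i < m, e i ∈ U
  right_mem : ∀ j < k, f j ∈ U
  left_left : ∀ i < m, ∀ j < m, s (e i) (e j) = 0
  right_right : ∀ i < k, ∀ j < k, s (f i) (f j) = 0
  left_right : ∀ i < m, ∀ j < k, s (e i) (f j) = if i = j then 1 else 0

theorem apply_swap_eq_neg {s : V →ₗ[F] V →ₗ[F] F} (hs : ∀ v, s v v = 0) (x y : V) :
    s x y = -s y x := by
  have h := hs (x + y)
  simp only [map_add, LinearMap.add_apply, hs, zero_add, add_zero] at h
  exact eq_neg_of_add_eq_zero_right h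

/-- In a finite-dimensional space, linearly independent functionals take prescribed
Kronecker values at some vector. -/
theorem exists_forall_apply_eq_ite {M ι : Type*} [AddCommGroup M] [Module F M]
    [FiniteDimensional F M] [DecidableEq ι] {φ : ι → Module.Dual F M}
    (hφ : LinearIndependent F φ) (k : ι) :
    ∃ u : M, ∀ i, φ i u = if i = k then 1 else 0 := by
  obtain ⟨Ψ, hΨ⟩ := LinearMap.exists_extend
    ((Module.Basis.span hφ).constr F fun i => if i = k then (1 : F) else 0)
  refine ⟨(Module.evalEquiv F M).symm Ψ, fun i => ?_⟩
  have h := LinearMap.congr_fun hΨ (Module.Basis.span hφ i)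
  rw [Module.Basis.constr_basis, LinearMap.comp_apply, Submodule.subtype_apply,
    Module.Basis.span_apply] at h
  rw [Module.apply_evalEquiv_symm_apply, h]

theorem exists_dual_vector_of_inf_rad_eq_bot {ι : Type*} [DecidableEq ι]
    (s : V →ₗ[F] V →ₗ[F] F) (U : Submodule F V) [FiniteDimensional F U] {e : ι → V}
    (he : LinearIndependent F e) (heU : Submodule.span F (Set.range e) ≤ U)
    (hrad : Submodule.span F (Set.range e) ⊓ rad s U = ⊥) (k : ι) :
    ∃ u ∈ U, ∀ i, s (e i) u = if i = k then 1 else 0 := by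
  have hφ : LinearIndependent F (⇑(U.subtype.dualMap ∘ₗ s) ∘ e) := by
    refine he.map (Submodule.disjoint_def.mpr fun x hx hker => ?_)
    have hxr : x ∈ Submodule.span F (Set.range e) ⊓ rad s U :=
      ⟨hx, heU hx, fun y hy => LinearMap.congr_fun (LinearMap.mem_ker.mp hker) ⟨y, hy⟩⟩
    rwa [hrad, Submodule.mem_bot] at hxr
  obtain ⟨u, hu⟩ := exists_forall_apply_eq_ite hφ k
  exact ⟨u, u.2, hu⟩

namespace IsHypSystem

variable {s : V →ₗ[F] V →ₗ[F] F} {U : Submodule F V} {m k : ℕ} {e f : ℕ → V}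

theorem update_right (h : IsHypSystem s U m k e f) (hs : ∀ v, s v v = 0) {g : V} (hg : g ∈ U)
    (heg : ∀ i < m, s (e i) g = if i = k then 1 else 0) (hfg : ∀ j < k, s (f j) g = 0) :
    IsHypSystem s U m (k + 1) e (Function.update f k g) where
  left_mem := h.left_mem
  right_mem j hj := by
    rcases Nat.lt_succ_iff_lt_or_eq.mp hj with hj | rfl
    · rw [Function.update_of_ne hj.ne]
      exact h.right_mem j hj
    · rwa [Function.update_self]
  left_left := h.left_left
  right_right i hi j hj := by
    rcases Nat.lt_succ_iff_lt_or_eq.mp hi with hi | rfl <;>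
      rcases Nat.lt_succ_iff_lt_or_eq.mp hj with hj | rfl
    · rw [Function.update_of_ne hi.ne, Function.update_of_ne hj.ne]
      exact h.right_right i hi j hj
    · rw [Function.update_of_ne hi.ne, Function.update_self]
      exact hfg i hi
    · rw [Function.update_of_ne hj.ne, Function.update_self, apply_swap_eq_neg hs, hfg j hj,
        neg_zero]
    · rw [Function.update_self, hs]
  left_right i hi j hj := by
    rcases Nat.lt_succ_iff_lt_or_eq.mp hj with hj | rfl
    · rw [Function.update_of_ne hj.ne]
      exact h.left_right i hi j hj
    · rw [Function.update_self]
      exact heg i hi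

theorem update_left (h : IsHypSystem s U m k e f) (hs : ∀ v, s v v = 0) (hkm : k ≤ m) {x : V}
    (hx : x ∈ U) (hex : ∀ i < m, s (e i) x = 0) (hfx : ∀ j < k, s (f j) x = 0) :
    IsHypSystem s U (m + 1) k (Function.update e m x) f where
  left_mem i hi := by
    rcases Nat.lt_succ_iff_lt_or_eq.mp hi with hi | rfl
    · rw [Function.update_of_ne hi.ne]
      exact h.left_mem i hi
    · rwa [Function.update_self]
  right_mem := h.right_mem
  right_right := h.right_right
  left_left i hi j hj := by
    rcases Nat.lt_succ_iff_lt_or_eq.mp hi with hi | rfl <;>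
      rcases Nat.lt_succ_iff_lt_or_eq.mp hj with hj | rfl
    · rw [Function.update_of_ne hi.ne, Function.update_of_ne hj.ne]
      exact h.left_left i hi j hj
    · rw [Function.update_of_ne hi.ne, Function.update_self]
      exact hex i hi
    · rw [Function.update_of_ne hj.ne, Function.update_self, apply_swap_eq_neg hs, hex j hj,
        neg_zero]
    · rw [Function.update_self, hs]
  left_right i hi j hj := by
    rcases Nat.lt_succ_iff_lt_or_eq.mp hi with hi | rfl
    · rw [Function.update_of_ne hi.ne]
      exact h.left_right i hi j hj
    · rw [Function.update_self, apply_swap_eq_neg hs, hfx j hj, neg_zero,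
        if_neg (hj.trans_le hkm).ne']

/-- A vector of `U` can be made orthogonal to the `f j` by adding a combination of the `e j`. -/
theorem exists_next_right (h : IsHypSystem s U m k e f) (hs : ∀ v, s v v = 0) (hkm : k ≤ m)
    {g : V} (hg : g ∈ U) :
    ∃ g' ∈ U, (∀ i < m, s (e i) g' = s (e i) g) ∧ (∀ j < k, s (f j) g' = 0) ∧
      g' - g ∈ Submodule.span F (e '' Set.Iio m) := by
  refine ⟨g + ∑ j ∈ Finset.range k, s (f j) g • e j, ?_, fun i hi => ?_, fun j hj => ?_, ?_⟩
  · exact U.add_mem hg (U.sum_mem fun j hj =>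
      U.smul_mem _ (h.left_mem j ((Finset.mem_range.mp hj).trans_le hkm)))
  · rw [map_add, map_sum, Finset.sum_eq_zero, add_zero]
    intro j hj
    rw [map_smul, h.left_left i hi j ((Finset.mem_range.mp hj).trans_le hkm), smul_zero]
  · rw [map_add, map_sum, Finset.sum_eq_single j]
    · rw [map_smul, apply_swap_eq_neg hs (f j) (e j), h.left_right j (hj.trans_le hkm) j hj]
      simp
    · intro l hl hlj
      rw [map_smul, apply_swap_eq_neg hs (f j) (e l),
        h.left_right l ((Finset.mem_range.mp hl).trans_le hkm) j hj, if_neg hlj]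
      simp
    · exact fun hj' => absurd (Finset.mem_range.mpr hj) hj'
  · rw [add_sub_cancel_left]
    exact Submodule.sum_mem _ fun j hj => Submodule.smul_mem _ _
      (Submodule.subset_span ⟨j, (Finset.mem_range.mp hj).trans_le hkm, rfl⟩)

/-- If the `e i` admit dual vectors in `U`, the missing partners `f j` can be supplied. -/
theorem exists_complete_right (h : IsHypSystem s U m k e f) (hs : ∀ v, s v v = 0) (hkm : k ≤ m)
    (hdual : ∀ j < m, ∃ g ∈ U, ∀ i < m, s (e i) g = if i = j then 1 else 0) :
    ∃ f' : ℕ → V, IsHypSystem s U m m e f' ∧ ∀ j < k, f' j = f j := by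
  induction hkm using Nat.decreasingInduction generalizing f with
  | self => exact ⟨f, h, fun _ _ => rfl⟩
  | of_succ k hk ih =>
    obtain ⟨g, hg, heg⟩ := hdual k hk
    obtain ⟨g', hg', heg', hfg', -⟩ := h.exists_next_right hs hk.le hg
    obtain ⟨f', hf', hff'⟩ :=
      ih (h.update_right hs hg' (fun i hi => (heg' i hi).trans (heg i hi)) hfg')
    refine ⟨f', hf', fun j hj => ?_⟩
    rw [hff' j (hj.trans k.lt_succ_self), Function.update_of_ne hj.ne]

/-- The projection of `u` along a hyperbolic system onto its orthogonal complement. -/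
theorem exists_sub_mem_span_orthogonal (h : IsHypSystem s U m m e f) (hs : ∀ v, s v v = 0)
    {u : V} (hu : u ∈ U) :
    ∃ u' ∈ U, (∀ i < m, s (e i) u' = 0) ∧ (∀ j < m, s (f j) u' = 0) ∧
      u' - u ∈ Submodule.span F (e '' Set.Iio m ∪ f '' Set.Iio m) := by
  obtain ⟨v, hv, hev, hfv, hvu⟩ := h.exists_next_right hs le_rfl hu
  refine ⟨v - ∑ i ∈ Finset.range m, s (e i) v • f i, ?_, fun i hi => ?_, fun j hj => ?_, ?_⟩
  · exact U.sub_mem hv (U.sum_mem fun i hi =>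
      U.smul_mem _ (h.right_mem i (Finset.mem_range.mp hi)))
  · rw [map_sub, map_sum, Finset.sum_eq_single i]
    · rw [map_smul, h.left_right i hi i hi]
      simp
    · intro l hl hli
      rw [map_smul, h.left_right i hi l (Finset.mem_range.mp hl), if_neg hli.symm, smul_zero]
    · exact fun hi' => absurd (Finset.mem_range.mpr hi) hi'
  · rw [map_sub, map_sum, hfv j hj, Finset.sum_eq_zero, sub_zero]
    intro i hi
    rw [map_smul, h.right_right j hj i (Finset.mem_range.mp hi), smul_zero]
  · rw [sub_right_comm]
    refine Submodule.sub_mem _ (Submodule.span_mono Set.subset_union_left hvu) ?_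
    exact Submodule.sum_mem _ fun i hi => Submodule.smul_mem _ _
      (Submodule.subset_span (Or.inr ⟨i, Finset.mem_range.mp hi, rfl⟩))

/-- A hyperbolic system of `U` which, together with the radical, does not span `U` can be
enlarged by a hyperbolic pair. -/
theorem exists_succ (h : IsHypSystem s U m m e f) (hs : ∀ v, s v v = 0)
    (hU : ¬ U ≤ Submodule.span F (e '' Set.Iio m ∪ f '' Set.Iio m) ⊔ rad s U) :
    ∃ e' f' : ℕ → V, IsHypSystem s U (m + 1) (m + 1) e' f' ∧
      (∀ i < m, e' i = e i) ∧ ∀ i < m, f' i = f i := by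
  obtain ⟨u, hu, hu_span⟩ := SetLike.not_le_iff_exists.mp hU
  obtain ⟨x, hx, hex, hfx, hxu⟩ := h.exists_sub_mem_span_orthogonal hs hu
  have hx_rad : x ∉ rad s U := fun hxr => hu_span (by
    rw [← sub_sub_cancel x u]
    exact Submodule.sub_mem _ (Submodule.mem_sup_right hxr) (Submodule.mem_sup_left hxu))
  obtain ⟨v, hv, hxv⟩ : ∃ v ∈ U, s x v ≠ 0 := by
    by_contra! hcon
    exact hx_rad ⟨hx, hcon⟩
  obtain ⟨y, hy, hey, hfy, hyv⟩ := h.exists_sub_mem_span_orthogonal hs hv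
  have hxy : s x y = s x v := by
    have hle : Submodule.span F (e '' Set.Iio m ∪ f '' Set.Iio m) ≤ LinearMap.ker (s x) := by
      rw [Submodule.span_le]
      rintro _ (⟨i, hi, rfl⟩ | ⟨i, hi, rfl⟩)
      · exact (apply_swap_eq_neg hs x (e i)).trans (by rw [hex i hi, neg_zero])
      · exact (apply_swap_eq_neg hs x (f i)).trans (by rw [hfx i hi, neg_zero])
    have h0 := LinearMap.mem_ker.mp (hle hyv)
    rwa [map_sub, sub_eq_zero] at h0
  refine ⟨Function.update e m x, Function.update f m ((s x v)⁻¹ • y),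
    (h.update_left hs le_rfl hx hex hfx).update_right hs (U.smul_mem _ hy)
      (fun i hi => ?_) (fun j hj => ?_),
    fun i hi => Function.update_of_ne hi.ne _ _, fun i hi => Function.update_of_ne hi.ne _ _⟩
  · rcases Nat.lt_succ_iff_lt_or_eq.mp hi with hi | rfl
    · rw [Function.update_of_ne hi.ne, map_smul, hey i hi, smul_zero, if_neg hi.ne]
    · rw [Function.update_self, map_smul, hxy, smul_eq_mul, inv_mul_cancel₀ hxv, if_pos rfl]
  · rw [map_smul, hfy j hj, smul_zero]

/-- The vectors of a hyperbolic system, together with independent vectors in the radical, are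
linearly independent. -/
theorem linearIndependent_sumElim_append (h : IsHypSystem s U m m e f) (hs : ∀ v, s v v = 0)
    {d : ℕ} {b : Fin d → V} (hb : LinearIndependent F b) (hb_rad : ∀ i, b i ∈ rad s U) :
    LinearIndependent F
      (Sum.elim (Fin.append (fun i : Fin m => e i) b) fun j : Fin m => f j) := by
  rw [Fintype.linearIndependent_iff]
  intro c hc
  simp only [Fintype.sum_sum_type, Sum.elim_inl, Sum.elim_inr, Fin.sum_univ_add,
    Fin.append_left, Fin.append_right] at hc
  have hbl : ∀ k, ∀ y ∈ U, s y (b k) = 0 := fun k y hy => by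
    rw [apply_swap_eq_neg hs, (hb_rad k).2 y hy, neg_zero]
  have hfe : ∀ i j : Fin m, s (f i) (e j) = if j = i then -1 else 0 := fun i j => by
    rw [apply_swap_eq_neg hs, h.left_right j j.2 i i.2]
    simp only [Fin.val_inj]
    split_ifs <;> simp
  have hef : ∀ i j : Fin m, s (e i) (f j) = if i = j then 1 else 0 := fun i j => by
    rw [h.left_right i i.2 j j.2]
    simp only [Fin.val_inj]
  have hcf : ∀ i : Fin m, c (Sum.inr i) = 0 := fun i => by
    have h0 := congrArg (s (e i)) hc
    simpa [map_add, map_sum, hef, hbl _ _ (h.left_mem i i.2),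
      h.left_left i i.2 _ (Fin.is_lt _)] using h0
  have hce : ∀ i : Fin m, c (Sum.inl (Fin.castAdd d i)) = 0 := fun i => by
    have h0 := congrArg (s (f i)) hc
    simpa [map_add, map_sum, hfe, hbl _ _ (h.right_mem i i.2),
      h.right_right i i.2 _ (Fin.is_lt _)] using h0
  simp only [hcf, hce, zero_smul, Finset.sum_const_zero, zero_add, add_zero] at hc
  have hcb := Fintype.linearIndependent_iff.mp hb _ hc
  rintro (i | i)
  · exact Fin.addCases (motive := fun i => c (Sum.inl i) = 0) hce hcb i
  · exact hcf i

theorem le_finrank [FiniteDimensional F U] (h : IsHypSystem s U m m e f) (hs : ∀ v, s v v = 0) :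
    m ≤ Module.finrank F U := by
  have hli := (h.linearIndependent_sumElim_append hs (b := Fin.elim0)
    linearIndependent_empty_type fun i => i.elim0).comp Sum.inr Sum.inr_injective
  have hU : LinearIndependent F fun j : Fin m => (⟨f j, h.right_mem j j.2⟩ : U) :=
    LinearIndependent.of_comp U.subtype hli
  simpa using hU.fintype_card_le_finrank

/-- Every hyperbolic system of `U` extends to one which spans `U` together with the radical. -/
theorem exists_maximal [FiniteDimensional F U] (h : IsHypSystem s U m m e f)
    (hs : ∀ v, s v v = 0) :
    ∃ (r : ℕ) (e' f' : ℕ → V), m ≤ r ∧ IsHypSystem s U r r e' f' ∧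
      (∀ i < m, e' i = e i) ∧ (∀ i < m, f' i = f i) ∧
      U ≤ Submodule.span F (e' '' Set.Iio r ∪ f' '' Set.Iio r) ⊔ rad s U := by
  by_contra! hcon
  have hall : ∀ n, ∃ e' f' : ℕ → V, IsHypSystem s U (m + n) (m + n) e' f' ∧
      (∀ i < m, e' i = e i) ∧ ∀ i < m, f' i = f i := fun n => by
    induction n with
    | zero => exact ⟨e, f, h, fun _ _ => rfl, fun _ _ => rfl⟩
    | succ n ih =>
      obtain ⟨e', f', h', he', hf'⟩ := ih
      obtain ⟨e'', f'', h'', he'', hf''⟩ :=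
        h'.exists_succ hs (hcon _ e' f' (Nat.le_add_right m n) h' he' hf')
      exact ⟨e'', f'', h'', fun i hi => (he'' i (by lia)).trans (he' i hi),
        fun i hi => (hf'' i (by lia)).trans (hf' i hi)⟩
  obtain ⟨_, _, h', -⟩ := hall (Module.finrank F U + 1)
  have := h'.le_finrank hs
  lia

/-- A hyperbolic system spanning `U` together with the radical becomes a hyperbolic basis of `U`
on appending a basis of the radical. -/
theorem isHypBasis_append (h : IsHypSystem s U m m e f) (hs : ∀ v, s v v = 0)
    (hU : U ≤ Submodule.span F (e '' Set.Iio m ∪ f '' Set.Iio m) ⊔ rad s U)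
    {d : ℕ} (b : Module.Basis (Fin d) F (rad s U)) :
    IsHypBasis s U m d (Fin.append (fun i : Fin m => e i) fun i => (b i : V))
      fun j : Fin m => f j := by
  have hb_span : Submodule.span F (Set.range fun i => (b i : V)) = rad s U := by
    have h0 := congrArg (Submodule.map (rad s U).subtype) b.span_eq
    rw [Submodule.map_span, ← Set.range_comp, Submodule.map_top, Submodule.range_subtype] at h0
    exact h0
  have hbl : ∀ k, ∀ y ∈ U, s y (b k) = 0 := fun k y hy => by
    rw [apply_swap_eq_neg hs, (b k).2.2 y hy, neg_zero]
  have hE : ∀ i, Fin.append (fun i : Fin m => e i) (fun i => (b i : V)) i ∈ U := fun i => by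
    refine Fin.addCases (fun i => ?_) (fun i => ?_) i
    · rw [Fin.append_left]
      exact h.left_mem i i.2
    · rw [Fin.append_right]
      exact (b i).2.1
  refine ⟨hE, fun j => h.right_mem j j.2, fun i j => ?_, fun i j => h.right_right i i.2 j j.2,
    fun i j => ?_, h.linearIndependent_sumElim_append hs
      (b.linearIndependent.map' _ (rad s U).ker_subtype) fun i => (b i).2, ?_, ?_⟩
  · refine Fin.addCases (fun j => ?_) (fun j => ?_) j
    · rw [Fin.append_left]
      refine Fin.addCases (fun i => ?_) (fun i => ?_) i
      · rw [Fin.append_left]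
        exact h.left_left i i.2 j j.2
      · rw [Fin.append_right]
        exact (b i).2.2 _ (h.left_mem j j.2)
    · rw [Fin.append_right]
      exact hbl j _ (hE i)
  · refine Fin.addCases (fun i => ?_) (fun i => ?_) i
    · rw [Fin.append_left, Fin.val_castAdd]
      exact h.left_right i i.2 j j.2
    · rw [Fin.append_right, (b i).2.2 _ (h.right_mem j j.2), if_neg]
      rw [Fin.val_natAdd]
      lia
  · apply le_antisymm
    · rw [Submodule.span_le]
      rintro _ ⟨i | j, rfl⟩
      · exact hE i
      · exact h.right_mem j j.2
    · refine hU.trans (sup_le (Submodule.span_mono ?_) ?_)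
      · rintro _ (⟨i, hi, rfl⟩ | ⟨j, hj, rfl⟩)
        · exact ⟨Sum.inl (Fin.castAdd d ⟨i, hi⟩), Fin.append_left _ _ _⟩
        · exact ⟨Sum.inr ⟨j, hj⟩, rfl⟩
      · refine hb_span.ge.trans (Submodule.span_mono ?_)
        rintro _ ⟨i, rfl⟩
        exact ⟨Sum.inl (Fin.natAdd m i), Fin.append_right _ _ _⟩
  · simpa only [Fin.append_right] using hb_span

end IsHypSystem

/-- **Any hyperbolic basis of a subspace `W ≤ U` with `W ∩ Rad(U) = 0` extends to a hyperbolic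
basis of `U`, with the given vectors occurring among the basis vectors of `U` and with
hyperbolic partners preserved.** -/
theorem hyperbolic_basis_extends (F V : Type) [Field F] [AddCommGroup V] [Module F V]
    (s : V →ₗ[F] V →ₗ[F] F) (hs : ∀ v, s v v = 0)
    (U W : Submodule F V) [FiniteDimensional F ↥U]
    (hWU : W ≤ U) (hW : W ⊓ rad s U = ⊥)
    (r' d' : ℕ) (e : Fin (r' + d') → V) (f : Fin r' → V)
    (hbW : IsHypBasis s W r' d' e f) :
    ∃ (r d : ℕ) (E : Fin (r + d) → V) (Fv : Fin r → V) (ι : Fin (r' + d') → Fin (r + d)),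
      IsHypBasis s U r d E Fv ∧
      Function.Injective ι ∧
      (∀ i, e i = E (ι i)) ∧
      (∀ j : Fin r', ∃ hj : ((ι (Fin.castLE (Nat.le_add_right r' d') j)) : ℕ) < r,
        f j = Fv ⟨((ι (Fin.castLE (Nat.le_add_right r' d') j)) : ℕ), hj⟩) := by
  obtain ⟨heW, hfW, hee, hff, hef, hli, -, -⟩ := hbW
  set e₀ : ℕ → V := fun i => if h : i < r' + d' then e ⟨i, h⟩ else 0
  set f₀ : ℕ → V := fun j => if h : j < r' then f ⟨j, h⟩ else 0
  have he₀ : ∀ i (h : i < r' + d'), e₀ i = e ⟨i, h⟩ := fun i h => dif_pos h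
  have hf₀ : ∀ j (h : j < r'), f₀ j = f ⟨j, h⟩ := fun j h => dif_pos h
  have hsys : IsHypSystem s U (r' + d') r' e₀ f₀ := by
    refine ⟨fun i hi => ?_, fun j hj => ?_, fun i hi j hj => ?_, fun i hi j hj => ?_,
      fun i hi j hj => ?_⟩
    · rw [he₀ i hi]
      exact hWU (heW _)
    · rw [hf₀ j hj]
      exact hWU (hfW _)
    · rw [he₀ i hi, he₀ j hj, hee]
    · rw [hf₀ i hi, hf₀ j hj, hff]
    · rw [he₀ i hi, hf₀ j hj, hef]
  have he_span : Submodule.span F (Set.range e) ≤ W := by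
    rw [Submodule.span_le]
    rintro _ ⟨i, rfl⟩
    exact heW i
  have hdual : ∀ j < r' + d', ∃ g ∈ U, ∀ i < r' + d', s (e₀ i) g = if i = j then 1 else 0 := by
    intro j hj
    obtain ⟨g, hg, heg⟩ := exists_dual_vector_of_inf_rad_eq_bot s U
      (hli.comp Sum.inl Sum.inl_injective) (he_span.trans hWU)
      (le_bot_iff.mp ((inf_le_inf_right _ he_span).trans hW.le)) ⟨j, hj⟩
    refine ⟨g, hg, fun i hi => ?_⟩
    rw [he₀ i hi]
    simpa using heg ⟨i, hi⟩
  obtain ⟨f₁, hf₁, hf₁₀⟩ := hsys.exists_complete_right hs (Nat.le_add_right r' d') hdual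
  obtain ⟨r, e₂, f₂, hr, hsys₂, he₂, hf₂, hU⟩ := hf₁.exists_maximal hs
  have : FiniteDimensional F (rad s U) :=
    Submodule.finiteDimensional_of_le (S₂ := U) fun x hx => hx.1
  refine ⟨r, _, _, _, fun i => Fin.castAdd _ (Fin.castLE hr i),
    hsys₂.isHypBasis_append hs hU (Module.finBasis F (rad s U)), fun i j hij => ?_,
    fun i => ?_, fun j => ⟨?_, ?_⟩⟩
  · simpa [Fin.ext_iff] using hij
  · rw [Fin.append_left, Fin.val_castLE, he₂ i i.2, he₀ i i.2]
  · exact j.2.trans_le ((Nat.le_add_right r' d').trans hr)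
  · simp only [Fin.val_castAdd, Fin.val_castLE]
    rw [hf₂ j (j.2.trans_le (Nat.le_add_right r' d')), hf₁₀ j j.2, hf₀ j j.2]
end

section
/- Let F, V, s, Γ be as in the context with n = dim V and dim Rad(V) = d ≤ 1. (a) For every chamber C of Γ there exists a hyperbolic basis H of V such that for each object X ∈ C the set H ∩ X is a basis of X which is a hyperbolic basis of X. (b) Conversely, for every hyperbolic basis (e_1, …, e_{r+d}; f_1, …, f_r) of V (so n = 2r + d), setting h_{2i−1} = e_i and h_{2j} = f_j, the chain of subspaces C_l = span(h_1, …, h_l) for 1 ≤ l ≤ n−1 is a chamber of Γ. -/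
variable {F V : Type} [Field F] [AddCommGroup V] [Module F V]

/-- An object of the geometry `Γ`: a subspace `U` with `0 < dim U < dim V`,
`U ∩ Rad(V) = 0` and `dim Rad(U) ≤ 1`. -/
def IsObj (s : V →ₗ[F] V →ₗ[F] F) (U : Submodule F V) : Prop :=
  0 < Module.finrank F ↥U ∧ Module.finrank F ↥U < Module.finrank F V ∧
  U ⊓ rad s (⊤ : Submodule F V) = ⊥ ∧ Module.finrank F ↥(rad s U) ≤ 1

/-- Incidence in `Γ`: the smaller subspace is contained in the larger one and meets its
radical trivially. -/
def Incid (s : V →ₗ[F] V →ₗ[F] F) (X Y : Submodule F V) : Prop :=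
  (X ≤ Y ∧ X ⊓ rad s Y = ⊥) ∨ (Y ≤ X ∧ Y ⊓ rad s X = ⊥)

/-- A chamber of `Γ`: a set of pairwise incident objects containing exactly one object of
each dimension `1, …, dim V − 1`. -/
def IsChamber (s : V →ₗ[F] V →ₗ[F] F) (C : Set (Submodule F V)) : Prop :=
  (∀ X ∈ C, IsObj s X) ∧
  (∀ X ∈ C, ∀ Y ∈ C, X ≠ Y → Incid s X Y) ∧
  (∀ k : ℕ, 1 ≤ k → k ≤ Module.finrank F V - 1 →
    ∃! X : Submodule F V, X ∈ C ∧ Module.finrank F ↥X = k)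

/-- The vectors `h 0, …, h (n - 1)` form consecutive hyperbolic pairs `(h (2i), h (2i+1))`, possibly
followed by a single nonzero vector, distinct pairs being orthogonal. -/
structure IsDarboux (s : V →ₗ[F] V →ₗ[F] F) (h : ℕ → V) (n : ℕ) : Prop where
  orthogonal : ∀ a < n, ∀ b < n, a / 2 ≠ b / 2 → s (h a) (h b) = 0
  pair : ∀ i, 2 * i + 1 < n → s (h (2 * i)) (h (2 * i + 1)) = 1
  last_ne_zero : ∀ i, 2 * i + 1 = n → h (2 * i) ≠ 0

/-- The span of `h 0, …, h (l - 1)`. -/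
def flag (F : Type) {V : Type} [Field F] [AddCommGroup V] [Module F V] (h : ℕ → V) (l : ℕ) :
    Submodule F V :=
  Submodule.span F (h '' (Finset.range l : Set ℕ))

theorem mem_flag_iff {h : ℕ → V} {l : ℕ} {x : V} :
    x ∈ flag F h l ↔ ∃ c : ℕ → F, ∑ k ∈ Finset.range l, c k • h k = x :=
  Submodule.mem_span_image_finset_iff_exists_fun' F

theorem apply_mem_flag {h : ℕ → V} {l k : ℕ} (hk : k < l) : h k ∈ flag F h l :=
  Submodule.subset_span ⟨k, by simpa using hk, rfl⟩

theorem flag_mono {h : ℕ → V} {l m : ℕ} (hlm : l ≤ m) : flag F h l ≤ flag F h m :=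
  Submodule.span_mono (Set.image_mono (by simpa using hlm))

theorem flag_le {h : ℕ → V} {l : ℕ} {U : Submodule F V} (hU : ∀ k < l, h k ∈ U) :
    flag F h l ≤ U := by
  refine Submodule.span_le.2 ?_
  rintro _ ⟨k, hk, rfl⟩
  exact hU k (by simpa using hk)

theorem flag_congr {h g : ℕ → V} {l : ℕ} (hg : ∀ k < l, h k = g k) : flag F h l = flag F g l :=
  le_antisymm (flag_le fun k hk => hg k hk ▸ apply_mem_flag hk)
    (flag_le fun k hk => hg k hk ▸ apply_mem_flag hk)

theorem range_sum_elim_even_odd {α : Type*} {h : ℕ → α} {r d : ℕ} (hd : d ≤ 1) :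
    Set.range (Sum.elim (fun i : Fin (r + d) => h (2 * i)) (fun j : Fin r => h (2 * j + 1))) =
      h '' (Finset.range (2 * r + d) : Set ℕ) := by
  rw [Set.Sum.elim_range]
  ext x
  simp only [Set.mem_union, Set.mem_range, Set.mem_image, Finset.coe_range, Set.mem_Iio]
  constructor
  · rintro (⟨i, rfl⟩ | ⟨j, rfl⟩)
    · exact ⟨2 * i, by omega, rfl⟩
    · exact ⟨2 * j + 1, by omega, rfl⟩
  · rintro ⟨k, hk, rfl⟩
    rcases Nat.even_or_odd' k with ⟨i, rfl | rfl⟩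
    · exact Or.inl ⟨⟨i, by omega⟩, rfl⟩
    · exact Or.inr ⟨⟨i, by omega⟩, rfl⟩

namespace IsDarboux

variable {s : V →ₗ[F] V →ₗ[F] F} {h : ℕ → V} {n l : ℕ}

theorem mono (hD : IsDarboux s h n) (hl : l ≤ n) : IsDarboux s h l where
  orthogonal a ha b hb := hD.orthogonal a (ha.trans_le hl) b (hb.trans_le hl)
  pair i hi := hD.pair i (hi.trans_le hl)
  last_ne_zero i hi := by
    rcases hl.eq_or_lt with rfl | hlt
    · exact hD.last_ne_zero i hi
    · intro h0
      have := hD.pair i (by omega)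
      simp [h0] at this

theorem apply_ne_zero (hD : IsDarboux s h n) (hs : s.IsAlt) {a b : ℕ} (ha : a < n) (hb : b < n)
    (hab : a ≠ b) (hab2 : a / 2 = b / 2) : s (h a) (h b) ≠ 0 := by
  rcases Nat.even_or_odd' a with ⟨i, rfl | rfl⟩
  · obtain rfl : b = 2 * i + 1 := by omega
    simp [hD.pair i hb]
  · obtain rfl : b = 2 * i := by omega
    rw [← hs.neg, hD.pair i ha]
    simp

theorem coeff_eq_zero (hD : IsDarboux s h n) (hs : s.IsAlt) (hl : l ≤ n) {c : ℕ → F} {a b : ℕ}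
    (ha : a < l) (hb : b < n) (hab : a ≠ b) (hab2 : a / 2 = b / 2)
    (h0 : s (∑ k ∈ Finset.range l, c k • h k) (h b) = 0) : c a = 0 := by
  rw [map_sum, LinearMap.sum_apply, Finset.sum_eq_single a] at h0
  · simpa [hD.apply_ne_zero hs (ha.trans_le hl) hb hab hab2] using h0
  · intro k hk hka
    have hk' := Finset.mem_range.1 hk
    rcases eq_or_ne k b with rfl | hkb
    · simp [hs (h k)]
    · simp [hD.orthogonal k (by omega) b hb (by omega)]
  · simp [ha]

theorem linearIndepOn (hD : IsDarboux s h n) (hs : s.IsAlt) :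
    LinearIndepOn F h (Finset.range n : Set ℕ) := by
  rw [linearIndepOn_finset_iff]
  intro c hc
  have key : ∀ a < n, ∀ b < n, a ≠ b → a / 2 = b / 2 → c a = 0 := fun a ha b hb hab hab2 =>
    hD.coeff_eq_zero hs le_rfl ha hb hab hab2 (by simp [hc])
  intro a ha
  have ha' := Finset.mem_range.1 ha
  rcases Nat.even_or_odd' a with ⟨i, rfl | rfl⟩
  · by_cases hi : 2 * i + 1 < n
    · exact key _ ha' _ hi (by omega) (by omega)
    · rw [Finset.sum_eq_single (2 * i)] at hc
      · exact (smul_eq_zero.1 hc).resolve_right (hD.last_ne_zero i (by omega))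
      · intro k hk hki
        have hk' := Finset.mem_range.1 hk
        rcases Nat.even_or_odd' k with ⟨j, rfl | rfl⟩
        · rw [key _ hk' (2 * j + 1) (by omega) (by omega) (by omega), zero_smul]
        · rw [key _ hk' (2 * j) (by omega) (by omega) (by omega), zero_smul]
      · exact fun hn => absurd ha hn
  · exact key _ ha' (2 * i) (by omega) (by omega) (by omega)

theorem finrank_flag (hD : IsDarboux s h n) (hs : s.IsAlt) : Module.finrank F (flag F h n) = n := by
  rw [flag, Set.image_eq_range]
  exact (finrank_span_eq_card (hD.linearIndepOn hs)).trans (by simp)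

theorem flag_inf_rad (hD : IsDarboux s h n) (hs : s.IsAlt) (hl : l < n ∨ l = n ∧ Even n) :
    flag F h l ⊓ rad s (flag F h n) = ⊥ := by
  rw [eq_bot_iff]
  rintro x ⟨hx, -, hx0⟩
  obtain ⟨c, rfl⟩ := mem_flag_iff.1 hx
  rw [Submodule.mem_bot]
  refine Finset.sum_eq_zero fun a ha => ?_
  have ha' := Finset.mem_range.1 ha
  have hln : l ≤ n := by omega
  rcases Nat.even_or_odd' a with ⟨i, rfl | rfl⟩
  · have hi : 2 * i + 1 < n := by
      rcases hl with hl | ⟨rfl, m, hm⟩ <;> omega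
    rw [hD.coeff_eq_zero hs hln ha' hi (by omega) (by omega) (hx0 _ (apply_mem_flag hi)), zero_smul]
  · have hi : 2 * i < n := by omega
    rw [hD.coeff_eq_zero hs hln ha' hi (by omega) (by omega) (hx0 _ (apply_mem_flag hi)), zero_smul]

theorem rad_flag_even (hD : IsDarboux s h n) (hs : s.IsAlt) (hn : Even n) :
    rad s (flag F h n) = ⊥ := by
  rw [← hD.flag_inf_rad hs (Or.inr ⟨rfl, hn⟩), eq_comm, inf_eq_right]
  exact fun x hx => hx.1

theorem rad_flag_odd {r : ℕ} (hD : IsDarboux s h (2 * r + 1)) (hs : s.IsAlt) :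
    rad s (flag F h (2 * r + 1)) = Submodule.span F {h (2 * r)} := by
  have hmem : h (2 * r) ∈ rad s (flag F h (2 * r + 1)) := by
    refine ⟨apply_mem_flag (by omega), fun y hy => ?_⟩
    obtain ⟨c, rfl⟩ := mem_flag_iff.1 hy
    rw [map_sum]
    refine Finset.sum_eq_zero fun k hk => ?_
    have hk' := Finset.mem_range.1 hk
    rcases eq_or_ne k (2 * r) with rfl | hkr
    · simp [hs (h (2 * r))]
    · simp [hD.orthogonal (2 * r) (by omega) k hk' (by omega)]
  apply le_antisymm
  · intro x hx
    obtain ⟨c, hc⟩ := mem_flag_iff.1 hx.1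
    rw [Finset.sum_range_succ] at hc
    have hy : ∑ k ∈ Finset.range (2 * r), c k • h k ∈
        flag F h (2 * r) ⊓ rad s (flag F h (2 * r + 1)) := by
      refine ⟨mem_flag_iff.2 ⟨c, rfl⟩, ?_⟩
      rw [eq_sub_of_add_eq hc]
      exact Submodule.sub_mem _ hx (Submodule.smul_mem _ _ hmem)
    rw [hD.flag_inf_rad hs (Or.inl (by omega)), Submodule.mem_bot] at hy
    rw [← hc, hy, zero_add]
    exact Submodule.smul_mem _ _ (Submodule.mem_span_singleton_self _)
  · rwa [Submodule.span_singleton_le_iff_mem]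

theorem isHypBasis {r d : ℕ} (hd : d ≤ 1) (hD : IsDarboux s h (2 * r + d)) (hs : s.IsAlt) :
    IsHypBasis s (flag F h (2 * r + d)) r d (fun i => h (2 * i)) (fun j => h (2 * j + 1)) := by
  refine ⟨fun i => apply_mem_flag (by omega), fun j => apply_mem_flag (by omega), fun i j => ?_,
    fun i j => ?_, fun i j => ?_, ?_, ?_, ?_⟩
  · rcases eq_or_ne i j with rfl | hij
    · exact hs _
    · exact hD.orthogonal _ (by omega) _ (by omega) (by omega)
  · rcases eq_or_ne i j with rfl | hij
    · exact hs _
    · exact hD.orthogonal _ (by omega) _ (by omega) (by omega)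
  · split_ifs with hij
    · simp only [hij]
      exact hD.pair _ (by omega)
    · exact hD.orthogonal _ (by omega) _ (by omega) (by omega)
  · have hinj : Function.Injective (Sum.elim
        (fun i : Fin (r + d) => (⟨2 * i, by simp; omega⟩ : (Finset.range (2 * r + d) : Set ℕ)))
        (fun j : Fin r => ⟨2 * j + 1, by simp; omega⟩)) := by
      rintro (i | i) (j | j) hij <;>
        simp only [Sum.elim_inl, Sum.elim_inr, Subtype.mk.injEq] at hij
      · congr 1; omega
      · omega
      · omega
      · congr 1; omega
    convert (hD.linearIndepOn hs).comp _ hinj using 1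
    ext (i | i) <;> rfl
  · rw [range_sum_elim_even_odd hd, flag]
  · interval_cases d
    · rw [rad_flag_even hD hs (by simp)]
      simp
    · rw [rad_flag_odd hD hs, Set.range_unique]
      simp

theorem image_inter_flag (hD : IsDarboux s h n) (hs : s.IsAlt) (hl : l ≤ n) :
    h '' (Finset.range n : Set ℕ) ∩ flag F h l = h '' (Finset.range l : Set ℕ) := by
  ext x
  constructor
  · rintro ⟨⟨k, hk, rfl⟩, hkl⟩
    refine ⟨k, ((hD.mono hl).linearIndepOn hs).mem_span_iff.1 hkl
      ((hD.linearIndepOn hs).mono (Set.insert_subset hk ?_)), rfl⟩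
    simpa using hl
  · rintro ⟨k, hk, rfl⟩
    simp only [Finset.coe_range, Set.mem_Iio] at hk
    exact ⟨⟨k, by simp; omega, rfl⟩, apply_mem_flag hk⟩

end IsDarboux

theorem exists_sub_orthogonal [FiniteDimensional F V] (s : V →ₗ[F] V →ₗ[F] F) {W : Submodule F V}
    (hW : rad s W = ⊥) (w : V) : ∃ u ∈ W, ∀ y ∈ W, s (w - u) y = 0 := by
  have hinj : Function.Injective (s.domRestrict₁₂ W W) := by
    rw [← LinearMap.ker_eq_bot, eq_bot_iff]
    intro x hx
    have hx' : (x : V) ∈ rad s W := ⟨x.2, fun y hy => LinearMap.congr_fun hx ⟨y, hy⟩⟩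
    rw [hW, Submodule.mem_bot] at hx'
    simpa using hx'
  have hsurj := (LinearMap.injective_iff_surjective_of_finrank_eq_finrank
    (Subspace.dual_finrank_eq (K := F) (V := W)).symm).1 hinj
  obtain ⟨u, hu⟩ := hsurj ((s w).domRestrict W)
  refine ⟨u, u.2, fun y hy => ?_⟩
  have := LinearMap.congr_fun hu ⟨y, hy⟩
  simp only [LinearMap.domRestrict₁₂_apply, LinearMap.domRestrict_apply] at this
  rw [map_sub, LinearMap.sub_apply, this, sub_self]

/-- A vector extending an adapted Darboux sequence by one step of the chain. -/
theorem IsDarboux.exists_next [FiniteDimensional F V] {s : V →ₗ[F] V →ₗ[F] F} (hs : s.IsAlt)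
    {h : ℕ → V} {k : ℕ} (hD : IsDarboux s h k) {W : Submodule F V} (hle : flag F h k ≤ W)
    (hW : Module.finrank F W = k + 1) (hinf : flag F h k ⊓ rad s W = ⊥) :
    ∃ v ∈ W, IsDarboux s (Function.update h k v) (k + 1) := by
  rcases Nat.even_or_odd' k with ⟨i, rfl | rfl⟩
  · obtain ⟨w, hw, hwk⟩ : ∃ w ∈ W, w ∉ flag F h (2 * i) := by
      by_contra! hcon
      have := Submodule.finrank_mono (show W ≤ flag F h (2 * i) from hcon)
      rw [hD.finrank_flag hs] at this
      omega
    obtain ⟨u, hu, huw⟩ := exists_sub_orthogonal s (hD.rad_flag_even hs (even_two_mul i)) w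
    have horth : ∀ a < 2 * i, s (w - u) (h a) = 0 := fun a ha => huw _ (apply_mem_flag ha)
    refine ⟨w - u, W.sub_mem hw (hle hu), ⟨fun a ha b hb hab => ?_, fun j hj => ?_, fun j hj => ?_⟩⟩
    · rcases eq_or_ne a (2 * i) with rfl | hai
      · have hb' : b ≠ 2 * i := by omega
        simpa [Function.update_of_ne hb'] using horth b (by omega)
      · rcases eq_or_ne b (2 * i) with rfl | hbi
        · rw [Function.update_self, Function.update_of_ne hai, ← hs.neg, horth a (by omega),
            neg_zero]
        · rw [Function.update_of_ne hai, Function.update_of_ne hbi]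
          exact hD.orthogonal a (by omega) b (by omega) hab
    · rw [Function.update_of_ne (by omega), Function.update_of_ne (by omega)]
      exact hD.pair j (by omega)
    · obtain rfl : j = i := by omega
      rw [Function.update_self, sub_ne_zero]
      rintro rfl
      exact hwk hu
  · have he : h (2 * i) ∈ flag F h (2 * i + 1) := apply_mem_flag (by omega)
    obtain ⟨w, hw, hew⟩ : ∃ w ∈ W, s (h (2 * i)) w = 1 := by
      obtain ⟨w, hw, hew⟩ : ∃ w ∈ W, s (h (2 * i)) w ≠ 0 := by
        by_contra! hcon
        have : h (2 * i) ∈ flag F h (2 * i + 1) ⊓ rad s W := ⟨he, hle he, hcon⟩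
        rw [hinf, Submodule.mem_bot] at this
        exact hD.last_ne_zero i rfl this
      exact ⟨(s (h (2 * i)) w)⁻¹ • w, W.smul_mem _ hw, by simp [hew]⟩
    obtain ⟨u, hu, huw⟩ := exists_sub_orthogonal s
      ((hD.mono (Nat.le_succ (2 * i))).rad_flag_even hs (even_two_mul i)) w
    have horth : ∀ a < 2 * i, s (w - u) (h a) = 0 := fun a ha => huw _ (apply_mem_flag ha)
    have heu : s (h (2 * i)) u = 0 := by
      have := hD.rad_flag_odd hs ▸ Submodule.mem_span_singleton_self (R := F) (h (2 * i))
      exact this.2 u (flag_mono (Nat.le_succ _) hu)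
    refine ⟨w - u, W.sub_mem hw (hle (flag_mono (Nat.le_succ _) hu)),
      ⟨fun a ha b hb hab => ?_, fun j hj => ?_, fun j hj => by omega⟩⟩
    · rcases eq_or_ne a (2 * i + 1) with rfl | hai
      · have hb' : b ≠ 2 * i + 1 := by omega
        simpa [Function.update_of_ne hb'] using horth b (by omega)
      · rcases eq_or_ne b (2 * i + 1) with rfl | hbi
        · rw [Function.update_self, Function.update_of_ne hai, ← hs.neg, horth a (by omega),
            neg_zero]
        · rw [Function.update_of_ne hai, Function.update_of_ne hbi]
          exact hD.orthogonal a (by omega) b (by omega) hab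
    · rw [Function.update_of_ne (by omega)]
      rcases eq_or_ne j i with rfl | hji
      · rw [Function.update_self, map_sub, hew, heu, sub_zero]
      · rw [Function.update_of_ne (by omega)]
        exact hD.pair j (by omega)

theorem exists_isDarboux_of_chain [FiniteDimensional F V] {s : V →ₗ[F] V →ₗ[F] F} (hs : s.IsAlt)
    {W : ℕ → Submodule F V} {n : ℕ} (hfin : ∀ k ≤ n, Module.finrank F (W k) = k)
    (hle : ∀ k < n, W k ≤ W (k + 1)) (hinf : ∀ k < n, W k ⊓ rad s (W (k + 1)) = ⊥) :
    ∃ h : ℕ → V, IsDarboux s h n ∧ ∀ l ≤ n, flag F h l = W l := by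
  suffices ∀ k ≤ n, ∃ h : ℕ → V, IsDarboux s h k ∧ ∀ l ≤ k, flag F h l = W l from this n le_rfl
  intro k
  induction k with
  | zero =>
    intro _
    refine ⟨0, ⟨by omega, by omega, by omega⟩, fun l hl => ?_⟩
    obtain rfl : l = 0 := by omega
    rw [Submodule.finrank_eq_zero.1 (hfin 0 (by omega))]
    simp [flag]
  | succ k ih =>
    intro hk
    obtain ⟨h, hD, hflag⟩ := ih (by omega)
    have hk' := hflag k le_rfl
    obtain ⟨v, hv, hD'⟩ := hD.exists_next hs (hk'.trans_le (hle k (by omega)))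
      (hfin (k + 1) hk) (hk' ▸ hinf k (by omega))
    have hold : ∀ l ≤ k, flag F (Function.update h k v) l = W l := fun l hl => by
      rw [← hflag l hl]
      exact flag_congr fun a ha => Function.update_of_ne (by omega) _ _
    refine ⟨_, hD', fun l hl => ?_⟩
    rcases hl.eq_or_lt with rfl | hlt
    · refine Submodule.eq_of_le_of_finrank_eq (flag_le fun a ha => ?_) ?_
      · rcases eq_or_ne a k with rfl | hak
        · simpa using hv
        · exact hle k (by omega) (hold k le_rfl ▸ apply_mem_flag (by omega))
      · rw [hD'.finrank_flag hs, hfin _ hk]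
    · exact hold l (by omega)

theorem IsChamber.exists_chain [FiniteDimensional F V] {s : V →ₗ[F] V →ₗ[F] F}
    {C : Set (Submodule F V)} (hC : IsChamber s C) :
    ∃ W : ℕ → Submodule F V, (∀ k ≤ Module.finrank F V, Module.finrank F (W k) = k) ∧
      (∀ k < Module.finrank F V, W k ≤ W (k + 1) ∧ W k ⊓ rad s (W (k + 1)) = ⊥) ∧
      ∀ X ∈ C, X = W (Module.finrank F X) := by
  obtain ⟨hobj, hinc, hex⟩ := hC
  have hex' : ∀ k, ∃ W : Submodule F V, k ≤ Module.finrank F V → Module.finrank F W = k ∧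
      (0 < k → k < Module.finrank F V → W ∈ C) := by
    intro k
    rcases Nat.eq_zero_or_pos k with rfl | hk
    · exact ⟨⊥, fun _ => ⟨by simp, by omega⟩⟩
    · rcases lt_trichotomy k (Module.finrank F V) with hlt | rfl | hgt
      · obtain ⟨X, ⟨hX, hXk⟩, -⟩ := hex k hk (by omega)
        exact ⟨X, fun _ => ⟨hXk, fun _ _ => hX⟩⟩
      · exact ⟨⊤, fun _ => ⟨by simp, by omega⟩⟩
      · exact ⟨⊥, by omega⟩
  choose W hW using hex'
  have hfin : ∀ k ≤ Module.finrank F V, Module.finrank F (W k) = k := fun k hk => (hW k hk).1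
  refine ⟨W, hfin, fun k hk => ?_, fun X hX => ?_⟩
  · have h1 := hfin k hk.le
    have h2 := hfin (k + 1) hk
    rcases Nat.eq_zero_or_pos k with rfl | hk0
    · simp [Submodule.finrank_eq_zero.1 h1]
    · have hkC := (hW k hk.le).2 hk0 hk
      rcases hk.nat_succ_le.eq_or_lt with heq | hlt
      · have htop : W (k + 1) = ⊤ := Submodule.eq_top_of_finrank_eq (h2.trans heq)
        rw [htop]
        exact ⟨le_top, (hobj _ hkC).2.2.1⟩
      · have hne : W k ≠ W (k + 1) := fun he => by rw [he] at h1; omega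
        rcases hinc _ hkC _ ((hW (k + 1) hk).2 (by omega) hlt) hne with hi | hi
        · exact hi
        · have := Submodule.finrank_mono hi.1
          omega
  · have hX' := hobj X hX
    have hWX := hW _ hX'.2.1.le
    exact (hex _ hX'.1 (by have := hX'.2.1; omega)).unique ⟨hX, rfl⟩
      ⟨hWX.2 hX'.1 hX'.2.1, hWX.1⟩

theorem IsDarboux.isChamber [FiniteDimensional F V] {s : V →ₗ[F] V →ₗ[F] F} (hs : s.IsAlt)
    {h : ℕ → V} {n : ℕ} (hD : IsDarboux s h n) (hn : Module.finrank F V = n) :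
    IsChamber s {X | ∃ l, 1 ≤ l ∧ l ≤ n - 1 ∧ X = flag F h l} := by
  have htop : flag F h n = ⊤ := Submodule.eq_top_of_finrank_eq (by rw [hD.finrank_flag hs, hn])
  have hfin : ∀ l ≤ n, Module.finrank F (flag F h l) = l := fun l hl =>
    (hD.mono hl).finrank_flag hs
  have hincid : ∀ l m, l < m → m ≤ n →
      flag F h l ≤ flag F h m ∧ flag F h l ⊓ rad s (flag F h m) = ⊥ := fun l m hlm hm =>
    ⟨flag_mono hlm.le, (hD.mono hm).flag_inf_rad hs (Or.inl hlm)⟩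
  refine ⟨?_, ?_, fun k hk1 hk => ?_⟩
  · rintro _ ⟨l, hl1, hl, rfl⟩
    refine ⟨by rw [hfin l (by omega)]; omega, by rw [hfin l (by omega)]; omega,
      htop ▸ (hincid l n (by omega) le_rfl).2, ?_⟩
    have hDl := hD.mono (show l ≤ n by omega)
    rcases Nat.even_or_odd' l with ⟨i, rfl | rfl⟩
    · rw [hDl.rad_flag_even hs (even_two_mul i), finrank_bot]
      exact zero_le_one
    · rw [hDl.rad_flag_odd hs]
      simpa using finrank_span_le_card (R := F) ({h (2 * i)} : Set V)
  · rintro _ ⟨l, hl1, hl, rfl⟩ _ ⟨m, hm1, hm, rfl⟩ hne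
    rcases lt_trichotomy l m with hlm | rfl | hlm
    · exact Or.inl (hincid l m hlm (by omega))
    · exact absurd rfl hne
    · exact Or.inr (hincid m l hlm (by omega))
  · rw [hn] at hk
    refine ⟨flag F h k, ⟨⟨k, hk1, hk, rfl⟩, hfin k (by omega)⟩, ?_⟩
    rintro _ ⟨⟨l, hl1, hl, rfl⟩, hlk⟩
    rw [hfin l (by omega)] at hlk
    rw [hlk]

theorem IsHypBasis.isDarboux {s : V →ₗ[F] V →ₗ[F] F} (hs : s.IsAlt) {U : Submodule F V} {r d : ℕ}
    {e : Fin (r + d) → V} {f : Fin r → V} (hB : IsHypBasis s U r d e f) {h : ℕ → V}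
    (heven : ∀ i : Fin (r + d), 2 * (i : ℕ) < 2 * r + d → h (2 * i) = e i)
    (hodd : ∀ j : Fin r, h (2 * j + 1) = f j) (hd : d ≤ 1) : IsDarboux s h (2 * r + d) := by
  obtain ⟨-, -, hee, hff, hef, hli, -, -⟩ := hB
  have heven' : ∀ i (hi : 2 * i < 2 * r + d), h (2 * i) = e ⟨i, by omega⟩ := fun i hi =>
    heven ⟨i, by omega⟩ hi
  have hodd' : ∀ i (hi : 2 * i + 1 < 2 * r + d), h (2 * i + 1) = f ⟨i, by omega⟩ := fun i hi =>
    hodd ⟨i, by omega⟩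
  refine ⟨fun a ha b hb hab => ?_, fun i hi => ?_, fun i hi => ?_⟩
  · rcases Nat.even_or_odd' a with ⟨i, rfl | rfl⟩ <;> rcases Nat.even_or_odd' b with ⟨j, rfl | rfl⟩
    · rw [heven' i ha, heven' j hb, hee]
    · rw [heven' i ha, hodd' j hb, hef, if_neg]
      simp only
      omega
    · rw [hodd' i ha, heven' j hb, ← hs.neg, hef, if_neg, neg_zero]
      simp only
      omega
    · rw [hodd' i ha, hodd' j hb, hff]
  · rw [heven' i (by omega), hodd' i hi, hef, if_pos rfl]
  · rw [heven' i (by omega)]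
    exact hli.ne_zero (Sum.inl _)

/-- **Hyperbolic bases and chambers.**  (a) For every chamber `C` of `Γ` there is a hyperbolic
basis `H` of `V` such that for each `X ∈ C` the set `H ∩ X` is a hyperbolic basis of `X`.
(b) Conversely, given a hyperbolic basis `(e₁,…,e_{r+d}; f₁,…,f_r)` of `V` (`d ≤ 1`), setting
`h_{2i−1} = eᵢ`, `h_{2j} = fⱼ` (1-based; 0-based, `h k = e(k/2)` for even `k` and `f(k/2)` for
odd `k`), the chain `C_l = span(h₁,…,h_l)`, `1 ≤ l ≤ n−1`, is a chamber of `Γ`. -/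
theorem chambers_and_hyperbolic_bases (F V : Type) [Field F] [AddCommGroup V] [Module F V]
    [FiniteDimensional F V] (s : V →ₗ[F] V →ₗ[F] F) (hs : ∀ v, s v v = 0)
    (hrad : Module.finrank F ↥(rad s (⊤ : Submodule F V)) ≤ 1) :
    ((∀ C : Set (Submodule F V), IsChamber s C →
      ∃ (r d : ℕ) (e : Fin (r + d) → V) (f : Fin r → V),
        IsHypBasis s (⊤ : Submodule F V) r d e f ∧
        ∀ X ∈ C, ∃ (r' d' : ℕ) (e' : Fin (r' + d') → V) (f' : Fin r' → V),
          IsHypBasis s X r' d' e' f' ∧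
          Set.range (Sum.elim e' f') = Set.range (Sum.elim e f) ∩ (X : Set V))) ∧
    (∀ (r d : ℕ), d ≤ 1 → ∀ (e : Fin (r + d) → V) (f : Fin r → V),
      IsHypBasis s (⊤ : Submodule F V) r d e f →
      ∀ h : Fin (2*r + d) → V,
        (∀ k : Fin (2*r + d),
          ((k : ℕ) % 2 = 0 → ∃ hk : (k : ℕ)/2 < r + d, h k = e ⟨(k : ℕ)/2, hk⟩) ∧
          ((k : ℕ) % 2 = 1 → ∃ hk : (k : ℕ)/2 < r, h k = f ⟨(k : ℕ)/2, hk⟩)) →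
        IsChamber s {X : Submodule F V | ∃ l : ℕ, 1 ≤ l ∧ l ≤ (2*r + d) - 1 ∧
          X = Submodule.span F (h '' {k : Fin (2*r + d) | (k : ℕ) < l})}) := by
  have hs' : s.IsAlt := hs
  constructor
  · intro C hC
    obtain ⟨W, hfin, hchain, hCW⟩ := hC.exists_chain
    obtain ⟨h, hD, hflag⟩ := exists_isDarboux_of_chain hs' hfin (fun k hk => (hchain k hk).1)
      (fun k hk => (hchain k hk).2)
    have hdm : ∀ l, 2 * (l / 2) + l % 2 = l := fun l => Nat.div_add_mod l 2
    have hmod : ∀ l, l % 2 ≤ 1 := by omega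
    have hbasis : ∀ l ≤ Module.finrank F V,
        IsHypBasis s (W l) (l / 2) (l % 2) (fun i => h (2 * i)) (fun j => h (2 * j + 1)) :=
      fun l hl => by
        have := IsDarboux.isHypBasis (r := l / 2) (hmod l) (by rw [hdm]; exact hD.mono hl) hs'
        rwa [hdm, hflag l hl] at this
    have htop : W (Module.finrank F V) = ⊤ := Submodule.eq_top_of_finrank_eq (hfin _ le_rfl)
    refine ⟨_, _, _, _, htop ▸ hbasis _ le_rfl, fun X hX => ?_⟩
    have hXn : Module.finrank F X ≤ Module.finrank F V := Submodule.finrank_le X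
    have hX' := hCW X hX
    refine ⟨_, _, _, _, hX'.symm ▸ hbasis _ hXn, ?_⟩
    rw [range_sum_elim_even_odd (hmod _), range_sum_elim_even_odd (hmod _), hdm, hdm,
      ← hD.image_inter_flag hs' hXn, hflag _ hXn, ← hX']
  · intro r d hd e f hB h hh
    have hn : Module.finrank F V = 2 * r + d := by
      have := finrank_span_eq_card hB.2.2.2.2.2.1
      rw [hB.2.2.2.2.2.2.1, finrank_top] at this
      rw [this]
      simp
      omega
    let g : ℕ → V := fun k => if hk : k < 2 * r + d then h ⟨k, hk⟩ else 0
    have hg : ∀ k : Fin (2 * r + d), g k = h k := fun k => by simp [g]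
    have hD : IsDarboux s g (2 * r + d) := by
      refine hB.isDarboux hs' (fun i hi => ?_) (fun j => ?_) hd
      · obtain ⟨hk, heq⟩ := (hh ⟨2 * i, hi⟩).1 (by simp)
        rw [hg ⟨2 * i, hi⟩, heq]
        congr 1
        ext
        simp
      · have hj : 2 * (j : ℕ) + 1 < 2 * r + d := by omega
        obtain ⟨hk, heq⟩ := (hh ⟨2 * j + 1, hj⟩).2 (by simp only; omega)
        rw [hg ⟨2 * j + 1, hj⟩, heq]
        congr 1
        ext
        simp only
        omega
    have himage : ∀ l ≤ 2 * r + d - 1,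
        h '' {k : Fin (2 * r + d) | (k : ℕ) < l} = g '' (Finset.range l : Set ℕ) := by
      intro l hl
      ext x
      constructor
      · rintro ⟨k, hk, rfl⟩
        exact ⟨k, by simpa using hk, hg k⟩
      · rintro ⟨k, hk, rfl⟩
        simp only [Finset.coe_range, Set.mem_Iio] at hk
        exact ⟨⟨k, by omega⟩, hk, (hg ⟨k, by omega⟩).symm⟩
    convert hD.isChamber hs' hn using 1
    ext X
    refine exists_congr fun l => and_congr_right fun _ => and_congr_right fun hl => ?_
    rw [himage l hl, flag]
end
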